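/- Let V : ℝ^d → ℝ be a bounded continuous function with finite Sjöstrand norm, i.e. ∫_{ℝ^d} sup_{x ∈ ℝ^d} |V_g V(x,ξ)| dξ < ∞. For t ∈ ℝ, t ≠ 0, and n ≥ 1 let E_n(t) = ( U₀(t/n) ∘ M_{t/n} )^n and let U(t)φ = lim_{n→∞} E_n(t)φ in L²(ℝ^d) (the Trotter limit). Then: (1) for each n there is a continuous function e_{n,t} : ℝ^d × ℝ^d → ℂ such that E_n(t)φ(x) = ∫_{ℝ^d} e_{n,t}(x,y) φ(y) dy for a.e. x, for every φ ∈ 𝓢(ℝ^d); (2) the functions a_{n,t}(x,y) := e^{−i|x−y|²/(2t)} e_{n,t}(x,y) satisfy sup_{n ≥ 1} ∫_{ℝ^{2d}} sup_{u ∈ ℝ^{2d}} |V_G a_{n,t}(u,ζ)| dζ < ∞ (uniform boundedness in M^{∞,1}(ℝ^{2d})); (3) there is a continuous function u_t : ℝ^d × ℝ^d → ℂ such that e_{n,t} → u_t uniformly on every compact subset of ℝ^{2d}, and U(t)φ(x) = ∫_{ℝ^d} u_t(x,y) φ(y) dy for a.e. x, for every φ ∈ 𝓢(ℝ^d). -/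

import Mathlib

open MeasureTheory Real Filter Topology
open scoped RealInnerProductSpace ENNReal NNReal

noncomputable section

/-- Euclidean space `ℝ^d`. -/
abbrev Euc (d : ℕ) := EuclideanSpace ℝ (Fin d)

/-- `L²(ℝ^d)`. -/
abbrev L2Sp (d : ℕ) := Lp ℂ 2 (volume : Measure (Euc d))

/-- The Gaussian window `g(t) = e^{-π|t|²}` on `ℝ^d`. -/
def gaussWindow {d : ℕ} (t : Euc d) : ℂ := (Real.exp (-π * ‖t‖ ^ 2) : ℝ)

/-- The short-time Fourier transform on `ℝ^d` with Gaussian window: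
`V_g f(x,ξ) = ∫ e^{-2πi ξ·t} f(t) g(t-x) dt`. -/
def STFT {d : ℕ} (f : Euc d → ℂ) (x ξ : Euc d) : ℂ :=
  ∫ (t : Euc d),
    Complex.exp (-(((2 * π * ⟪ξ, t⟫ : ℝ) : ℂ) * Complex.I)) * f t * gaussWindow (t - x)

/-- The Gaussian window `G(u) = e^{-π|u|²}` on `ℝ^{2d} = ℝ^d × ℝ^d`. -/
def gaussWindow2 {d : ℕ} (u : Euc d × Euc d) : ℂ :=
  (Real.exp (-π * (‖u.1‖ ^ 2 + ‖u.2‖ ^ 2)) : ℝ)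

/-- The short-time Fourier transform on `ℝ^{2d} = ℝ^d × ℝ^d` with Gaussian window. -/
def STFT2 {d : ℕ} (f : Euc d × Euc d → ℂ) (u ζ : Euc d × Euc d) : ℂ :=
  ∫ (v : Euc d × Euc d),
    Complex.exp (-(((2 * π * (⟪ζ.1, v.1⟫ + ⟪ζ.2, v.2⟫) : ℝ) : ℂ) * Complex.I)) * f v *
      gaussWindow2 (v - u)

namespace TrotterKernel

/-! ### Gaussian integrals -/

lemma integrable_rexp_sq {d : ℕ} {b : ℝ} (hb : 0 < b) (c : Euc d) :
    Integrable fun x : Euc d => Real.exp (-b * ‖x - c‖ ^ 2) := by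
  have h := GaussianFourier.integrable_cexp_neg_mul_sq_norm_add (V := Euc d) (b := (b : ℂ))
    (by simpa using hb) 0 0
  have h2 := (h.comp_sub_right c).norm
  refine h2.congr (Eventually.of_forall fun x => ?_)
  simp only [zero_mul, add_zero, Complex.norm_exp]
  congr 1
  norm_cast

lemma integral_fourier_cexp_sq {d : ℕ} {b : ℂ} (hb : 0 < b.re) (c ξ : Euc d) :
    ∫ x : Euc d, Complex.exp (-(((2 * π * ⟪ξ, x⟫ : ℝ) : ℂ) * Complex.I)) *
        Complex.exp (-b * ((‖x - c‖ ^ 2 : ℝ) : ℂ)) =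
      Complex.exp (-(((2 * π * ⟪ξ, c⟫ : ℝ) : ℂ) * Complex.I)) * (π / b) ^ ((d : ℂ) / 2) *
        Complex.exp (-(π ^ 2 / b) * ((‖ξ‖ ^ 2 : ℝ) : ℂ)) := by
  have h := GaussianFourier.integral_cexp_neg_mul_sq_norm_add (V := Euc d) hb
    (-(2 * π * Complex.I)) ξ
  have hb0 : b ≠ 0 := by rintro rfl; simp at hb
  rw [finrank_euclideanSpace, Fintype.card_fin] at h
  rw [← integral_add_right_eq_self _ c]
  have : ∀ x : Euc d, Complex.exp (-(((2 * π * ⟪ξ, x + c⟫ : ℝ) : ℂ) * Complex.I)) *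
        Complex.exp (-b * ((‖x + c - c‖ ^ 2 : ℝ) : ℂ)) =
      Complex.exp (-(((2 * π * ⟪ξ, c⟫ : ℝ) : ℂ) * Complex.I)) *
        Complex.exp (-b * ‖x‖ ^ 2 + -(2 * π * Complex.I) * ⟪ξ, x⟫) := by
    intro x
    rw [← Complex.exp_add, ← Complex.exp_add, inner_add_right, add_sub_cancel_right]
    congr 1
    push_cast
    ring
  simp_rw [this]
  have e : (-(2 * π * Complex.I)) ^ 2 * (‖ξ‖ : ℂ) ^ 2 / (4 * b) =
      -(π ^ 2 / b) * ((‖ξ‖ ^ 2 : ℝ) : ℂ) := by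
    rw [neg_sq, mul_pow, mul_pow, Complex.I_sq]
    push_cast
    field_simp
    ring
  rw [integral_const_mul, h, e]
  exact (mul_assoc _ _ _).symm

lemma norm_cexp_neg_mul_sq {d : ℕ} (b : ℂ) (x : Euc d) :
    ‖Complex.exp (-b * ((‖x‖ ^ 2 : ℝ) : ℂ))‖ = Real.exp (-b.re * ‖x‖ ^ 2) := by
  rw [Complex.norm_exp, Complex.re_mul_ofReal, Complex.neg_re]

lemma norm_cexp_neg_ofReal_mul_I (θ : ℝ) : ‖Complex.exp (-((θ : ℂ) * Complex.I))‖ = 1 := by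
  rw [← neg_mul, ← Complex.ofReal_neg, Complex.norm_exp_ofReal_mul_I]

/-! ### Gaussian wave packets and their free evolution -/

/-- The complex width `4 - 2πis` of the wave packets at time `-s`. -/
def width (s : ℝ) : ℂ := 4 - ((2 * π * s : ℝ) : ℂ) * Complex.I

@[simp] lemma width_re (s : ℝ) : (width s).re = 4 := by simp [width]

@[simp] lemma width_im (s : ℝ) : (width s).im = -(2 * π * s) := by
  simp [width]

lemma width_ne_zero (s : ℝ) : width s ≠ 0 := by
  intro h
  have := width_re s
  rw [h] at this
  norm_num at this

lemma normSq_width (s : ℝ) : Complex.normSq (width s) = 16 + (2 * π * s) ^ 2 := by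
  rw [Complex.normSq_apply]; simp; ring

/-- The decay rate of the modulus of the wave packets. -/
def rate (s : ℝ) : ℝ := 4 * π / (16 + (2 * π * s) ^ 2)

lemma rate_pos (s : ℝ) : 0 < rate s := by unfold rate; positivity

lemma pi_div_width_re (s : ℝ) : ((π : ℂ) / width s).re = rate s := by
  rw [Complex.div_re]
  simp [normSq_width, rate]
  ring

lemma pi_div_width_im (s : ℝ) :
    ((π : ℂ) / width s).im = 2 * π ^ 2 * s / (16 + (2 * π * s) ^ 2) := by
  rw [Complex.div_im]
  simp [normSq_width]
  ring

lemma continuous_width : Continuous width := by unfold width; fun_prop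

lemma width_mem_slitPlane (s : ℝ) : width s ∈ Complex.slitPlane := by
  left; simp

/-- The normalization constant of the window. -/
def winConst (d : ℕ) : ℝ := (√(∫ x : Euc d, Real.exp (-(π / 2) * ‖x‖ ^ 2)))⁻¹

lemma winConst_sq (d : ℕ) : winConst d ^ 2 * ∫ x : Euc d, Real.exp (-(π / 2) * ‖x‖ ^ 2) = 1 := by
  have h : 0 < ∫ x : Euc d, Real.exp (-(π / 2) * ‖x‖ ^ 2) := by
    have := integrable_rexp_sq (d := d) (b := π / 2) (by positivity) 0
    simp only [sub_zero] at this
    exact integral_exp_pos this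
  unfold winConst
  rw [inv_pow, Real.sq_sqrt h.le, inv_mul_cancel₀ h.ne']

/-- The amplitude of the wave packets. -/
def amp (d : ℕ) (s : ℝ) : ℂ :=
  winConst d * (4 : ℂ) ^ ((d : ℂ) / 2) / width s ^ ((d : ℂ) / 2)

lemma width_cpow_ne_zero (s : ℝ) (c : ℂ) : width s ^ c ≠ 0 := by
  rw [Complex.cpow_ne_zero_iff]; left; exact width_ne_zero s

lemma continuous_amp (d : ℕ) : Continuous (amp d) := by
  unfold amp
  refine continuous_const.div ?_ (fun s => width_cpow_ne_zero s _)
  exact continuous_width.cpow continuous_const width_mem_slitPlane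

lemma amp_zero (d : ℕ) : amp d 0 = winConst d := by
  have h : width 0 = 4 := by simp [width]
  unfold amp
  rw [h, mul_div_assoc, div_self, mul_one]
  rw [← h]; exact width_cpow_ne_zero 0 _

/-- The centre of the wave packet with parameter `z` at time `-s`. -/
def ctr {d : ℕ} (s : ℝ) (z : Euc d × Euc d) : Euc d := z.1 - (2 * π * s) • z.2

/-- The wave packet with parameter `z`, evolved freely to time `-s`. -/
def packet {d : ℕ} (s : ℝ) (z : Euc d × Euc d) (x : Euc d) : ℂ :=
  amp d s * Complex.exp (((2 * π ^ 2 * s * ‖z.2‖ ^ 2 : ℝ) : ℂ) * Complex.I) *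
    Complex.exp (((2 * π * ⟪z.2, x⟫ : ℝ) : ℂ) * Complex.I) *
    Complex.exp (-(π / width s) * ((‖x - ctr s z‖ ^ 2 : ℝ) : ℂ))

lemma norm_packet {d : ℕ} (s : ℝ) (z : Euc d × Euc d) (x : Euc d) :
    ‖packet s z x‖ = ‖amp d s‖ * Real.exp (-rate s * ‖x - ctr s z‖ ^ 2) := by
  unfold packet
  rw [norm_mul, norm_mul, norm_mul, Complex.norm_exp_ofReal_mul_I, Complex.norm_exp_ofReal_mul_I,
    norm_cexp_neg_mul_sq, pi_div_width_re, mul_one, mul_one]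

lemma continuous_packet {d : ℕ} (s : ℝ) :
    Continuous fun p : (Euc d × Euc d) × Euc d => packet s p.1 p.2 := by
  unfold packet ctr
  fun_prop

lemma continuous_packet_left {d : ℕ} (s : ℝ) (x : Euc d) :
    Continuous fun z : Euc d × Euc d => packet s z x := by
  unfold packet ctr
  fun_prop

lemma continuous_packet_right {d : ℕ} (s : ℝ) (z : Euc d × Euc d) :
    Continuous (packet s z) := by
  unfold packet
  fun_prop

lemma integrable_packet {d : ℕ} (s : ℝ) (z : Euc d × Euc d) : Integrable (packet s z) := by
  have h := (integrable_rexp_sq (rate_pos s) (ctr s z)).const_mul ‖amp d s‖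
  refine h.mono' (continuous_packet_right s z).aestronglyMeasurable
    (Eventually.of_forall fun x => ?_)
  rw [norm_packet]

lemma memLp_packet {d : ℕ} (s : ℝ) (z : Euc d × Euc d) : MemLp (packet s z) 2 := by
  rw [memLp_two_iff_integrable_sq_norm (continuous_packet_right s z).aestronglyMeasurable]
  have h := (integrable_rexp_sq (b := 2 * rate s) (by have := rate_pos s; positivity)
    (ctr s z)).const_mul (‖amp d s‖ ^ 2)
  refine h.congr (Eventually.of_forall fun x => ?_)
  simp only [norm_packet, mul_pow, ← Real.exp_nat_mul]
  congr 2
  push_cast; ring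

/-- The wave packet as an element of `L²`. -/
def wp {d : ℕ} (s : ℝ) (z : Euc d × Euc d) : L2Sp d := (memLp_packet s z).toLp _

lemma coeFn_wp {d : ℕ} (s : ℝ) (z : Euc d × Euc d) :
    (wp s z : Euc d → ℂ) =ᵐ[volume] packet s z := MemLp.coeFn_toLp _

lemma fourier_packet {d : ℕ} (s : ℝ) (z : Euc d × Euc d) (ξ : Euc d) :
    ∫ x, Complex.exp (-(((2 * π * ⟪ξ, x⟫ : ℝ) : ℂ) * Complex.I)) * packet s z x =
      winConst d * (4 : ℂ) ^ ((d : ℂ) / 2) *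
        Complex.exp (((2 * π ^ 2 * s * ‖ξ‖ ^ 2 : ℝ) : ℂ) * Complex.I) *
        Complex.exp (-(((2 * π * ⟪ξ - z.2, z.1⟫ : ℝ) : ℂ) * Complex.I)) *
        Complex.exp (-((4 * π * ‖ξ - z.2‖ ^ 2 : ℝ) : ℂ)) := by
  have hb : 0 < ((π : ℂ) / width s).re := by rw [pi_div_width_re]; exact rate_pos s
  have h := integral_fourier_cexp_sq hb (ctr s z) (ξ - z.2)
  have h1 : ∀ x, Complex.exp (-(((2 * π * ⟪ξ, x⟫ : ℝ) : ℂ) * Complex.I)) * packet s z x =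
      (amp d s * Complex.exp (((2 * π ^ 2 * s * ‖z.2‖ ^ 2 : ℝ) : ℂ) * Complex.I)) *
      (Complex.exp (-(((2 * π * ⟪ξ - z.2, x⟫ : ℝ) : ℂ) * Complex.I)) *
        Complex.exp (-(π / width s) * ((‖x - ctr s z‖ ^ 2 : ℝ) : ℂ))) := by
    intro x
    have : Complex.exp (-(((2 * π * ⟪ξ - z.2, x⟫ : ℝ) : ℂ) * Complex.I)) =
        Complex.exp (-(((2 * π * ⟪ξ, x⟫ : ℝ) : ℂ) * Complex.I)) *
        Complex.exp (((2 * π * ⟪z.2, x⟫ : ℝ) : ℂ) * Complex.I) := by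
      rw [← Complex.exp_add, inner_sub_left]; congr 1; push_cast; ring
    rw [this]; unfold packet; ring
  have hw := width_ne_zero s
  have hpi : (π : ℂ) ≠ 0 := by exact_mod_cast pi_ne_zero
  have h2 : (π : ℂ) / (π / width s) = width s := by field_simp
  have h3 : (π : ℂ) ^ 2 / (π / width s) = π * width s := by field_simp
  simp_rw [h1]
  rw [integral_const_mul, h, h2, h3]
  unfold amp
  have hcp := width_cpow_ne_zero s ((d : ℂ) / 2)
  have key : Complex.exp (((2 * π ^ 2 * s * ‖z.2‖ ^ 2 : ℝ) : ℂ) * Complex.I) *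
      Complex.exp (-(((2 * π * ⟪ξ - z.2, ctr s z⟫ : ℝ) : ℂ) * Complex.I)) *
      Complex.exp (-(π * width s) * ((‖ξ - z.2‖ ^ 2 : ℝ) : ℂ)) =
      Complex.exp (((2 * π ^ 2 * s * ‖ξ‖ ^ 2 : ℝ) : ℂ) * Complex.I) *
        Complex.exp (-(((2 * π * ⟪ξ - z.2, z.1⟫ : ℝ) : ℂ) * Complex.I)) *
        Complex.exp (-((4 * π * ‖ξ - z.2‖ ^ 2 : ℝ) : ℂ)) := by
    simp only [← Complex.exp_add]
    congr 1
    have e1 : ⟪ξ - z.2, ctr s z⟫ = ⟪ξ - z.2, z.1⟫ - (2 * π * s) * (⟪ξ, z.2⟫ - ‖z.2‖ ^ 2) := by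
      unfold ctr
      rw [inner_sub_right, real_inner_smul_right, inner_sub_left ξ z.2 z.2,
        real_inner_self_eq_norm_sq]
    have e2 : ‖ξ - z.2‖ ^ 2 = ‖ξ‖ ^ 2 - 2 * ⟪ξ, z.2⟫ + ‖z.2‖ ^ 2 := norm_sub_sq_real _ _
    rw [e1, e2]
    unfold width
    push_cast
    ring
  calc _ = winConst d * (4 : ℂ) ^ ((d : ℂ) / 2) *
      (Complex.exp (((2 * π ^ 2 * s * ‖z.2‖ ^ 2 : ℝ) : ℂ) * Complex.I) *
      Complex.exp (-(((2 * π * ⟪ξ - z.2, ctr s z⟫ : ℝ) : ℂ) * Complex.I)) *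
      Complex.exp (-(π * width s) * ((‖ξ - z.2‖ ^ 2 : ℝ) : ℂ))) := by
        field_simp
    _ = _ := by rw [key]; ring

end TrotterKernel

namespace TrotterKernel

/-- `F` is the Fourier–Plancherel transform and `U₀` the free Schrödinger group. -/
structure IsFree {d : ℕ} (F : L2Sp d ≃ₗᵢ[ℂ] L2Sp d) (U₀ : ℝ → L2Sp d →L[ℂ] L2Sp d) : Prop where
  fourier : ∀ f : L2Sp d, Integrable (f : Euc d → ℂ) →
      (F f : Euc d → ℂ) =ᵐ[volume] fun ξ =>
        ∫ x, Complex.exp (-(((2 * π * ⟪ξ, x⟫ : ℝ) : ℂ) * Complex.I)) * f x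
  free : ∀ (τ : ℝ) (f : L2Sp d),
      (F (U₀ τ f) : Euc d → ℂ) =ᵐ[volume] fun ξ =>
        Complex.exp (-(((2 * π ^ 2 * τ * ‖ξ‖ ^ 2 : ℝ) : ℂ) * Complex.I)) *
          (F f : Euc d → ℂ) ξ

lemma continuous_of_inner_of_norm {X H : Type*} [TopologicalSpace X] [NormedAddCommGroup H]
    [InnerProductSpace ℂ H] {φ : X → H} {c : ℝ} (hc : ∀ x, ‖φ x‖ = c)
    (hw : ∀ f, Continuous fun x => inner ℂ f (φ x)) : Continuous φ := by
  rw [continuous_iff_continuousAt]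
  intro x₀
  rw [ContinuousAt, tendsto_iff_norm_sub_tendsto_zero]
  have h1 : ∀ x, ‖φ x - φ x₀‖ = √(2 * c ^ 2 - 2 * (inner ℂ (φ x₀) (φ x)).re) := by
    intro x
    rw [← Real.sqrt_sq (norm_nonneg (φ x - φ x₀)), norm_sub_rev, @norm_sub_sq ℂ, hc, hc]
    congr 1
    simp only [RCLike.re_to_complex]
    ring
  simp_rw [h1]
  have h2 : Continuous fun x => √(2 * c ^ 2 - 2 * (inner ℂ (φ x₀) (φ x)).re) := by
    have := hw (φ x₀)
    have h3 := Complex.continuous_re.comp this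
    exact (continuous_const.sub (continuous_const.mul h3)).sqrt
  have h4 := h2.tendsto x₀
  have h5 : 2 * c ^ 2 - 2 * (inner ℂ (φ x₀) (φ x₀)).re = 0 := by
    have := inner_self_eq_norm_sq (𝕜 := ℂ) (φ x₀)
    rw [RCLike.re_to_complex] at this
    rw [this, hc]; ring
  rw [h5, Real.sqrt_zero] at h4
  exact h4

namespace IsFree

variable {d : ℕ} {F : L2Sp d ≃ₗᵢ[ℂ] L2Sp d} {U₀ : ℝ → L2Sp d →L[ℂ] L2Sp d}

lemma fourier_wp (h : IsFree F U₀) (s : ℝ) (z : Euc d × Euc d) :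
    (F (wp s z) : Euc d → ℂ) =ᵐ[volume] fun ξ => winConst d * (4 : ℂ) ^ ((d : ℂ) / 2) *
        Complex.exp (((2 * π ^ 2 * s * ‖ξ‖ ^ 2 : ℝ) : ℂ) * Complex.I) *
        Complex.exp (-(((2 * π * ⟪ξ - z.2, z.1⟫ : ℝ) : ℂ) * Complex.I)) *
        Complex.exp (-((4 * π * ‖ξ - z.2‖ ^ 2 : ℝ) : ℂ)) := by
  have h1 := h.fourier (wp s z) ((integrable_packet s z).congr (coeFn_wp s z).symm)
  filter_upwards [h1] with ξ hξ
  rw [hξ, ← fourier_packet]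
  refine integral_congr_ae ?_
  filter_upwards [coeFn_wp s z] with x hx
  rw [hx]

lemma apply_wp (h : IsFree F U₀) (σ s : ℝ) (z : Euc d × Euc d) :
    U₀ σ (wp s z) = wp (s - σ) z := by
  apply F.injective
  apply Lp.ext
  filter_upwards [h.free σ (wp s z), h.fourier_wp s z, h.fourier_wp (s - σ) z] with ξ h1 h2 h3
  rw [h1, h2, h3]
  have : Complex.exp (((2 * π ^ 2 * (s - σ) * ‖ξ‖ ^ 2 : ℝ) : ℂ) * Complex.I) =
      Complex.exp (-(((2 * π ^ 2 * σ * ‖ξ‖ ^ 2 : ℝ) : ℂ) * Complex.I)) *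
      Complex.exp (((2 * π ^ 2 * s * ‖ξ‖ ^ 2 : ℝ) : ℂ) * Complex.I) := by
    rw [← Complex.exp_add]; congr 1; push_cast; ring
  rw [this]; ring

lemma apply_apply (h : IsFree F U₀) (s σ : ℝ) (f : L2Sp d) :
    U₀ s (U₀ σ f) = U₀ (s + σ) f := by
  apply F.injective
  apply Lp.ext
  filter_upwards [h.free s (U₀ σ f), h.free σ f, h.free (s + σ) f] with ξ h1 h2 h3
  rw [h1, h2, h3, ← mul_assoc, ← Complex.exp_add]
  congr 2
  push_cast; ring

lemma zero_apply (h : IsFree F U₀) (f : L2Sp d) : U₀ 0 f = f := by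
  apply F.injective
  apply Lp.ext
  filter_upwards [h.free 0 f] with ξ h1
  rw [h1]
  simp

lemma norm_apply (h : IsFree F U₀) (s : ℝ) (f : L2Sp d) : ‖U₀ s f‖ = ‖f‖ := by
  rw [← F.norm_map, ← F.norm_map f, Lp.norm_def, Lp.norm_def]
  congr 1
  refine eLpNorm_congr_norm_ae ?_
  filter_upwards [h.free s f] with ξ h1
  rw [h1, norm_mul, norm_cexp_neg_ofReal_mul_I, one_mul]

lemma inner_apply (h : IsFree F U₀) (s : ℝ) (f g : L2Sp d) :
    inner ℂ (U₀ s f) g = inner ℂ f (U₀ (-s) g) := by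
  let L : L2Sp d →ₗᵢ[ℂ] L2Sp d := ⟨(U₀ (-s)).toLinearMap, h.norm_apply (-s)⟩
  have := L.inner_map_map (U₀ s f) g
  rw [← this]
  change inner ℂ (U₀ (-s) (U₀ s f)) (U₀ (-s) g) = _
  rw [h.apply_apply, neg_add_cancel, h.zero_apply]

lemma continuous_apply (h : IsFree F U₀) (f : L2Sp d) : Continuous fun s => U₀ s f := by
  refine continuous_of_inner_of_norm (c := ‖f‖) (fun s => h.norm_apply s f) fun g => ?_
  have h1 : ∀ s, inner ℂ g (U₀ s f) = ∫ ξ, inner ℂ (F g ξ)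
      (Complex.exp (-(((2 * π ^ 2 * s * ‖ξ‖ ^ 2 : ℝ) : ℂ) * Complex.I)) * F f ξ) := by
    intro s
    rw [← F.inner_map_map, L2.inner_def]
    refine integral_congr_ae ?_
    filter_upwards [h.free s f] with ξ hξ
    rw [hξ]
  simp_rw [h1]
  refine continuous_of_dominated (bound := fun ξ => ‖inner ℂ (F g ξ) (F f ξ)‖) ?_ ?_ ?_ ?_
  · intro s
    refine (Lp.aestronglyMeasurable _).inner (AEStronglyMeasurable.mul ?_
      (Lp.aestronglyMeasurable _))
    exact Continuous.aestronglyMeasurable (by fun_prop)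
  · intro s
    refine Eventually.of_forall fun ξ => le_of_eq ?_
    rw [← smul_eq_mul, inner_smul_right, norm_mul, norm_cexp_neg_ofReal_mul_I, one_mul]
  · exact (L2.integrable_inner _ _).norm
  · refine Eventually.of_forall fun ξ => ?_
    exact Continuous.inner continuous_const (by fun_prop)

lemma continuous_uncurry (h : IsFree F U₀) : Continuous fun p : ℝ × L2Sp d => U₀ p.1 p.2 := by
  rw [continuous_iff_continuousAt]
  rintro ⟨s₀, f₀⟩
  rw [ContinuousAt, tendsto_iff_norm_sub_tendsto_zero]
  have h1 : Tendsto (fun p : ℝ × L2Sp d => ‖p.2 - f₀‖ + ‖U₀ p.1 f₀ - U₀ s₀ f₀‖) (𝓝 (s₀, f₀))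
      (𝓝 (‖f₀ - f₀‖ + ‖U₀ s₀ f₀ - U₀ s₀ f₀‖)) := by
    have h2 : Continuous fun p : ℝ × L2Sp d => ‖p.2 - f₀‖ + ‖U₀ p.1 f₀ - U₀ s₀ f₀‖ := by
      have := (h.continuous_apply f₀).comp (continuous_fst (X := ℝ) (Y := L2Sp d))
      exact ((continuous_snd.sub continuous_const).norm).add ((this.sub continuous_const).norm)
    exact h2.tendsto (s₀, f₀)
  rw [sub_self, sub_self, norm_zero, add_zero] at h1
  refine squeeze_zero (fun _ => norm_nonneg _) (fun p => ?_) h1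
  calc ‖U₀ p.1 p.2 - U₀ s₀ f₀‖ = ‖U₀ p.1 (p.2 - f₀) + (U₀ p.1 f₀ - U₀ s₀ f₀)‖ := by
        rw [map_sub]; congr 1; abel
    _ ≤ _ := by rw [← h.norm_apply p.1 (p.2 - f₀)]; exact norm_add_le _ _

end IsFree

/-! ### The wave packets form a continuous Parseval frame -/

lemma packet_zero {d : ℕ} (z : Euc d × Euc d) (x : Euc d) :
    packet 0 z x = winConst d * Complex.exp (((2 * π * ⟪z.2, x⟫ : ℝ) : ℂ) * Complex.I) *
      ((Real.exp (-(π / 4) * ‖x - z.1‖ ^ 2) : ℝ) : ℂ) := by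
  unfold packet
  rw [amp_zero]
  simp [ctr, width]

lemma norm_packet_zero {d : ℕ} (z : Euc d × Euc d) (x : Euc d) :
    ‖packet 0 z x‖ = winConst d * Real.exp (-(π / 4) * ‖x - z.1‖ ^ 2) := by
  have : 0 ≤ winConst d := by unfold winConst; positivity
  rw [packet_zero, norm_mul, norm_mul, Complex.norm_exp_ofReal_mul_I, Complex.norm_real,
    Complex.norm_real, Real.norm_of_nonneg this, Real.norm_of_nonneg (Real.exp_pos _).le, mul_one]

lemma integral_norm_packet_sq {d : ℕ} (y : Euc d) :
    ∫ z : Euc d, (winConst d * Real.exp (-(π / 4) * ‖y - z‖ ^ 2)) ^ 2 = 1 := by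
  rw [← winConst_sq d, ← integral_const_mul, ← integral_sub_left_eq_self _ _ y]
  refine integral_congr_ae (Eventually.of_forall fun z => ?_)
  simp only [mul_pow, ← Real.exp_nat_mul]
  congr 2
  rw [sub_sub_cancel]
  push_cast; ring

lemma norm_wp_zero {d : ℕ} (z : Euc d × Euc d) : ‖wp 0 z‖ = 1 := by
  have h : ‖wp 0 z‖ ^ 2 = 1 := by
    rw [← inner_self_eq_norm_sq (𝕜 := ℂ), L2.inner_def]
    have : ∫ x, inner ℂ ((wp 0 z : L2Sp d) x) ((wp 0 z : L2Sp d) x) =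
        ∫ x, (((winConst d * Real.exp (-(π / 4) * ‖z.1 - x‖ ^ 2)) ^ 2 : ℝ) : ℂ) := by
      refine integral_congr_ae ?_
      filter_upwards [coeFn_wp 0 z] with x hx
      rw [hx, inner_self_eq_norm_sq_to_K, norm_packet_zero, norm_sub_rev]
      rw [Complex.ofReal_pow]; rfl
    rw [this, integral_complex_ofReal, integral_norm_packet_sq]
    simp
  nlinarith [norm_nonneg (wp 0 z)]

lemma inner_wp {d : ℕ} (s : ℝ) (z : Euc d × Euc d) (f : L2Sp d) :
    inner ℂ (wp s z) f = ∫ x, (starRingEnd ℂ) (packet s z x) * f x := by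
  rw [L2.inner_def]
  refine integral_congr_ae ?_
  filter_upwards [coeFn_wp s z] with x hx
  rw [hx, RCLike.inner_apply']

lemma exp_neg_sq_le {E : Type*} [NormedAddCommGroup E] {b R : ℝ} (hb : 0 ≤ b) (v y : E)
    (hy : ‖y‖ ≤ R) : Real.exp (-b * ‖v - y‖ ^ 2) ≤
      Real.exp (b * R ^ 2) * Real.exp (-(b / 2) * ‖v‖ ^ 2) := by
  rw [← Real.exp_add]
  apply Real.exp_le_exp.mpr
  have h1 : ‖v‖ ≤ ‖v - y‖ + R := by
    calc ‖v‖ = ‖(v - y) + y‖ := by rw [sub_add_cancel]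
      _ ≤ ‖v - y‖ + ‖y‖ := norm_add_le _ _
      _ ≤ _ := by linarith
  have h2 : ‖v‖ ^ 2 ≤ 2 * ‖v - y‖ ^ 2 + 2 * R ^ 2 := by
    nlinarith [norm_nonneg v, sq_nonneg (‖v - y‖ - R), norm_nonneg (v - y)]
  nlinarith

lemma continuous_inner_wp {d : ℕ} (f : L2Sp d) :
    Continuous fun z : Euc d × Euc d => inner ℂ f (wp 0 z) := by
  suffices h : Continuous fun z : Euc d × Euc d => inner ℂ (wp 0 z) f by
    have := Complex.continuous_conj.comp h
    refine this.congr fun z => ?_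
    simp
  simp_rw [inner_wp]
  rw [continuous_iff_continuousAt]
  intro z₀
  have hm : MemLp (fun x : Euc d => winConst d * Real.exp (π / 4) *
      Real.exp (-(π / 8) * ‖x - z₀.1‖ ^ 2)) 2 := by
    rw [memLp_two_iff_integrable_sq (by fun_prop)]
    have h := (integrable_rexp_sq (b := π / 4) (by positivity) z₀.1).const_mul
      ((winConst d * Real.exp (π / 4)) ^ 2)
    refine h.congr (Eventually.of_forall fun x => ?_)
    simp only [mul_pow, ← Real.exp_nat_mul]
    congr 2
    push_cast; ring
  refine continuousAt_of_dominated (bound := fun x => winConst d * Real.exp (π / 4) *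
      Real.exp (-(π / 8) * ‖x - z₀.1‖ ^ 2) * ‖f x‖) ?_ ?_ ?_ ?_
  · refine Eventually.of_forall fun z => AEStronglyMeasurable.mul ?_ (Lp.aestronglyMeasurable _)
    exact (Complex.continuous_conj.comp (continuous_packet_right 0 z)).aestronglyMeasurable
  · have : ∀ᶠ z in 𝓝 z₀, ‖z - z₀‖ ≤ 1 := by
      have := Metric.closedBall_mem_nhds z₀ one_pos
      filter_upwards [this] with z hz
      rwa [Metric.mem_closedBall, dist_eq_norm] at hz
    filter_upwards [this] with z hz
    refine Eventually.of_forall fun x => ?_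
    have hz1 : ‖z.1 - z₀.1‖ ≤ 1 := (norm_fst_le (z - z₀)).trans hz
    have := exp_neg_sq_le (b := π / 4) (by positivity) (x - z₀.1) (z.1 - z₀.1) hz1
    rw [sub_sub_sub_cancel_right, one_pow, mul_one, div_div, show (4 : ℝ) * 2 = 8 by norm_num]
      at this
    rw [norm_mul, RCLike.norm_conj, norm_packet_zero]
    have h0 : 0 ≤ winConst d := by unfold winConst; positivity
    refine mul_le_mul_of_nonneg_right ?_ (norm_nonneg _)
    rw [mul_assoc (winConst d)]
    exact mul_le_mul_of_nonneg_left this h0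
  · exact (hm.integrable_mul (Lp.memLp f).norm)
  · refine Eventually.of_forall fun x => ?_
    exact ((Complex.continuous_conj.comp (continuous_packet_left 0 x)).mul
      continuous_const).continuousAt

lemma continuous_wp {d : ℕ} : Continuous fun z : Euc d × Euc d => wp 0 z :=
  continuous_of_inner_of_norm (c := 1) norm_wp_zero continuous_inner_wp

end TrotterKernel

namespace TrotterKernel

lemma eLpNorm_two_sq {α : Type*} [MeasurableSpace α] (μ : Measure α) (f : α → ℂ) :
    eLpNorm f 2 μ ^ 2 = ∫⁻ x, ‖f x‖ₑ ^ 2 ∂μ := by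
  have h := eLpNorm_nnreal_pow_eq_lintegral (f := f) (μ := μ) (p := 2) (by norm_num)
  simpa using h

/-- The product of `f` with the window centred at `y`. -/
def windowed {d : ℕ} (f : L2Sp d) (y : Euc d) (x : Euc d) : ℂ :=
  ((winConst d * Real.exp (-(π / 4) * ‖x - y‖ ^ 2) : ℝ) : ℂ) * f x

lemma winConst_nonneg (d : ℕ) : 0 ≤ winConst d := by unfold winConst; positivity

lemma enorm_windowed {d : ℕ} (f : L2Sp d) (y x : Euc d) : ‖windowed f y x‖ₑ ^ 2 =
    ENNReal.ofReal ((winConst d * Real.exp (-(π / 4) * ‖x - y‖ ^ 2)) ^ 2) * ‖f x‖ₑ ^ 2 := by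
  have := mul_nonneg (winConst_nonneg d) (Real.exp_pos (-(π / 4) * ‖x - y‖ ^ 2)).le
  unfold windowed
  rw [enorm_mul, mul_pow, ENNReal.ofReal_pow this, ← ofReal_norm, Complex.norm_real,
    Real.norm_of_nonneg this]

lemma lintegral_winConst_exp {d : ℕ} (x : Euc d) :
    ∫⁻ y : Euc d, ENNReal.ofReal ((winConst d * Real.exp (-(π / 4) * ‖x - y‖ ^ 2)) ^ 2) = 1 := by
  rw [← ofReal_integral_eq_lintegral_ofReal, integral_norm_packet_sq, ENNReal.ofReal_one]
  · have h := (integrable_rexp_sq (b := π / 2) (by positivity) x).const_mul (winConst d ^ 2)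
    refine h.congr (Eventually.of_forall fun y => ?_)
    simp only [mul_pow, ← Real.exp_nat_mul, norm_sub_rev x]
    congr 2
    push_cast; ring
  · exact Eventually.of_forall fun y => sq_nonneg _

lemma memLp_window {d : ℕ} (y : Euc d) :
    MemLp (fun x : Euc d => ((winConst d * Real.exp (-(π / 4) * ‖x - y‖ ^ 2) : ℝ) : ℂ)) 2 := by
  have hr : MemLp (fun x : Euc d => winConst d * Real.exp (-(π / 4) * ‖x - y‖ ^ 2)) 2 := by
    rw [memLp_two_iff_integrable_sq (by fun_prop)]
    have h := (integrable_rexp_sq (b := π / 2) (by positivity) y).const_mul (winConst d ^ 2)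
    refine h.congr (Eventually.of_forall fun y => ?_)
    simp only [mul_pow, ← Real.exp_nat_mul]
    congr 2
    push_cast; ring
  exact hr.ofReal

lemma integrable_windowed {d : ℕ} (f : L2Sp d) (y : Euc d) : Integrable (windowed f y) :=
  (memLp_window y).integrable_mul (Lp.memLp f)

lemma aestronglyMeasurable_windowed {d : ℕ} (f : L2Sp d) (y : Euc d) :
    AEStronglyMeasurable (windowed f y) := (integrable_windowed f y).aestronglyMeasurable

lemma memLp_windowed {d : ℕ} (f : L2Sp d) (y : Euc d) : MemLp (windowed f y) 2 := by
  refine MemLp.of_le_mul (g := (f : Euc d → ℂ)) (c := winConst d) (Lp.memLp f)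
    (aestronglyMeasurable_windowed f y) (Eventually.of_forall fun x => ?_)
  unfold windowed
  rw [norm_mul, Complex.norm_real, Real.norm_of_nonneg
    (mul_nonneg (winConst_nonneg d) (Real.exp_pos _).le)]
  refine mul_le_mul_of_nonneg_right ?_ (norm_nonneg _)
  refine mul_le_of_le_one_right (winConst_nonneg d) ?_
  rw [Real.exp_le_one_iff]
  have : 0 ≤ π / 4 * ‖x - y‖ ^ 2 := by positivity
  linarith

lemma inner_wp_zero {d : ℕ} (z : Euc d × Euc d) (f : L2Sp d) : inner ℂ (wp 0 z) f =
    ∫ x, Complex.exp (-(((2 * π * ⟪z.2, x⟫ : ℝ) : ℂ) * Complex.I)) * windowed f z.1 x := by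
  rw [inner_wp]
  refine integral_congr_ae (Eventually.of_forall fun x => ?_)
  simp only [packet_zero, windowed, map_mul, ← Complex.exp_conj, Complex.conj_ofReal,
    Complex.conj_I, mul_neg, Complex.ofReal_mul]
  ring

lemma IsFree.lintegral_inner_wp_sq {d : ℕ} {F : L2Sp d ≃ₗᵢ[ℂ] L2Sp d}
    {U₀ : ℝ → L2Sp d →L[ℂ] L2Sp d} (h : IsFree F U₀) (f : L2Sp d) :
    ∫⁻ z : Euc d × Euc d, ‖(inner ℂ (wp 0 z) f : ℂ)‖ₑ ^ 2 = ‖f‖ₑ ^ 2 := by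
  have hc : Continuous fun z : Euc d × Euc d => (inner ℂ (wp 0 z) f : ℂ) :=
    continuous_wp.inner continuous_const
  rw [Measure.volume_eq_prod, lintegral_prod _
    (hc.enorm.measurable.pow_const 2).aemeasurable]
  have h1 : ∀ y : Euc d, ∫⁻ ζ : Euc d, ‖(inner ℂ (wp 0 (y, ζ)) f : ℂ)‖ₑ ^ 2 =
      ∫⁻ x : Euc d, ENNReal.ofReal ((winConst d * Real.exp (-(π / 4) * ‖x - y‖ ^ 2)) ^ 2) *
        ‖f x‖ₑ ^ 2 := by
    intro y
    let q : L2Sp d := (memLp_windowed f y).toLp _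
    have hq : (q : Euc d → ℂ) =ᵐ[volume] windowed f y := MemLp.coeFn_toLp _
    have h2 := h.fourier q ((integrable_windowed f y).congr hq.symm)
    have h3 : ∫⁻ ζ, ‖(F q : Euc d → ℂ) ζ‖ₑ ^ 2 = ∫⁻ x, ‖(q : Euc d → ℂ) x‖ₑ ^ 2 := by
      rw [← eLpNorm_two_sq, ← eLpNorm_two_sq, ← Lp.enorm_def, ← Lp.enorm_def, ← ofReal_norm,
        ← ofReal_norm, F.norm_map]
    have h4 : ∫⁻ ζ : Euc d, ‖(inner ℂ (wp 0 (y, ζ)) f : ℂ)‖ₑ ^ 2 =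
        ∫⁻ ζ, ‖(F q : Euc d → ℂ) ζ‖ₑ ^ 2 := by
      refine lintegral_congr_ae ?_
      filter_upwards [h2] with ζ hζ
      rw [hζ, inner_wp_zero]
      congr 2
      refine integral_congr_ae ?_
      filter_upwards [hq] with x hx
      rw [hx]
    rw [h4, h3]
    refine lintegral_congr_ae ?_
    filter_upwards [hq] with x hx
    rw [hx, enorm_windowed]
  simp_rw [h1]
  rw [lintegral_lintegral_swap]
  · have : ∀ x : Euc d, ∫⁻ y : Euc d, ENNReal.ofReal
        ((winConst d * Real.exp (-(π / 4) * ‖x - y‖ ^ 2)) ^ 2) * ‖f x‖ₑ ^ 2 = ‖f x‖ₑ ^ 2 := by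
      intro x
      rw [lintegral_mul_const' _ _ (by simp), lintegral_winConst_exp, one_mul]
    simp_rw [this]
    rw [← eLpNorm_two_sq, ← Lp.enorm_def]
  · refine AEMeasurable.fun_mul (f := fun p : Euc d × Euc d => ENNReal.ofReal
      ((winConst d * Real.exp (-(π / 4) * ‖p.2 - p.1‖ ^ 2)) ^ 2)) ?_ ?_
    · exact Measurable.aemeasurable (by fun_prop)
    · exact ((Lp.aestronglyMeasurable f).enorm.comp_snd).pow_const 2

lemma memLp_inner_wp {d : ℕ} {F : L2Sp d ≃ₗᵢ[ℂ] L2Sp d}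
    {U₀ : ℝ → L2Sp d →L[ℂ] L2Sp d} (h : IsFree F U₀) (f : L2Sp d) :
    MemLp (fun z : Euc d × Euc d => (inner ℂ (wp 0 z) f : ℂ)) 2 := by
  refine ⟨(continuous_wp.inner continuous_const).aestronglyMeasurable, ?_⟩
  have h1 := eLpNorm_two_sq volume (fun z : Euc d × Euc d => (inner ℂ (wp 0 z) f : ℂ))
  rw [h.lintegral_inner_wp_sq] at h1
  by_contra hcon
  rw [not_lt, top_le_iff] at hcon
  rw [hcon] at h1
  simp at h1
  exact absurd h1.symm (by simp)

/-- The wave packet transform as a linear isometry. -/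
def transform {d : ℕ} {F : L2Sp d ≃ₗᵢ[ℂ] L2Sp d}
    {U₀ : ℝ → L2Sp d →L[ℂ] L2Sp d} (h : IsFree F U₀) :
    L2Sp d →ₗᵢ[ℂ] Lp ℂ 2 (volume : Measure (Euc d × Euc d)) where
  toFun f := (memLp_inner_wp h f).toLp _
  map_add' f g := by
    rw [← MemLp.toLp_add]
    congr 1
    ext z
    simp [inner_add_right]
  map_smul' c f := by
    rw [RingHom.id_apply, ← MemLp.toLp_const_smul]
    congr 1
    ext z
    simp [inner_smul_right]
  norm_map' f := by
    simp only [LinearMap.coe_mk, AddHom.coe_mk]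
    rw [Lp.norm_toLp]
    have h1 := eLpNorm_two_sq volume (fun z : Euc d × Euc d => (inner ℂ (wp 0 z) f : ℂ))
    rw [h.lintegral_inner_wp_sq] at h1
    rw [ENNReal.pow_right_strictMono two_ne_zero |>.injective h1, toReal_enorm]

lemma IsFree.integral_inner_mul_inner {d : ℕ} {F : L2Sp d ≃ₗᵢ[ℂ] L2Sp d}
    {U₀ : ℝ → L2Sp d →L[ℂ] L2Sp d} (h : IsFree F U₀) (f g : L2Sp d) :
    ∫ z : Euc d × Euc d, (inner ℂ f (wp 0 z) : ℂ) * inner ℂ (wp 0 z) g = inner ℂ f g := by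
  rw [← (transform h).inner_map_map f g, L2.inner_def]
  refine integral_congr_ae ?_
  filter_upwards [(memLp_inner_wp h f).coeFn_toLp, (memLp_inner_wp h g).coeFn_toLp] with z h1 h2
  change _ = inner ℂ (((memLp_inner_wp h f).toLp _ : Lp ℂ 2 _) z)
    (((memLp_inner_wp h g).toLp _ : Lp ℂ 2 _) z)
  rw [h1, h2, RCLike.inner_apply', inner_conj_symm]

end TrotterKernel

namespace TrotterKernel

/-! ### Phase space matrix coefficients -/

variable {d : ℕ}

instance isAddHaarMeasure_volume_prod :
    (volume : Measure (Euc d × Euc d)).IsAddHaarMeasure := by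
  rw [Measure.volume_eq_prod]; infer_instance

/-- Matrix coefficients of an operator with respect to the wave packets. -/
def coeff (T : L2Sp d →L[ℂ] L2Sp d) (w z : Euc d × Euc d) : ℂ := inner ℂ (wp 0 w) (T (wp 0 z))

lemma continuous_coeff (T : L2Sp d →L[ℂ] L2Sp d) :
    Continuous fun p : (Euc d × Euc d) × (Euc d × Euc d) => coeff T p.1 p.2 :=
  (continuous_wp.comp continuous_fst).inner (T.continuous.comp (continuous_wp.comp continuous_snd))

lemma norm_coeff_le (T : L2Sp d →L[ℂ] L2Sp d) (w z : Euc d × Euc d) : ‖coeff T w z‖ ≤ ‖T‖ := by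
  refine (norm_inner_le_norm _ _).trans ?_
  rw [norm_wp_zero, one_mul]
  refine (T.le_opNorm _).trans ?_
  rw [norm_wp_zero, mul_one]

/-- The largest matrix coefficient at phase space distance `h` from the diagonal. -/
def env (T : L2Sp d →L[ℂ] L2Sp d) (h : Euc d × Euc d) : ℝ≥0∞ := ⨆ z, ‖coeff T (z + h) z‖ₑ

lemma enorm_coeff_le (T : L2Sp d →L[ℂ] L2Sp d) (w z : Euc d × Euc d) :
    ‖coeff T w z‖ₑ ≤ env T (w - z) := by
  have := le_iSup (fun v => ‖coeff T (v + (w - z)) v‖ₑ) z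
  rwa [add_sub_cancel] at this

lemma measurable_env (T : L2Sp d →L[ℂ] L2Sp d) : Measurable (env T) := by
  refine LowerSemicontinuous.measurable (lowerSemicontinuous_iSup fun z => ?_)
  have : Continuous fun h => ‖coeff T (z + h) z‖ₑ := by
    have h1 : Continuous fun h : Euc d × Euc d => (z + h, z) := by fun_prop
    exact ((continuous_coeff T).comp h1).enorm
  exact this.lowerSemicontinuous

/-- The norm of the class of operators almost diagonalised by the wave packets. -/
def sj (Ω : Euc d × Euc d → ℝ≥0∞) (T : L2Sp d →L[ℂ] L2Sp d) : ℝ≥0∞ := ∫⁻ h, env T h * Ω h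

/-- Measurable submultiplicative functions. -/
structure IsWeight (Ω : Euc d × Euc d → ℝ≥0∞) : Prop where
  measurable : Measurable Ω
  mul_le : ∀ a b, Ω (a + b) ≤ Ω a * Ω b

lemma env_smul (c : ℂ) (T : L2Sp d →L[ℂ] L2Sp d) (h : Euc d × Euc d) :
    env (c • T) h = ‖c‖ₑ * env T h := by
  unfold env
  rw [ENNReal.mul_iSup]
  refine iSup_congr fun z => ?_
  simp [coeff, inner_smul_right, enorm_mul]

lemma sj_smul (Ω : Euc d × Euc d → ℝ≥0∞) (c : ℂ) (T : L2Sp d →L[ℂ] L2Sp d) :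
    sj Ω (c • T) = ‖c‖ₑ * sj Ω T := by
  unfold sj
  rw [← lintegral_const_mul' _ _ (by simp)]
  simp_rw [env_smul, mul_assoc]

lemma sj_add_le {Ω : Euc d × Euc d → ℝ≥0∞} (hΩ : IsWeight Ω) (S T : L2Sp d →L[ℂ] L2Sp d) :
    sj Ω (S + T) ≤ sj Ω S + sj Ω T := by
  unfold sj
  rw [← lintegral_add_left (Measurable.fun_mul (measurable_env S) hΩ.measurable)]
  refine lintegral_mono fun h => ?_
  rw [← add_mul]
  gcongr
  refine iSup_le fun z => ?_
  have : coeff (S + T) (z + h) z = coeff S (z + h) z + coeff T (z + h) z := by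
    simp [coeff, inner_add_right]
  rw [this]
  exact (enorm_add_le _ _).trans (add_le_add (le_iSup (fun z => ‖coeff S (z + h) z‖ₑ) z)
    (le_iSup (fun z => ‖coeff T (z + h) z‖ₑ) z))

lemma sj_zero (Ω : Euc d × Euc d → ℝ≥0∞) : sj Ω (0 : L2Sp d →L[ℂ] L2Sp d) = 0 := by
  simp [sj, env, coeff]

lemma sj_sum_le {Ω : Euc d × Euc d → ℝ≥0∞} (hΩ : IsWeight Ω) {ι : Type*} (s : Finset ι)
    (T : ι → L2Sp d →L[ℂ] L2Sp d) : sj Ω (∑ i ∈ s, T i) ≤ ∑ i ∈ s, sj Ω (T i) :=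
  Finset.le_sum_of_subadditive _ (sj_zero Ω).le (sj_add_le hΩ) s T

lemma env_le_liminf {T : L2Sp d →L[ℂ] L2Sp d} {S : ℕ → L2Sp d →L[ℂ] L2Sp d}
    (h : ∀ f, Tendsto (fun n => S n f) atTop (𝓝 (T f))) (k : Euc d × Euc d) :
    env T k ≤ liminf (fun n => env (S n) k) atTop := by
  refine iSup_le fun z => ?_
  have h1 : Tendsto (fun n => ‖coeff (S n) (z + k) z‖ₑ) atTop (𝓝 ‖coeff T (z + k) z‖ₑ) :=
    (tendsto_const_nhds.inner (h (wp 0 z))).enorm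
  rw [← h1.liminf_eq]
  exact liminf_le_liminf (Eventually.of_forall fun n =>
    le_iSup (fun z => ‖coeff (S n) (z + k) z‖ₑ) z)

lemma sj_le_of_tendsto {Ω : Euc d × Euc d → ℝ≥0∞} (hΩ : IsWeight Ω) {T : L2Sp d →L[ℂ] L2Sp d}
    {S : ℕ → L2Sp d →L[ℂ] L2Sp d} {B : ℝ≥0∞}
    (h : ∀ f, Tendsto (fun n => S n f) atTop (𝓝 (T f))) (hB : ∀ n, sj Ω (S n) ≤ B) :
    sj Ω T ≤ B := by
  calc sj Ω T ≤ ∫⁻ k, liminf (fun n => env (S n) k * Ω k) atTop := by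
        refine lintegral_mono fun k => ?_
        refine (mul_le_mul_left (env_le_liminf h k) _).trans ?_
        simp only [liminf_eq_iSup_iInf_of_nat]
        rw [ENNReal.iSup_mul]
        refine iSup_mono fun n => ?_
        refine le_iInf₂ fun m hm => ?_
        gcongr
        exact iInf₂_le m hm
    _ ≤ liminf (fun n => sj Ω (S n)) atTop :=
        lintegral_liminf_le fun n => (measurable_env (S n)).mul hΩ.measurable
    _ ≤ B := by
        refine liminf_le_of_le (by isBoundedDefault) fun b hb => ?_
        obtain ⟨n, hn⟩ := hb.exists
        exact hn.trans (hB n)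

variable {F : L2Sp d ≃ₗᵢ[ℂ] L2Sp d} {U₀ : ℝ → L2Sp d →L[ℂ] L2Sp d}

lemma IsFree.coeff_comp (hU : IsFree F U₀) (S T : L2Sp d →L[ℂ] L2Sp d) (w z : Euc d × Euc d) :
    coeff (S.comp T) w z = ∫ v, coeff S w v * coeff T v z := by
  have h := hU.integral_inner_mul_inner (S.adjoint (wp 0 w)) (T (wp 0 z))
  simp only [ContinuousLinearMap.adjoint_inner_left] at h
  exact h.symm

lemma IsFree.env_comp_le (hU : IsFree F U₀) (S T : L2Sp d →L[ℂ] L2Sp d) (h : Euc d × Euc d) :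
    env (S.comp T) h ≤ ∫⁻ k, env S (h - k) * env T k := by
  refine iSup_le fun z => ?_
  rw [hU.coeff_comp, ← lintegral_sub_right_eq_self _ z]
  refine (enorm_integral_le_lintegral_enorm _).trans (lintegral_mono fun v => ?_)
  rw [enorm_mul]
  refine mul_le_mul' ((enorm_coeff_le _ _ _).trans (le_of_eq ?_)) (enorm_coeff_le _ _ _)
  congr 1; abel

lemma IsFree.sj_comp_le (hU : IsFree F U₀) {Ω : Euc d × Euc d → ℝ≥0∞} (hΩ : IsWeight Ω)
    (S T : L2Sp d →L[ℂ] L2Sp d) : sj Ω (S.comp T) ≤ sj Ω S * sj Ω T := by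
  have hm : Measurable fun p : (Euc d × Euc d) × (Euc d × Euc d) =>
      env S (p.1 - p.2) * Ω (p.1 - p.2) * (env T p.2 * Ω p.2) := by
    have h1 : Measurable fun p : (Euc d × Euc d) × (Euc d × Euc d) => p.1 - p.2 := by fun_prop
    exact (((measurable_env S).comp h1).mul (hΩ.measurable.comp h1)).mul
      (((measurable_env T).comp measurable_snd).mul (hΩ.measurable.comp measurable_snd))
  calc sj Ω (S.comp T) ≤ ∫⁻ h, ∫⁻ k, env S (h - k) * Ω (h - k) * (env T k * Ω k) := by
        refine lintegral_mono fun h => ?_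
        have h1 : Measurable fun k => env S (h - k) * env T k :=
          ((measurable_env S).comp (measurable_const.sub measurable_id)).mul (measurable_env T)
        refine (mul_le_mul_left (hU.env_comp_le S T h) _).trans ?_
        rw [← lintegral_mul_const _ h1]
        refine lintegral_mono fun k => ?_
        have := hΩ.mul_le (h - k) k
        rw [sub_add_cancel] at this
        calc env S (h - k) * env T k * Ω h ≤ env S (h - k) * env T k * (Ω (h - k) * Ω k) := by
              gcongr
          _ = _ := by ring
    _ = ∫⁻ k, ∫⁻ h, env S (h - k) * Ω (h - k) * (env T k * Ω k) :=
        lintegral_lintegral_swap hm.aemeasurable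
    _ = ∫⁻ k, sj Ω S * (env T k * Ω k) := by
        refine lintegral_congr fun k => ?_
        have h1 : Measurable fun h => env S (h - k) * Ω (h - k) :=
          ((measurable_env S).mul hΩ.measurable).comp (measurable_id.sub measurable_const)
        rw [lintegral_mul_const _ h1,
          lintegral_sub_right_eq_self (fun h => env S h * Ω h) k]
        rfl
    _ = sj Ω S * sj Ω T := lintegral_const_mul _ ((measurable_env T).mul hΩ.measurable)

end TrotterKernel

namespace TrotterKernel

/-! ### Multiplication operators are almost diagonal -/

variable {d : ℕ}

lemma norm_gaussWindow (x : Euc d) : ‖gaussWindow x‖ = Real.exp (-π * ‖x‖ ^ 2) := by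
  rw [gaussWindow, Complex.norm_real, Real.norm_of_nonneg (Real.exp_pos _).le]

lemma continuous_gaussWindow : Continuous (gaussWindow : Euc d → ℂ) := by
  unfold gaussWindow; fun_prop

lemma continuous_STFT {g : Euc d → ℂ} (hg : Continuous g) {M : ℝ} (hM : ∀ x, ‖g x‖ ≤ M)
    (x : Euc d) : Continuous fun ξ => STFT g x ξ := by
  unfold STFT
  have hw := continuous_gaussWindow (d := d)
  refine continuous_of_dominated (bound := fun t => M * Real.exp (-π * ‖t - x‖ ^ 2)) ?_ ?_ ?_ ?_
  · intro ξ
    exact Continuous.aestronglyMeasurable (by fun_prop)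
  · intro ξ
    refine Eventually.of_forall fun t => ?_
    rw [norm_mul, norm_mul, norm_cexp_neg_ofReal_mul_I, one_mul, norm_gaussWindow]
    exact mul_le_mul_of_nonneg_right (hM t) (Real.exp_pos _).le
  · exact (integrable_rexp_sq Real.pi_pos x).const_mul M
  · exact Eventually.of_forall fun t => by fun_prop

/-- The supremum in the position variable of the short-time Fourier transform. -/
def specSup (g : Euc d → ℂ) (ξ : Euc d) : ℝ≥0∞ := ⨆ x, ‖STFT g x ξ‖ₑ

lemma measurable_specSup {g : Euc d → ℂ} (hg : Continuous g) {M : ℝ} (hM : ∀ x, ‖g x‖ ≤ M) :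
    Measurable (specSup g) :=
  LowerSemicontinuous.measurable (lowerSemicontinuous_iSup fun x =>
    (continuous_STFT hg hM x).enorm.lowerSemicontinuous)

lemma integral_gauss_mul_gauss {a γ : ℝ} (hγ : 0 < γ) (haγ : a * (π + γ) = π * γ) (X : Euc d) :
    ∫ y : Euc d, Real.exp (-π * ‖X - y‖ ^ 2) * Real.exp (-γ * ‖y‖ ^ 2) =
      (π / (π + γ)) ^ ((d : ℝ) / 2) * Real.exp (-a * ‖X‖ ^ 2) := by
  have hp : 0 < π + γ := by positivity
  have h1 : ∀ y : Euc d, Real.exp (-π * ‖X - y‖ ^ 2) * Real.exp (-γ * ‖y‖ ^ 2) =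
      Real.exp (-(π + γ) * ‖y - (π / (π + γ)) • X‖ ^ 2) * Real.exp (-a * ‖X‖ ^ 2) := by
    intro y
    rw [← Real.exp_add, ← Real.exp_add, @norm_sub_sq_real, @norm_sub_sq_real, norm_smul,
      inner_smul_right, real_inner_comm X y, mul_pow, Real.norm_eq_abs, sq_abs]
    congr 1
    have ha : a = π * γ / (π + γ) := by field_simp; linarith
    rw [ha]
    field_simp
    ring
  simp_rw [h1]
  rw [integral_mul_const, integral_sub_right_eq_self (fun y : Euc d =>
    Real.exp (-(π + γ) * ‖y‖ ^ 2)), GaussianFourier.integral_rexp_neg_mul_sq_norm hp]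
  simp

lemma enorm_fourier_gauss_le {g : Euc d → ℂ} (hg : Continuous g) {M : ℝ} (hM : ∀ x, ‖g x‖ ≤ M)
    {a : ℝ} (ha : 0 < a) (haπ : a < π) (m ξ : Euc d) :
    ‖∫ x, Complex.exp (-(((2 * π * ⟪ξ, x⟫ : ℝ) : ℂ) * Complex.I)) * g x *
      ((Real.exp (-a * ‖x - m‖ ^ 2) : ℝ) : ℂ)‖ₑ ≤
      ENNReal.ofReal ((π / a) ^ ((d : ℝ) / 2)) * specSup g ξ := by
  set γ : ℝ := a * π / (π - a) with hγdef
  have hpa : 0 < π - a := by linarith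
  have hγ : 0 < γ := by positivity
  have haγ : a * (π + γ) = π * γ := by rw [hγdef]; field_simp; ring
  have hp : 0 < π + γ := by positivity
  set c : ℝ := (π / (π + γ)) ^ ((d : ℝ) / 2) with hc
  have hc0 : 0 < c := by positivity
  have hw := continuous_gaussWindow (d := d)
  have h1 : ∀ x : Euc d, Complex.exp (-(((2 * π * ⟪ξ, x⟫ : ℝ) : ℂ) * Complex.I)) * g x *
      ((Real.exp (-a * ‖x - m‖ ^ 2) : ℝ) : ℂ) = (c : ℂ)⁻¹ * ∫ y : Euc d,
      Complex.exp (-(((2 * π * ⟪ξ, x⟫ : ℝ) : ℂ) * Complex.I)) * g x * gaussWindow (x - (m + y)) *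
        ((Real.exp (-γ * ‖y‖ ^ 2) : ℝ) : ℂ) := by
    intro x
    have h2 := integral_gauss_mul_gauss hγ haγ (x - m)
    have h3 : ∀ y : Euc d, Complex.exp (-(((2 * π * ⟪ξ, x⟫ : ℝ) : ℂ) * Complex.I)) * g x *
        gaussWindow (x - (m + y)) * ((Real.exp (-γ * ‖y‖ ^ 2) : ℝ) : ℂ) =
        Complex.exp (-(((2 * π * ⟪ξ, x⟫ : ℝ) : ℂ) * Complex.I)) * g x *
        ((Real.exp (-π * ‖x - m - y‖ ^ 2) * Real.exp (-γ * ‖y‖ ^ 2) : ℝ) : ℂ) := by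
      intro y
      rw [gaussWindow, sub_sub]; push_cast; ring
    simp_rw [h3]
    rw [integral_const_mul, integral_complex_ofReal, h2, ← hc, Complex.ofReal_mul c]
    have : (c : ℂ) ≠ 0 := by exact_mod_cast hc0.ne'
    field_simp
  simp_rw [h1]
  rw [integral_const_mul, integral_integral_swap]
  · have h4 : ∀ y : Euc d, ∫ x : Euc d, Complex.exp (-(((2 * π * ⟪ξ, x⟫ : ℝ) : ℂ) * Complex.I)) *
        g x * gaussWindow (x - (m + y)) * ((Real.exp (-γ * ‖y‖ ^ 2) : ℝ) : ℂ) =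
        STFT g (m + y) ξ * ((Real.exp (-γ * ‖y‖ ^ 2) : ℝ) : ℂ) := by
      intro y
      rw [integral_mul_const]; rfl
    simp_rw [h4]
    have hγi : Integrable fun y : Euc d => Real.exp (-γ * ‖y‖ ^ 2) := by
      simpa using integrable_rexp_sq hγ (0 : Euc d)
    calc _ ≤ ENNReal.ofReal c⁻¹ * ∫⁻ y : Euc d, specSup g ξ *
          ENNReal.ofReal (Real.exp (-γ * ‖y‖ ^ 2)) := by
          rw [enorm_mul]
          refine mul_le_mul' ?_ ((enorm_integral_le_lintegral_enorm _).trans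
            (lintegral_mono fun y => ?_))
          · rw [← ofReal_norm, norm_inv, Complex.norm_real, Real.norm_of_nonneg hc0.le]
          · rw [enorm_mul]
            refine mul_le_mul' (le_iSup (fun x => ‖STFT g x ξ‖ₑ) (m + y)) ?_
            rw [← ofReal_norm, Complex.norm_real, Real.norm_of_nonneg (Real.exp_pos _).le]
      _ = ENNReal.ofReal (c⁻¹ * ∫ y : Euc d, Real.exp (-γ * ‖y‖ ^ 2)) * specSup g ξ := by
          rw [lintegral_const_mul _ (by fun_prop), ← ofReal_integral_eq_lintegral_ofReal hγi
            (Eventually.of_forall fun y => (Real.exp_pos _).le),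
            ENNReal.ofReal_mul (inv_nonneg.mpr hc0.le)]
          ring
      _ = _ := by
          rw [GaussianFourier.integral_rexp_neg_mul_sq_norm hγ, hc]
          congr 2
          rw [finrank_euclideanSpace_fin, ← Real.inv_rpow (by positivity),
            ← Real.mul_rpow (by positivity) (by positivity)]
          congr 1
          have : a = π * γ / (π + γ) := by field_simp; linarith
          rw [this]
          field_simp
  · have hi : Integrable (fun p : Euc d × Euc d => Real.exp (-γ * ‖p.2‖ ^ 2) *
        Real.exp (-π * ‖p.1 - p.2 - m‖ ^ 2)) (volume.prod volume) := by
      have e1 : Integrable fun y : Euc d => Real.exp (-γ * ‖y‖ ^ 2) := by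
        simpa using integrable_rexp_sq hγ (0 : Euc d)
      exact Integrable.convolution_integrand (ContinuousLinearMap.mul ℝ ℝ) e1
        (integrable_rexp_sq Real.pi_pos m)
    refine (hi.const_mul M).mono' (Continuous.aestronglyMeasurable
      (by unfold Function.uncurry; fun_prop)) (Eventually.of_forall fun p => ?_)
    simp only [Function.uncurry, norm_mul, norm_cexp_neg_ofReal_mul_I, one_mul, norm_gaussWindow,
      Complex.norm_real, Real.norm_of_nonneg (Real.exp_pos _).le]
    rw [mul_assoc, mul_comm (Real.exp _) (Real.exp _), ← sub_sub, sub_right_comm]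
    exact mul_le_mul_of_nonneg_right (hM _) (by positivity)

/-- `T` acts as multiplication by `g`. -/
def IsMulBy (g : Euc d → ℂ) (T : L2Sp d →L[ℂ] L2Sp d) : Prop :=
  ∀ f : L2Sp d, (T f : Euc d → ℂ) =ᵐ[volume] fun x => g x * f x

/-- The conjugate of `T` by the free group at time `s`. -/
def conjFree (U₀ : ℝ → L2Sp d →L[ℂ] L2Sp d) (s : ℝ) (T : L2Sp d →L[ℂ] L2Sp d) :
    L2Sp d →L[ℂ] L2Sp d := (U₀ s).comp (T.comp (U₀ (-s)))

lemma pi_div_width (s : ℝ) : (π : ℂ) / width s =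
    (rate s : ℂ) + ((2 * π ^ 2 * s / (16 + (2 * π * s) ^ 2) : ℝ) : ℂ) * Complex.I := by
  apply Complex.ext
  · rw [pi_div_width_re]
    simp only [Complex.add_re, Complex.mul_re, Complex.ofReal_re, Complex.ofReal_im,
      Complex.I_re, Complex.I_im]
    ring
  · rw [pi_div_width_im]
    simp only [Complex.add_im, Complex.mul_im, Complex.ofReal_re, Complex.ofReal_im,
      Complex.I_re, Complex.I_im]
    ring

/-- The shear parameter of the Gaussian wave packet at time `s`. -/
def shear (s : ℝ) : ℝ := 2 * π * s / (16 + (2 * π * s) ^ 2)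

lemma conj_packet_mul_packet (s : ℝ) (z h : Euc d × Euc d) :
    ∃ c : ℂ, ‖c‖ = ‖amp d s‖ ^ 2 * Real.exp (-(rate s / 2) * ‖ctr s h‖ ^ 2) ∧ ∀ x : Euc d,
      (starRingEnd ℂ) (packet s (z + h) x) * packet s z x =
      c * (Complex.exp (-(((2 * π * ⟪h.2 + shear s • ctr s h, x⟫ : ℝ) : ℂ) * Complex.I)) *
        ((Real.exp (-(2 * rate s) * ‖x - (ctr s z + (2⁻¹ : ℝ) • ctr s h)‖ ^ 2) : ℝ) : ℂ)) := by
  set u := ctr s h with hu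
  set cz := ctr s z with hcz
  have hcw : ctr s (z + h) = cz + u := by
    simp only [hu, hcz, ctr, Prod.fst_add, Prod.snd_add, smul_add]; abel
  set κ : ℝ := 2 * π ^ 2 * s / (16 + (2 * π * s) ^ 2) with hκ
  have hsh : π * shear s = κ := by unfold shear; rw [hκ]; ring
  refine ⟨(starRingEnd ℂ) (amp d s) * amp d s *
    Complex.exp (((2 * π ^ 2 * s * (‖z.2‖ ^ 2 - ‖(z + h).2‖ ^ 2) +
      2 * κ * ⟪u, cz + (2⁻¹ : ℝ) • u⟫ : ℝ) : ℂ) * Complex.I) *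
    ((Real.exp (-(rate s / 2) * ‖u‖ ^ 2) : ℝ) : ℂ), ?_, fun x => ?_⟩
  · rw [norm_mul, norm_mul, norm_mul, RCLike.norm_conj, Complex.norm_exp_ofReal_mul_I,
      Complex.norm_real, Real.norm_of_nonneg (Real.exp_pos _).le]
    ring
  · unfold packet
    rw [hcw, ← hcz, pi_div_width, ← hκ]
    simp only [map_mul, ← Complex.exp_conj, Complex.conj_ofReal, Complex.conj_I, map_neg, map_add,
      Complex.ofReal_exp]
    have e1 : ∀ a a' p q r p' q' r' : ℂ, a' * Complex.exp p * Complex.exp q * Complex.exp r *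
        (a * Complex.exp p' * Complex.exp q' * Complex.exp r') =
        a' * a * Complex.exp (p + q + r + p' + q' + r') := by
      intros; simp only [Complex.exp_add]; ring
    have e2 : ∀ a a' p q r r' : ℂ, a' * a * Complex.exp p * Complex.exp q *
        (Complex.exp r * Complex.exp r') = a' * a * Complex.exp (p + q + r + r') := by
      intros; simp only [Complex.exp_add]; ring
    rw [e1, e2]
    congr 2
    have n1 : ‖x - (cz + u)‖ ^ 2 = ‖x - cz‖ ^ 2 - 2 * (⟪u, x⟫ - ⟪u, cz⟫) + ‖u‖ ^ 2 := by
      rw [← sub_sub, @norm_sub_sq_real, real_inner_comm, inner_sub_right]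
    have n2 : ‖x - (cz + (2⁻¹ : ℝ) • u)‖ ^ 2 =
        ‖x - cz‖ ^ 2 - (⟪u, x⟫ - ⟪u, cz⟫) + ‖u‖ ^ 2 / 4 := by
      rw [← sub_sub, @norm_sub_sq_real, inner_smul_right, real_inner_comm, inner_sub_right,
        norm_smul, mul_pow]
      norm_num
      ring
    have n3 : ⟪u, cz + (2⁻¹ : ℝ) • u⟫ = ⟪u, cz⟫ + ‖u‖ ^ 2 / 2 := by
      rw [inner_add_right, inner_smul_right, real_inner_self_eq_norm_sq]; ring
    have n4 : ⟪h.2 + shear s • u, x⟫ = ⟪h.2, x⟫ + shear s * ⟪u, x⟫ := by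
      rw [inner_add_left, real_inner_smul_left]
    have n5 : ⟪(z + h).2, x⟫ = ⟪z.2, x⟫ + ⟪h.2, x⟫ := by
      rw [Prod.snd_add, inner_add_left]
    rw [n1, n2, n3, n4, n5, ← hsh]
    push_cast
    ring

end TrotterKernel

namespace TrotterKernel

variable {d : ℕ} {F : L2Sp d ≃ₗᵢ[ℂ] L2Sp d} {U₀ : ℝ → L2Sp d →L[ℂ] L2Sp d}

lemma rate_le (s : ℝ) : rate s ≤ π / 4 := by
  unfold rate
  rw [div_le_div_iff₀ (by positivity) (by norm_num)]
  nlinarith [Real.pi_pos, sq_nonneg (2 * π * s)]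

lemma continuous_rate : Continuous rate := by
  unfold rate
  refine Continuous.div (by fun_prop) (by fun_prop) fun s => ?_
  positivity

lemma IsFree.coeff_conjFree (hU : IsFree F U₀) {g : Euc d → ℂ} {T : L2Sp d →L[ℂ] L2Sp d}
    (hT : IsMulBy g T) (s : ℝ) (w z : Euc d × Euc d) : coeff (conjFree U₀ s T) w z =
      ∫ x, (starRingEnd ℂ) (packet s w x) * packet s z x * g x := by
  have h1 : coeff (conjFree U₀ s T) w z = inner ℂ (wp s w) (T (wp s z)) := by
    simp only [coeff, conjFree, ContinuousLinearMap.comp_apply, hU.apply_wp, sub_neg_eq_add,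
      zero_add]
    rw [← neg_neg s, ← hU.inner_apply, hU.apply_wp]
    simp
  rw [h1, inner_wp]
  refine integral_congr_ae ?_
  filter_upwards [hT (wp s z), coeFn_wp s z] with x h2 h3
  rw [h2, h3]; ring

lemma IsFree.env_conjFree_le (hU : IsFree F U₀) {g : Euc d → ℂ} {T : L2Sp d →L[ℂ] L2Sp d}
    (hT : IsMulBy g T) (hg : Continuous g) {M : ℝ} (hM : ∀ x, ‖g x‖ ≤ M) (s : ℝ)
    (h : Euc d × Euc d) : env (conjFree U₀ s T) h ≤
      ENNReal.ofReal (‖amp d s‖ ^ 2 * (π / (2 * rate s)) ^ ((d : ℝ) / 2) *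
        Real.exp (-(rate s / 2) * ‖ctr s h‖ ^ 2)) * specSup g (h.2 + shear s • ctr s h) := by
  refine iSup_le fun z => ?_
  obtain ⟨c, hc, hp⟩ := conj_packet_mul_packet s z h
  have h0 := rate_pos s
  have h1 := rate_le s
  have h2 := enorm_fourier_gauss_le hg hM (a := 2 * rate s) (by positivity)
    (by linarith [Real.pi_pos]) (ctr s z + (2⁻¹ : ℝ) • ctr s h) (h.2 + shear s • ctr s h)
  rw [hU.coeff_conjFree hT]
  simp_rw [hp, mul_assoc c]
  rw [integral_const_mul, enorm_mul]
  calc _ ≤ ENNReal.ofReal (‖amp d s‖ ^ 2 * Real.exp (-(rate s / 2) * ‖ctr s h‖ ^ 2)) *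
        (ENNReal.ofReal ((π / (2 * rate s)) ^ ((d : ℝ) / 2)) *
          specSup g (h.2 + shear s • ctr s h)) := by
        refine mul_le_mul' ?_ (le_trans (le_of_eq ?_) h2)
        · rw [← ofReal_norm, hc]
        · congr 2
          ext x
          ring
    _ = _ := by
        rw [← mul_assoc, ← ENNReal.ofReal_mul (by positivity)]
        congr 2
        ring

lemma exists_bound_amp (d : ℕ) (S : ℝ) : ∃ C > 0, ∃ ε > 0, ∀ s : ℝ, |s| ≤ S →
    ‖amp d s‖ ^ 2 * (π / (2 * rate s)) ^ ((d : ℝ) / 2) ≤ C ∧ ε ≤ rate s / 2 := by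
  have hc : Continuous fun s => ‖amp d s‖ ^ 2 * (π / (2 * rate s)) ^ ((d : ℝ) / 2) := by
    refine ((continuous_amp d).norm.pow 2).mul (Continuous.rpow_const ?_ fun s => ?_)
    · refine continuous_const.div (continuous_const.mul continuous_rate) fun s => ?_
      have := rate_pos s; positivity
    · left
      have := rate_pos s; positivity
  obtain ⟨C, hC⟩ := (isCompact_Icc (a := -S) (b := S)).exists_bound_of_continuousOn hc.continuousOn
  refine ⟨max C 1, by positivity, rate S / 2, by have := rate_pos S; positivity, fun s hs => ?_⟩
  refine ⟨((le_abs_self _).trans (hC s (abs_le.mp hs))).trans (le_max_left _ _), ?_⟩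
  have : rate S ≤ rate s := by
    unfold rate
    have h1 : (2 * π * s) ^ 2 ≤ (2 * π * S) ^ 2 := by
      rw [mul_pow, mul_pow (2 * π) S]
      refine mul_le_mul_of_nonneg_left ?_ (by positivity)
      rw [← sq_abs s]
      exact pow_le_pow_left₀ (abs_nonneg s) hs 2
    exact div_le_div_of_nonneg_left (by positivity) (by positivity) (by linarith)
  linarith

lemma lintegral_shear {f : Euc d → Euc d → ℝ≥0∞} (hf : Measurable fun p : Euc d × Euc d =>
    f p.1 p.2) (s q : ℝ) :
    ∫⁻ h : Euc d × Euc d, f (ctr s h) (h.2 + q • ctr s h) = ∫⁻ u, ∫⁻ ξ, f u ξ := by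
  have hm1 : Measurable fun h : Euc d × Euc d => (ctr s h, h.2 + q • ctr s h) := by
    unfold ctr; fun_prop
  have hm2 : Measurable fun h : Euc d × Euc d => (h.2, h.1 + q • h.2) := by fun_prop
  have hf1 : Measurable fun h : Euc d × Euc d => f (ctr s h) (h.2 + q • ctr s h) := hf.comp hm1
  have hf2 : Measurable fun h : Euc d × Euc d => f h.2 (h.1 + q • h.2) := hf.comp hm2
  rw [Measure.volume_eq_prod, lintegral_prod_symm _ hf1.aemeasurable]
  have h1 : ∀ y : Euc d, ∫⁻ x : Euc d, f (ctr s (x, y)) ((x, y).2 + q • ctr s (x, y)) =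
      ∫⁻ u : Euc d, f u (y + q • u) := by
    intro y
    exact lintegral_sub_right_eq_self (fun u => f u (y + q • u)) ((2 * π * s) • y)
  simp_rw [h1]
  rw [lintegral_lintegral_swap hf2.aemeasurable]
  refine lintegral_congr fun u => ?_
  exact lintegral_add_right_eq_self (fun ξ => f u ξ) (q • u)

/-- A bounded weight function that is small near the origin. -/
def far {E : Type*} [Norm E] (n : ℕ) (h : E) : ℝ≥0∞ := ENNReal.ofReal (min 1 (‖h‖ / (n + 1)))

/-- A weight function measuring the mass away from the origin. -/
def farWeight (l : ℝ≥0) (n : ℕ) (h : Euc d × Euc d) : ℝ≥0∞ := 1 + l * far n h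

lemma measurable_far (n : ℕ) : Measurable (far n : Euc d × Euc d → ℝ≥0∞) := by
  unfold far; fun_prop

lemma far_add_le (n : ℕ) (a b : Euc d × Euc d) : far n (a + b) ≤ far n a + far n b := by
  unfold far
  rw [← ENNReal.ofReal_add (by positivity) (by positivity)]
  apply ENNReal.ofReal_le_ofReal
  have h1 : ‖a + b‖ / ((n : ℝ) + 1) ≤ ‖a‖ / ((n : ℝ) + 1) + ‖b‖ / ((n : ℝ) + 1) := by
    rw [← add_div]
    exact div_le_div_of_nonneg_right (norm_add_le a b) (by positivity)
  have h2 : 0 ≤ ‖a‖ / ((n : ℝ) + 1) := by positivity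
  have h3 : 0 ≤ ‖b‖ / ((n : ℝ) + 1) := by positivity
  rcases le_total 1 (‖a‖ / ((n : ℝ) + 1)) with h4 | h4
  · rw [min_eq_left h4]
    have : 0 ≤ min 1 (‖b‖ / ((n : ℝ) + 1)) := by positivity
    linarith [min_le_left 1 (‖a + b‖ / ((n : ℝ) + 1))]
  · rcases le_total 1 (‖b‖ / ((n : ℝ) + 1)) with h5 | h5
    · rw [min_eq_left h5, min_eq_right h4]
      linarith [min_le_left 1 (‖a + b‖ / ((n : ℝ) + 1))]
    · rw [min_eq_right h4, min_eq_right h5]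
      exact (min_le_right _ _).trans h1

lemma isWeight_farWeight (l : ℝ≥0) (n : ℕ) : IsWeight (farWeight l n : Euc d × Euc d → ℝ≥0∞) where
  measurable := by
    unfold farWeight
    exact measurable_const.add (measurable_const.mul (measurable_far n))
  mul_le a b := by
    unfold farWeight
    calc 1 + (l : ℝ≥0∞) * far n (a + b) ≤ 1 + l * (far n a + far n b) := by
          gcongr; exact far_add_le n a b
      _ ≤ 1 + l * (far n a + far n b) + (l * far n a) * (l * far n b) := le_self_add
      _ = _ := by ring

lemma abs_shear_le (s : ℝ) : |shear s| ≤ 1 := by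
  unfold shear
  rw [abs_div, abs_of_pos (by positivity : (0 : ℝ) < 16 + (2 * π * s) ^ 2),
    div_le_one (by positivity), abs_le]
  constructor <;> nlinarith [sq_nonneg (2 * π * s - 1), sq_nonneg (2 * π * s + 1)]

lemma norm_le_ctr {S s : ℝ} (hs : |s| ≤ S) (h : Euc d × Euc d) :
    ‖h‖ ≤ (1 + 2 * π * S) * (‖ctr s h‖ + ‖h.2 + shear s • ctr s h‖) := by
  set u := ctr s h with hu
  set ξ := h.2 + shear s • u with hξ
  have hS : 0 ≤ S := (abs_nonneg s).trans hs
  have h2 : ‖h.2‖ ≤ ‖u‖ + ‖ξ‖ := by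
    have e : h.2 = ξ - shear s • u := by rw [hξ]; abel
    rw [e]
    refine (norm_sub_le _ _).trans ?_
    rw [norm_smul, Real.norm_eq_abs]
    nlinarith [abs_shear_le s, norm_nonneg u]
  have h1 : ‖h.1‖ ≤ ‖u‖ + 2 * π * S * (‖u‖ + ‖ξ‖) := by
    have e : h.1 = u + (2 * π * s) • h.2 := by rw [hu, ctr]; abel
    rw [e]
    refine (norm_add_le _ _).trans ?_
    rw [norm_smul, Real.norm_eq_abs, abs_mul, abs_of_pos (by positivity : 0 < 2 * π)]
    gcongr
  have h3 : 0 ≤ 2 * π * S * (‖u‖ + ‖ξ‖) := by positivity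
  rw [Prod.norm_def]
  refine max_le ?_ ?_ <;> nlinarith [norm_nonneg u, norm_nonneg ξ]

lemma IsFree.exists_sj_conjFree_le (hU : IsFree F U₀) {g : Euc d → ℂ} {T : L2Sp d →L[ℂ] L2Sp d}
    (hT : IsMulBy g T) (hg : Continuous g) {M : ℝ} (hM : ∀ x, ‖g x‖ ≤ M)
    (hfin : ∫⁻ ξ, specSup g ξ < ⊤) (S : ℝ) : ∃ β : ℝ≥0, ∀ l : ℝ≥0, ∀ᶠ n : ℕ in atTop,
      ∀ s : ℝ, |s| ≤ S → sj (farWeight l n) (conjFree U₀ s T) ≤ β := by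
  obtain ⟨C, hC, ε, hε, hb⟩ := exists_bound_amp d S
  have hΦ := measurable_specSup hg hM
  set D : Euc d → Euc d → ℝ≥0∞ := fun u ξ =>
    ENNReal.ofReal (C * Real.exp (-ε * ‖u‖ ^ 2)) * specSup g ξ with hD
  have hDm : Measurable fun p : Euc d × Euc d => D p.1 p.2 :=
    Measurable.mul (by fun_prop) (hΦ.comp measurable_snd)
  set K : ℝ := 1 + 2 * π * S
  set Θ : ℕ → Euc d → Euc d → ℝ≥0∞ := fun n u ξ => far n (K * (‖u‖ + ‖ξ‖)) with hΘ
  have hΘm : ∀ n, Measurable fun p : Euc d × Euc d => Θ n p.1 p.2 := by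
    intro n
    simp only [hΘ]
    unfold far
    fun_prop
  have hDint : ∫⁻ p : Euc d × Euc d, D p.1 p.2 < ⊤ := by
    rw [Measure.volume_eq_prod, lintegral_prod _ hDm.aemeasurable]
    simp only [hD]
    simp_rw [lintegral_const_mul _ hΦ]
    rw [lintegral_mul_const _ (by fun_prop)]
    refine ENNReal.mul_lt_top ?_ hfin
    have := (integrable_rexp_sq hε (0 : Euc d)).const_mul C
    simp only [sub_zero] at this
    exact this.lintegral_lt_top
  set A := ∫⁻ p : Euc d × Euc d, D p.1 p.2 with hA
  have key : ∀ (l : ℝ≥0) (n : ℕ) (s : ℝ), |s| ≤ S → sj (farWeight l n) (conjFree U₀ s T) ≤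
      A + ∫⁻ p : Euc d × Euc d, l * (D p.1 p.2 * Θ n p.1 p.2) := by
    intro l n s hs
    have hDΘ : Measurable fun p : Euc d × Euc d => D p.1 p.2 * (1 + l * Θ n p.1 p.2) :=
      hDm.mul (measurable_const.add (measurable_const.mul (hΘm n)))
    calc sj (farWeight l n) (conjFree U₀ s T) ≤ ∫⁻ h : Euc d × Euc d,
          (fun u ξ => D u ξ * (1 + l * Θ n u ξ)) (ctr s h) (h.2 + shear s • ctr s h) := by
          refine lintegral_mono fun h => ?_
          refine mul_le_mul' ((hU.env_conjFree_le hT hg hM s h).trans ?_) ?_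
          · refine mul_le_mul_left (ENNReal.ofReal_le_ofReal ?_) _
            refine mul_le_mul (hb s hs).1 (Real.exp_le_exp.mpr ?_) (Real.exp_pos _).le hC.le
            exact mul_le_mul_of_nonneg_right (neg_le_neg (hb s hs).2) (by positivity)
          · unfold farWeight
            gcongr
            unfold far
            refine ENNReal.ofReal_le_ofReal (min_le_min le_rfl ?_)
            refine div_le_div_of_nonneg_right ((norm_le_ctr hs h).trans (le_abs_self _))
              (by positivity)
      _ = ∫⁻ u, ∫⁻ ξ, D u ξ * (1 + l * Θ n u ξ) := by
          exact lintegral_shear (f := fun u ξ => D u ξ * (1 + l * Θ n u ξ)) hDΘ s (shear s)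
      _ = ∫⁻ p : Euc d × Euc d, D p.1 p.2 * (1 + l * Θ n p.1 p.2) := by
          rw [Measure.volume_eq_prod, lintegral_prod _ hDΘ.aemeasurable]
      _ = _ := by
          rw [hA, ← lintegral_add_left hDm]
          refine lintegral_congr fun p => ?_
          ring
  refine ⟨(A + 1).toNNReal, fun l => ?_⟩
  rw [ENNReal.coe_toNNReal (by finiteness)]
  have hlim : Tendsto (fun n : ℕ => ∫⁻ p : Euc d × Euc d, l * (D p.1 p.2 * Θ n p.1 p.2)) atTop
      (𝓝 (∫⁻ _ : Euc d × Euc d, 0)) := by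
    have hae : ∀ᵐ p : Euc d × Euc d, D p.1 p.2 < ⊤ := ae_lt_top hDm hDint.ne
    refine tendsto_lintegral_of_dominated_convergence (fun p : Euc d × Euc d => l * D p.1 p.2)
      (fun n => measurable_const.mul (hDm.mul (hΘm n))) ?_ ?_ ?_
    · refine fun n => Eventually.of_forall fun p => ?_
      refine mul_le_mul_right (mul_le_of_le_one_right (zero_le) ?_) _
      simp only [hΘ, far]
      exact ENNReal.ofReal_le_one.mpr (min_le_left _ _)
    · rw [lintegral_const_mul _ hDm]
      finiteness
    · filter_upwards [hae] with p hp
      have h1 : Tendsto (fun n : ℕ => Θ n p.1 p.2) atTop (𝓝 0) := by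
        simp only [hΘ, far]
        have h2 : Tendsto (fun n : ℕ => ‖K * (‖p.1‖ + ‖p.2‖)‖ / ((n : ℝ) + 1)) atTop (𝓝 0) := by
          have := tendsto_one_div_add_atTop_nhds_zero_nat (𝕜 := ℝ)
          simpa [div_eq_mul_inv] using this.const_mul ‖K * (‖p.1‖ + ‖p.2‖)‖
        have h3 := (tendsto_const_nhds (x := (1 : ℝ))).min h2
        rw [min_eq_right zero_le_one] at h3
        simpa using ENNReal.tendsto_ofReal h3
      have h4 := ENNReal.Tendsto.const_mul (a := D p.1 p.2) h1 (Or.inr hp.ne)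
      have h5 := ENNReal.Tendsto.const_mul (a := (l : ℝ≥0∞)) h4 (Or.inr (by simp))
      simpa using h5
  rw [lintegral_zero] at hlim
  filter_upwards [hlim.eventually (gt_mem_nhds zero_lt_one)] with n hn s hs
  exact (key l n s hs).trans (by gcongr)

end TrotterKernel

namespace TrotterKernel

/-! ### Exponentials of multiplication operators -/

variable {d : ℕ} {F : L2Sp d ≃ₗᵢ[ℂ] L2Sp d} {U₀ : ℝ → L2Sp d →L[ℂ] L2Sp d}

lemma exists_isMulBy {g : Euc d → ℂ} (hg : Continuous g) {M : ℝ} (hM : ∀ x, ‖g x‖ ≤ M) :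
    ∃ T : L2Sp d →L[ℂ] L2Sp d, IsMulBy g T := by
  have hmem : ∀ f : L2Sp d, MemLp (fun x => g x * f x) 2 := fun f =>
    MemLp.of_le_mul (g := (f : Euc d → ℂ)) (c := M) (Lp.memLp f)
      (hg.aestronglyMeasurable.mul (Lp.aestronglyMeasurable f)) (Eventually.of_forall fun x => by
        rw [norm_mul]; exact mul_le_mul_of_nonneg_right (hM x) (norm_nonneg _))
  let L : L2Sp d →ₗ[ℂ] L2Sp d :=
    { toFun := fun f => (hmem f).toLp _
      map_add' := fun f h => by
        apply Lp.ext
        filter_upwards [(hmem (f + h)).coeFn_toLp, (hmem f).coeFn_toLp, (hmem h).coeFn_toLp,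
          Lp.coeFn_add f h, Lp.coeFn_add ((hmem f).toLp _) ((hmem h).toLp _)] with x h1 h2 h3 h4 h5
        rw [h1, h5, Pi.add_apply, h2, h3, h4, Pi.add_apply, mul_add]
      map_smul' := fun c f => by
        apply Lp.ext
        filter_upwards [(hmem (c • f)).coeFn_toLp, (hmem f).coeFn_toLp,
          Lp.coeFn_smul c f, Lp.coeFn_smul c ((hmem f).toLp _)] with x h1 h2 h3 h4
        rw [h1, RingHom.id_apply, h4, Pi.smul_apply, h2, h3, Pi.smul_apply, smul_eq_mul,
          smul_eq_mul]
        ring }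
  refine ⟨L.mkContinuous M fun f => ?_, fun f => (hmem f).coeFn_toLp⟩
  refine Lp.norm_le_mul_norm_of_ae_le_mul ?_
  filter_upwards [(hmem f).coeFn_toLp] with x hx
  change ‖((hmem f).toLp _ : L2Sp d) x‖ ≤ _
  rw [hx, norm_mul]
  exact mul_le_mul_of_nonneg_right (hM x) (norm_nonneg _)

lemma IsMulBy.norm_apply_le {g : Euc d → ℂ} {T : L2Sp d →L[ℂ] L2Sp d} (h : IsMulBy g T) {C : ℝ}
    (hC : ∀ x, ‖g x‖ ≤ C) (f : L2Sp d) : ‖T f‖ ≤ C * ‖f‖ := by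
  refine Lp.norm_le_mul_norm_of_ae_le_mul ?_
  filter_upwards [h f] with x hx
  rw [hx, norm_mul]
  exact mul_le_mul_of_nonneg_right (hC x) (norm_nonneg _)

lemma IsMulBy.norm_apply_eq {g : Euc d → ℂ} {T : L2Sp d →L[ℂ] L2Sp d} (h : IsMulBy g T)
    (hC : ∀ x, ‖g x‖ = 1) (f : L2Sp d) : ‖T f‖ = ‖f‖ := by
  rw [Lp.norm_def, Lp.norm_def]
  congr 1
  refine eLpNorm_congr_norm_ae ?_
  filter_upwards [h f] with x hx
  rw [hx, norm_mul, hC, one_mul]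

lemma IsMulBy.one : IsMulBy (fun _ : Euc d => 1) (1 : L2Sp d →L[ℂ] L2Sp d) := fun f =>
  Eventually.of_forall fun x => by simp

lemma IsMulBy.mul {g g' : Euc d → ℂ} {T T' : L2Sp d →L[ℂ] L2Sp d} (h : IsMulBy g T)
    (h' : IsMulBy g' T') : IsMulBy (fun x => g x * g' x) (T * T') := fun f => by
  filter_upwards [h (T' f), h' f] with x h1 h2
  rw [mul_apply_eq_comp, h1, h2, mul_assoc]

lemma IsMulBy.pow {g : Euc d → ℂ} {T : L2Sp d →L[ℂ] L2Sp d} (h : IsMulBy g T) (n : ℕ) :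
    IsMulBy (fun x => g x ^ n) (T ^ n) := by
  induction n with
  | zero => simpa using IsMulBy.one
  | succ n ih => simpa only [pow_succ] using ih.mul h

lemma IsMulBy.smul {g : Euc d → ℂ} {T : L2Sp d →L[ℂ] L2Sp d} (h : IsMulBy g T) (c : ℂ) :
    IsMulBy (fun x => c * g x) (c • T) := fun f => by
  filter_upwards [h f, Lp.coeFn_smul c (T f)] with x h1 h2
  rw [smul_apply, h2, Pi.smul_apply, h1, smul_eq_mul, mul_assoc]

lemma IsMulBy.add {g g' : Euc d → ℂ} {T T' : L2Sp d →L[ℂ] L2Sp d} (h : IsMulBy g T)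
    (h' : IsMulBy g' T') : IsMulBy (fun x => g x + g' x) (T + T') := fun f => by
  filter_upwards [h f, h' f, Lp.coeFn_add (T f) (T' f)] with x h1 h2 h3
  rw [add_apply, h3, Pi.add_apply, h1, h2, add_mul]

lemma IsMulBy.sub {g g' : Euc d → ℂ} {T T' : L2Sp d →L[ℂ] L2Sp d} (h : IsMulBy g T)
    (h' : IsMulBy g' T') : IsMulBy (fun x => g x - g' x) (T - T') := fun f => by
  filter_upwards [h f, h' f, Lp.coeFn_sub (T f) (T' f)] with x h1 h2 h3
  rw [sub_apply, h3, Pi.sub_apply, h1, h2, sub_mul]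

lemma IsMulBy.sum_range {g : ℕ → Euc d → ℂ} {T : ℕ → L2Sp d →L[ℂ] L2Sp d}
    (h : ∀ k, IsMulBy (g k) (T k)) (n : ℕ) :
    IsMulBy (fun x => ∑ k ∈ Finset.range n, g k x) (∑ k ∈ Finset.range n, T k) := by
  induction n with
  | zero =>
    intro f
    filter_upwards [Lp.coeFn_zero ℂ 2 (volume : Measure (Euc d))] with x hx
    simp only [Finset.range_zero, Finset.sum_empty, zero_apply, zero_mul]
    rw [hx]; rfl
  | succ n ih =>
    simp_rw [Finset.sum_range_succ]
    exact ih.add (h n)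

lemma IsMulBy.tendsto_exp {g : Euc d → ℂ} {T E : L2Sp d →L[ℂ] L2Sp d} (hT : IsMulBy g T)
    (hE : IsMulBy (fun x => Complex.exp (g x)) E) {M : ℝ} (hM : ∀ x, ‖g x‖ ≤ M) (f : L2Sp d) :
    Tendsto (fun n => (∑ k ∈ Finset.range n, ((k.factorial : ℂ)⁻¹ • T ^ k)) f) atTop
      (𝓝 (E f)) := by
  have hP : ∀ n, IsMulBy (fun x => ∑ k ∈ Finset.range n, (k.factorial : ℂ)⁻¹ * g x ^ k)
      (∑ k ∈ Finset.range n, ((k.factorial : ℂ)⁻¹ • T ^ k)) :=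
    IsMulBy.sum_range fun k => (hT.pow k).smul _
  rw [tendsto_iff_norm_sub_tendsto_zero]
  have hlim : Tendsto (fun n : ℕ => M ^ n / n.factorial * 2 * ‖f‖) atTop (𝓝 0) := by
    have := (FloorSemiring.tendsto_pow_div_factorial_atTop M).mul_const (2 * ‖f‖)
    simpa [mul_assoc] using this
  have hev : ∀ᶠ n : ℕ in atTop, M / n.succ ≤ 1 / 2 := by
    have h1 : Tendsto (fun n : ℕ => M / ((n : ℝ) + 1)) atTop (𝓝 0) := by
      have := tendsto_one_div_add_atTop_nhds_zero_nat (𝕜 := ℝ)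
      simpa [div_eq_mul_inv] using this.const_mul M
    filter_upwards [h1.eventually (ge_mem_nhds (by norm_num : (0 : ℝ) < 1 / 2))] with n hn
    simpa using hn
  refine squeeze_zero' (Eventually.of_forall fun _ => norm_nonneg _) ?_ hlim
  filter_upwards [hev] with n hn
  rw [norm_sub_rev, ← sub_apply]
  refine (hE.sub (hP n)).norm_apply_le (fun x => ?_) f
  have h2 : ‖g x‖ / n.succ ≤ 1 / 2 :=
    (div_le_div_of_nonneg_right (hM x) (by positivity)).trans hn
  have h3 := Complex.exp_bound' h2
  have h4 : ∑ k ∈ Finset.range n, (k.factorial : ℂ)⁻¹ * g x ^ k =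
      ∑ k ∈ Finset.range n, g x ^ k / k.factorial :=
    Finset.sum_congr rfl fun k _ => by rw [div_eq_mul_inv, mul_comm]
  rw [h4]
  refine h3.trans ?_
  have := hM x
  gcongr

lemma IsFree.conjFree_mul (hU : IsFree F U₀) (s : ℝ) (S T : L2Sp d →L[ℂ] L2Sp d) :
    conjFree U₀ s (S * T) = conjFree U₀ s S * conjFree U₀ s T := by
  ext1 f
  simp [conjFree, hU.apply_apply, hU.zero_apply]

lemma IsFree.conjFree_one (hU : IsFree F U₀) (s : ℝ) :
    conjFree U₀ s (1 : L2Sp d →L[ℂ] L2Sp d) = 1 := by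
  ext1 f
  simp [conjFree, hU.apply_apply, hU.zero_apply]

lemma IsFree.conjFree_pow (hU : IsFree F U₀) (s : ℝ) (T : L2Sp d →L[ℂ] L2Sp d) (n : ℕ) :
    conjFree U₀ s (T ^ n) = conjFree U₀ s T ^ n := by
  induction n with
  | zero => simp [hU.conjFree_one]
  | succ n ih => rw [pow_succ, pow_succ, hU.conjFree_mul, ih]

lemma IsFree.sj_mul_pow_le (hU : IsFree F U₀) {Ω : Euc d × Euc d → ℝ≥0∞} (hΩ : IsWeight Ω)
    (X B : L2Sp d →L[ℂ] L2Sp d) (n : ℕ) : sj Ω (X * B ^ n) ≤ sj Ω X * sj Ω B ^ n := by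
  induction n with
  | zero => simp
  | succ n ih =>
    rw [pow_succ, pow_succ, ← mul_assoc, ← mul_assoc]
    exact (hU.sj_comp_le hΩ _ _).trans (by gcongr)

lemma IsFree.sj_mul_conjFree_exp_le (hU : IsFree F U₀) {Ω : Euc d × Euc d → ℝ≥0∞}
    (hΩ : IsWeight Ω) {g : Euc d → ℂ} {T E : L2Sp d →L[ℂ] L2Sp d} (hT : IsMulBy g T) (τ : ℝ)
    (hE : IsMulBy (fun x => Complex.exp (-(τ : ℂ) * Complex.I * g x)) E) {M : ℝ}
    (hM : ∀ x, ‖g x‖ ≤ M)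
    {s : ℝ} {β : ℝ≥0} (hβ : sj Ω (conjFree U₀ s T) ≤ β) (X : L2Sp d →L[ℂ] L2Sp d) :
    sj Ω (X * conjFree U₀ s E) ≤ ENNReal.ofReal (Real.exp (|τ| * β)) * sj Ω X := by
  set c : ℂ := -(τ : ℂ) * Complex.I with hc
  have hcn : ‖c‖ = |τ| := by rw [hc]; simp
  set B := conjFree U₀ s T with hB
  have hlim := (hT.smul c).tendsto_exp hE (M := |τ| * M) (fun x => by
    rw [norm_mul, hcn]; exact mul_le_mul_of_nonneg_left (hM x) (abs_nonneg _))
  refine sj_le_of_tendsto hΩ (S := fun n => ∑ k ∈ Finset.range n,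
    ((k.factorial : ℂ)⁻¹ * c ^ k) • (X * B ^ k)) (fun f => ?_) fun n => ?_
  · have h1 := ((X.comp (U₀ s)).continuous.tendsto _).comp (hlim (U₀ (-s) f))
    refine h1.congr fun n => ?_
    simp only [Function.comp, sum_apply, map_sum]
    refine Finset.sum_congr rfl fun k _ => ?_
    rw [hB, ← hU.conjFree_pow, smul_pow, smul_smul]
    simp [conjFree]
  · refine (sj_sum_le hΩ _ _).trans ?_
    have h1 : ∀ k ∈ Finset.range n, sj Ω (((k.factorial : ℂ)⁻¹ * c ^ k) • (X * B ^ k)) ≤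
        ENNReal.ofReal ((|τ| * β) ^ k / k.factorial) * sj Ω X := by
      intro k _
      rw [sj_smul]
      have h2 : ‖(k.factorial : ℂ)⁻¹ * c ^ k‖ₑ = ENNReal.ofReal (|τ| ^ k / k.factorial) := by
        rw [← ofReal_norm, norm_mul, norm_pow, hcn, norm_inv, Complex.norm_natCast,
          div_eq_mul_inv, mul_comm]
      have h3 : ENNReal.ofReal ((|τ| * β) ^ k / k.factorial) =
          ENNReal.ofReal (|τ| ^ k / k.factorial) * (β : ℝ≥0∞) ^ k := by
        rw [mul_pow, mul_div_right_comm, ENNReal.ofReal_mul (by positivity),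
          ENNReal.ofReal_pow (by positivity), ENNReal.ofReal_coe_nnreal]
      rw [h2, h3, mul_assoc]
      refine mul_le_mul_right ((hU.sj_mul_pow_le hΩ X B k).trans ?_) _
      rw [mul_comm]
      gcongr
    refine (Finset.sum_le_sum h1).trans ?_
    rw [← Finset.sum_mul, ← ENNReal.ofReal_sum_of_nonneg (fun k _ => by positivity)]
    gcongr
    exact Real.sum_le_exp_of_nonneg (by positivity) n

lemma STFT_one (x ξ : Euc d) : ‖STFT (fun _ => 1) x ξ‖ = Real.exp (-π * ‖ξ‖ ^ 2) := by
  have h := integral_fourier_cexp_sq (b := (π : ℂ)) (by simpa using Real.pi_pos) x ξ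
  have h1 : STFT (fun _ => 1) x ξ = ∫ t, Complex.exp (-(((2 * π * ⟪ξ, t⟫ : ℝ) : ℂ) * Complex.I)) *
      Complex.exp (-(π : ℂ) * ((‖t - x‖ ^ 2 : ℝ) : ℂ)) := by
    unfold STFT gaussWindow
    refine integral_congr_ae (Eventually.of_forall fun t => ?_)
    simp
  have hπ : (π : ℂ) ≠ 0 := by exact_mod_cast Real.pi_ne_zero
  rw [h1, h, norm_mul, norm_mul, norm_cexp_neg_ofReal_mul_I, div_self hπ, Complex.one_cpow,
    norm_one, one_mul, one_mul]
  have : -((π : ℂ) ^ 2 / π) * ((‖ξ‖ ^ 2 : ℝ) : ℂ) = ((-π * ‖ξ‖ ^ 2 : ℝ) : ℂ) := by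
    push_cast; field_simp
  rw [this, ← Complex.ofReal_exp, Complex.norm_real, Real.norm_of_nonneg (Real.exp_pos _).le]

lemma lintegral_specSup_one : ∫⁻ ξ : Euc d, specSup (fun _ => 1) ξ < ⊤ := by
  have h : ∀ ξ : Euc d, specSup (fun _ => 1) ξ = ENNReal.ofReal (Real.exp (-π * ‖ξ‖ ^ 2)) := by
    intro ξ
    unfold specSup
    simp_rw [← ofReal_norm, STFT_one]
    simp
  simp_rw [h]
  have := integrable_rexp_sq Real.pi_pos (0 : Euc d)
  simp only [sub_zero] at this
  exact this.lintegral_lt_top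

lemma IsFree.exists_sj_one_le (hU : IsFree F U₀) : ∃ β : ℝ≥0, ∀ l : ℝ≥0, ∀ᶠ n : ℕ in atTop,
    sj (farWeight l n) (1 : L2Sp d →L[ℂ] L2Sp d) ≤ β := by
  obtain ⟨β, hβ⟩ := hU.exists_sj_conjFree_le IsMulBy.one continuous_const (M := 1) (by simp)
    lintegral_specSup_one 0
  refine ⟨β, fun l => ?_⟩
  filter_upwards [hβ l] with n hn
  simpa [hU.conjFree_one] using hn 0 (by simp)

end TrotterKernel

namespace TrotterKernel

/-! ### Convergence of Trotter products -/

lemma exists_approx_solution {H : Type*} [NormedAddCommGroup H] [NormedSpace ℝ H]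
    [CompleteSpace H] {D : ℝ → H → H} (hD : Continuous fun p : ℝ × H => D p.1 p.2) {C : ℝ}
    (hC0 : 0 ≤ C) (hC : ∀ r f g, ‖D r f - D r g‖ ≤ C * ‖f - g‖) (f : H) {δ : ℝ} (hδ : 0 < δ) :
    ∃ Y Y' : ℝ → H, Y 1 = f ∧ Continuous Y' ∧ (∀ r, HasDerivAt Y (Y' r) r) ∧
      ∀ r ∈ Set.Icc (0 : ℝ) 1, ‖Y' r - D r (Y r)‖ ≤ δ := by
  let Z : ℕ → ℝ → H := fun N => Nat.rec (fun _ => f)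
    (fun _ Y q => f - ∫ p in (0 : ℝ)..q, D (1 - p) (Y p)) N
  have hZs : ∀ N q, Z (N + 1) q = f - ∫ p in (0 : ℝ)..q, D (1 - p) (Z N p) := fun _ _ => rfl
  have hZc : ∀ N, Continuous (Z N) := by
    intro N
    induction N with
    | zero => exact continuous_const
    | succ N ih =>
      have h1 : Continuous fun p => D (1 - p) (Z N p) :=
        hD.comp ((continuous_const.sub continuous_id).prodMk ih)
      have : Z (N + 1) = fun q => f - ∫ p in (0 : ℝ)..q, D (1 - p) (Z N p) := rfl
      rw [this]
      refine continuous_const.sub (continuous_iff_continuousAt.2 fun q => ?_)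
      exact (h1.integral_hasStrictDerivAt 0 q).hasDerivAt.continuousAt
  have hDc : ∀ N, Continuous fun p => D (1 - p) (Z N p) := fun N =>
    hD.comp ((continuous_const.sub continuous_id).prodMk (hZc N))
  obtain ⟨K, hK⟩ := (isCompact_Icc (a := (0 : ℝ)) (b := 1)).exists_bound_of_continuousOn
    (hDc 0).continuousOn
  have hK0 : 0 ≤ K := (norm_nonneg _).trans (hK 0 (by simp))
  have hdiff : ∀ N, ∀ q ∈ Set.Icc (0 : ℝ) 1,
      ‖Z (N + 1) q - Z N q‖ ≤ K * C ^ N * (q ^ (N + 1) / (N + 1).factorial) := by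
    intro N
    induction N with
    | zero =>
      intro q hq
      have h1 : Z (0 + 1) q - Z 0 q = -∫ p in (0 : ℝ)..q, D (1 - p) (Z 0 p) := by
        rw [hZs]
        change f - _ - f = _
        abel
      rw [h1, norm_neg]
      have := intervalIntegral.norm_integral_le_of_norm_le_const (a := (0 : ℝ)) (b := q) (C := K)
        (f := fun p => D (1 - p) (Z 0 p)) (fun p hp => by
          rw [Set.uIoc_of_le hq.1] at hp
          exact hK p ⟨hp.1.le, hp.2.trans hq.2⟩)
      simpa [abs_of_nonneg hq.1] using this
    | succ N ih =>
      intro q hq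
      have h1 : Z (N + 1 + 1) q - Z (N + 1) q =
          ∫ p in (0 : ℝ)..q, (D (1 - p) (Z N p) - D (1 - p) (Z (N + 1) p)) := by
        rw [intervalIntegral.integral_sub ((hDc N).intervalIntegrable _ _)
          ((hDc (N + 1)).intervalIntegrable _ _), hZs (N + 1), hZs N]
        abel
      rw [h1]
      have h2 := intervalIntegral.norm_integral_le_of_norm_le (μ := volume) (a := (0 : ℝ)) (b := q)
        (f := fun p => D (1 - p) (Z N p) - D (1 - p) (Z (N + 1) p))
        (g := fun p => C * (K * C ^ N * (p ^ (N + 1) / (N + 1).factorial))) hq.1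
        (Eventually.of_forall fun p hp => by
          refine (hC _ _ _).trans (mul_le_mul_of_nonneg_left ?_ hC0)
          rw [norm_sub_rev]
          exact ih p ⟨hp.1.le, hp.2.trans hq.2⟩) (by
          apply Continuous.intervalIntegrable; fun_prop)
      refine h2.trans_eq ?_
      simp only [intervalIntegral.integral_const_mul, intervalIntegral.integral_div, integral_pow]
      rw [Nat.factorial_succ (N + 1)]
      push_cast
      have : ((N + 1).factorial : ℝ) ≠ 0 := by positivity
      have h3 : (N : ℝ) + 1 + 1 ≠ 0 := by positivity
      field_simp
      simp
      ring
  have hlim : Tendsto (fun N : ℕ => C * K * (C ^ N / N.factorial)) atTop (𝓝 0) := by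
    simpa using (FloorSemiring.tendsto_pow_div_factorial_atTop C).const_mul (C * K)
  obtain ⟨N, hN⟩ := (hlim.eventually (ge_mem_nhds hδ)).exists
  refine ⟨fun r => Z (N + 1) (1 - r), fun r => D r (Z N (1 - r)), ?_, ?_, ?_, ?_⟩
  · simp [hZs]
  · exact hD.comp (continuous_id.prodMk ((hZc N).comp (continuous_const.sub continuous_id)))
  · intro r
    have h1 := ((hDc N).integral_hasStrictDerivAt 0 (1 - r)).hasDerivAt
    have h2 := (h1.const_sub f).scomp r ((hasDerivAt_id r).const_sub 1)
    simpa [Function.comp_def, hZs] using h2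
  · intro r hr
    have hr' : 1 - r ∈ Set.Icc (0 : ℝ) 1 := ⟨by linarith [hr.2], by linarith [hr.1]⟩
    refine (hC _ _ _).trans ?_
    rw [norm_sub_rev]
    refine (mul_le_mul_of_nonneg_left (hdiff N _ hr') hC0).trans (le_trans ?_ hN)
    rw [mul_assoc C K, mul_assoc K]
    refine mul_le_mul_of_nonneg_left (mul_le_mul_of_nonneg_left ?_ hK0) hC0
    rw [div_eq_mul_inv (C ^ N)]
    refine mul_le_mul_of_nonneg_left ?_ (by positivity)
    rw [div_eq_mul_inv]
    have h1 : (1 - r) ^ (N + 1) ≤ 1 := pow_le_one₀ hr'.1 hr'.2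
    have h2 : (((N + 1).factorial : ℝ))⁻¹ ≤ ((N.factorial : ℝ))⁻¹ := by
      gcongr
      omega
    calc (1 - r) ^ (N + 1) * (((N + 1).factorial : ℝ))⁻¹ ≤ 1 * ((N.factorial : ℝ))⁻¹ := by
          gcongr
      _ = _ := one_mul _

lemma eventually_norm_product_sub_le {H : Type*} [NormedAddCommGroup H] [NormedSpace ℝ H]
    {D : ℝ → H → H} {P A : ℕ → ℕ → H → H} {C : ℝ} (hC : 0 ≤ C)
    (hP : ∀ n k f g, ‖P n k f - P n k g‖ ≤ ‖f - g‖) (hP0 : ∀ n f, P n 0 f = f)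
    (hPs : ∀ n k f, P n (k + 1) f = P n k (A n (k + 1) f))
    (hA : ∀ n k f, k < n → ‖A n (k + 1) f - (f - ((n : ℝ)⁻¹) • D (((k + 1 : ℕ) : ℝ) / n) f)‖ ≤
      C * ((n : ℝ)⁻¹) ^ 2 * ‖f‖)
    {Y Y' : ℝ → H} (hY' : Continuous Y') (hY : ∀ r, HasDerivAt Y (Y' r) r) {δ : ℝ}
    (hδ : ∀ r ∈ Set.Icc (0 : ℝ) 1, ‖Y' r - D r (Y r)‖ ≤ δ) {ε : ℝ} (hε : 0 < ε) :
    ∀ᶠ n in atTop, ‖P n n (Y 1) - Y 0‖ ≤ δ + ε := by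
  have hYc : Continuous Y := continuous_iff_continuousAt.2 fun r => (hY r).continuousAt
  obtain ⟨S, hS⟩ := (isCompact_Icc (a := (0 : ℝ)) (b := 1)).exists_bound_of_continuousOn
    hYc.continuousOn
  have hu := (isCompact_Icc (a := (0 : ℝ)) (b := 1)).uniformContinuousOn_of_continuous
    hY'.continuousOn
  obtain ⟨η, hη, hu⟩ := Metric.uniformContinuousOn_iff.1 hu (ε / 2) (half_pos hε)
  have hinv : Tendsto (fun n : ℕ => ((n : ℝ))⁻¹) atTop (𝓝 0) := tendsto_inv_atTop_nhds_zero_nat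
  have hinv2 : Tendsto (fun n : ℕ => C * S * ((n : ℝ))⁻¹) atTop (𝓝 0) := by
    simpa using hinv.const_mul (C * S)
  filter_upwards [hinv.eventually (gt_mem_nhds hη), hinv2.eventually (ge_mem_nhds (half_pos hε)),
    eventually_gt_atTop 0] with n hn1 hn2 hn0
  have hn : (0 : ℝ) < n := by exact_mod_cast hn0
  have hstep : ∀ k < n, ‖P n (k + 1) (Y (((k + 1 : ℕ) : ℝ) / n)) - P n k (Y ((k : ℝ) / n))‖ ≤
      (n : ℝ)⁻¹ * (δ + ε) := by
    intro k hk
    set a : ℝ := (k : ℝ) / n with ha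
    set b : ℝ := ((k + 1 : ℕ) : ℝ) / n with hb
    have hab : b - a = (n : ℝ)⁻¹ := by rw [ha, hb]; push_cast; field_simp; ring
    have ha0 : 0 ≤ a := by positivity
    have hb1 : b ≤ 1 := by
      rw [hb, div_le_one hn]; exact_mod_cast hk
    have hle : a ≤ b := by
      have : 0 < (n : ℝ)⁻¹ := by positivity
      linarith
    have hbI : b ∈ Set.Icc (0 : ℝ) 1 := ⟨ha0.trans hle, hb1⟩
    have h1 : ‖Y b - Y a - (n : ℝ)⁻¹ • Y' b‖ ≤ ε / 2 * (n : ℝ)⁻¹ := by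
      have h2 := Convex.norm_image_sub_le_of_norm_hasDerivWithin_le (s := Set.Icc a b)
        (f := fun r => Y r - r • Y' b) (f' := fun r => Y' r - Y' b) (C := ε / 2) (x := a) (y := b)
        (fun r _ => by
          have := ((hY r).sub ((hasDerivAt_id r).smul_const (Y' b))).hasDerivWithinAt
            (s := Set.Icc a b)
          simpa [Pi.sub_def] using this)
        (fun r hr => by
          rw [← dist_eq_norm]
          refine (hu r ⟨ha0.trans hr.1, hr.2.trans hb1⟩ b hbI ?_).le
          rw [Real.dist_eq, abs_sub_comm, abs_of_nonneg (by linarith [hr.2])]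
          linarith [hr.1])
        (convex_Icc a b) (Set.left_mem_Icc.2 hle) (Set.right_mem_Icc.2 hle)
      rw [Real.norm_of_nonneg (by linarith), hab] at h2
      refine le_of_eq_of_le ?_ h2
      congr 1
      rw [← hab, sub_smul]
      abel
    rw [hPs]
    refine (hP _ _ _ _).trans ?_
    have h3 := hA n k (Y b) hk
    rw [← hb] at h3
    have h4 := hδ b hbI
    have hSb := hS b hbI
    have hdec : A n (k + 1) (Y b) - Y a =
        (A n (k + 1) (Y b) - (Y b - (n : ℝ)⁻¹ • D b (Y b))) + (Y b - Y a - (n : ℝ)⁻¹ • Y' b) +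
          (n : ℝ)⁻¹ • (Y' b - D b (Y b)) := by
      rw [smul_sub]; abel
    rw [hdec]
    refine (norm_add₃_le).trans ?_
    rw [norm_smul, Real.norm_of_nonneg (by positivity)]
    have h5 : C * ((n : ℝ)⁻¹) ^ 2 * ‖Y b‖ ≤ (n : ℝ)⁻¹ * (ε / 2) := by
      calc C * ((n : ℝ)⁻¹) ^ 2 * ‖Y b‖ ≤ C * ((n : ℝ)⁻¹) ^ 2 * S := by gcongr
        _ = (n : ℝ)⁻¹ * (C * S * (n : ℝ)⁻¹) := by ring
        _ ≤ _ := by gcongr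
    have h6 : (n : ℝ)⁻¹ * ‖Y' b - D b (Y b)‖ ≤ (n : ℝ)⁻¹ * δ := by gcongr
    linarith
  have hsum := norm_sum_le (Finset.range n) fun k =>
    P n (k + 1) (Y (((k + 1 : ℕ) : ℝ) / n)) - P n k (Y ((k : ℝ) / n))
  rw [Finset.sum_range_sub (fun k => P n k (Y ((k : ℝ) / n)))] at hsum
  rw [div_self hn.ne', hP0] at hsum
  simp only [Nat.cast_zero, zero_div] at hsum
  refine hsum.trans ((Finset.sum_le_sum fun k hk => hstep k (Finset.mem_range.1 hk)).trans_eq ?_)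
  rw [Finset.sum_const, Finset.card_range, nsmul_eq_mul, mul_inv_cancel_left₀ hn.ne']

lemma cauchySeq_product {H : Type*} [NormedAddCommGroup H] [NormedSpace ℝ H] [CompleteSpace H]
    {D : ℝ → H → H} (hD : Continuous fun p : ℝ × H => D p.1 p.2) {M : ℝ} (hM0 : 0 ≤ M)
    (hM : ∀ r f g, ‖D r f - D r g‖ ≤ M * ‖f - g‖)
    {P A : ℕ → ℕ → H → H} {C : ℝ} (hC : 0 ≤ C)
    (hP : ∀ n k f g, ‖P n k f - P n k g‖ ≤ ‖f - g‖) (hP0 : ∀ n f, P n 0 f = f)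
    (hPs : ∀ n k f, P n (k + 1) f = P n k (A n (k + 1) f))
    (hA : ∀ n k f, k < n → ‖A n (k + 1) f - (f - ((n : ℝ)⁻¹) • D (((k + 1 : ℕ) : ℝ) / n) f)‖ ≤
      C * ((n : ℝ)⁻¹) ^ 2 * ‖f‖) (f : H) : CauchySeq fun n => P n n f := by
  rw [Metric.cauchySeq_iff]
  intro ε hε
  obtain ⟨Y, Y', hY1, hY', hY, hd⟩ := exists_approx_solution hD hM0 hM f
    (show 0 < ε / 8 by linarith)
  have h := eventually_norm_product_sub_le hC hP hP0 hPs hA hY' hY hd (show 0 < ε / 8 by linarith)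
  obtain ⟨N, hN⟩ := eventually_atTop.1 h
  refine ⟨N, fun m hm n hn => ?_⟩
  have h1 := hN m hm
  have h2 := hN n hn
  rw [hY1, ← dist_eq_norm] at h1 h2
  have := dist_triangle_right (P m m f) (P n n f) (Y 0)
  linarith

end TrotterKernel

namespace TrotterKernel

variable {d : ℕ} {F : L2Sp d ≃ₗᵢ[ℂ] L2Sp d} {U₀ : ℝ → L2Sp d →L[ℂ] L2Sp d}

/-- The Trotter product in the interaction picture. -/
def trotter (U₀ : ℝ → L2Sp d →L[ℂ] L2Sp d) (E : L2Sp d →L[ℂ] L2Sp d) (τ : ℝ) (k : ℕ) :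
    L2Sp d →L[ℂ] L2Sp d := (((U₀ τ).comp E) ^ k).comp (U₀ (-(k * τ)))

lemma IsFree.trotter_zero (hU : IsFree F U₀) (E : L2Sp d →L[ℂ] L2Sp d) (τ : ℝ) :
    trotter U₀ E τ 0 = 1 := by
  ext1 f
  simp [trotter, hU.zero_apply]

lemma IsFree.trotter_succ (hU : IsFree F U₀) (E : L2Sp d →L[ℂ] L2Sp d) (τ : ℝ) (k : ℕ) :
    trotter U₀ E τ (k + 1) = trotter U₀ E τ k * conjFree U₀ ((k + 1 : ℕ) * τ) E := by
  ext1 f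
  simp only [trotter, conjFree, pow_succ, ContinuousLinearMap.comp_apply,
    mul_apply_eq_comp, hU.apply_apply]
  congr 4
  push_cast; ring

lemma IsFree.norm_trotter_apply (hU : IsFree F U₀) {E : L2Sp d →L[ℂ] L2Sp d}
    (hE : ∀ f, ‖E f‖ = ‖f‖) (τ : ℝ) (k : ℕ) (f : L2Sp d) : ‖trotter U₀ E τ k f‖ = ‖f‖ := by
  induction k generalizing f with
  | zero => simp [hU.trotter_zero]
  | succ k ih =>
    rw [hU.trotter_succ, mul_apply_eq_comp, ih]
    simp only [conjFree, ContinuousLinearMap.comp_apply]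
    rw [hU.norm_apply, hE, hU.norm_apply]

lemma IsFree.sj_trotter_le (hU : IsFree F U₀) {Ω : Euc d × Euc d → ℝ≥0∞}
    (hΩ : IsWeight Ω) {g : Euc d → ℂ} {T E : L2Sp d →L[ℂ] L2Sp d} (hT : IsMulBy g T) (τ : ℝ)
    (hE : IsMulBy (fun x => Complex.exp (-(τ : ℂ) * Complex.I * g x)) E) {M : ℝ}
    (hM : ∀ x, ‖g x‖ ≤ M) {β : ℝ≥0} (k : ℕ)
    (hβ : ∀ j ≤ k, sj Ω (conjFree U₀ (j * τ) T) ≤ β) :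
    sj Ω (trotter U₀ E τ k) ≤ ENNReal.ofReal (Real.exp (k * (|τ| * β))) * sj Ω 1 := by
  induction k with
  | zero => simp [hU.trotter_zero]
  | succ k ih =>
    rw [hU.trotter_succ]
    refine (hU.sj_mul_conjFree_exp_le hΩ hT τ hE hM (hβ (k + 1) le_rfl) _).trans ?_
    refine (mul_le_mul_right (ih fun j hj => hβ j (hj.trans k.le_succ)) _).trans_eq ?_
    rw [← mul_assoc, ← ENNReal.ofReal_mul (Real.exp_pos _).le, ← Real.exp_add]
    congr 3
    push_cast; ring

/-- The Trotter products converge strongly, with uniform off-diagonal decay. -/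
lemma IsFree.exists_trotter_limit (hU : IsFree F U₀) {V : Euc d → ℝ} (hV : Continuous V) {M : ℝ}
    (hM : ∀ x, |V x| ≤ M) (hfin : ∫⁻ ξ, specSup (fun x => (V x : ℂ)) ξ < ⊤)
    {Mul : ℝ → L2Sp d →L[ℂ] L2Sp d}
    (hMul : ∀ τ : ℝ, IsMulBy (fun x => Complex.exp (-(τ : ℂ) * Complex.I * (V x : ℂ))) (Mul τ))
    (t : ℝ) : ∃ W : L2Sp d →L[ℂ] L2Sp d,
      (∀ f, Tendsto (fun n : ℕ => trotter U₀ (Mul (t / n)) (t / n) n f) atTop (𝓝 (W f))) ∧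
      ∃ β : ℝ≥0, ∀ l : ℝ≥0, ∀ᶠ N : ℕ in atTop, sj (farWeight l N) W ≤ β ∧
        ∀ n : ℕ, 1 ≤ n → sj (farWeight l N) (trotter U₀ (Mul (t / n)) (t / n) n) ≤ β := by
  have hVc : Continuous fun x => (V x : ℂ) := Complex.continuous_ofReal.comp hV
  have hMc : ∀ x, ‖(V x : ℂ)‖ ≤ M := fun x => by rw [Complex.norm_real]; exact hM x
  have hM0 : 0 ≤ M := (abs_nonneg _).trans (hM 0)
  obtain ⟨T, hT⟩ := exists_isMulBy hVc hMc
  have hiso : ∀ τ f, ‖Mul τ f‖ = ‖f‖ := fun τ f => (hMul τ).norm_apply_eq (fun x => by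
    rw [Complex.norm_exp]; simp) f
  have hcauchy : ∀ f, CauchySeq fun n : ℕ => trotter U₀ (Mul (t / n)) (t / n) n f := by
    intro f
    refine cauchySeq_product
      (D := fun r f => ((t : ℂ) * Complex.I) • conjFree U₀ (r * t) T f) (M := |t| * M)
      (C := (|t| * M) ^ 2 * Real.exp (|t| * M))
      (P := fun n k f => trotter U₀ (Mul (t / n)) (t / n) k f)
      (A := fun n k f => conjFree U₀ (k * (t / n)) (Mul (t / n)) f)
      ?_ (by positivity) ?_ (by positivity) ?_ ?_ ?_ ?_ f
    · simp only [conjFree, ContinuousLinearMap.comp_apply]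
      have h1 : Continuous fun p : ℝ × L2Sp d => U₀ (-(p.1 * t)) p.2 :=
        hU.continuous_uncurry.comp (f := fun p : ℝ × L2Sp d => (-(p.1 * t), p.2)) (by fun_prop)
      have h2 := hU.continuous_uncurry.comp
        (f := fun p : ℝ × L2Sp d => (p.1 * t, T (U₀ (-(p.1 * t)) p.2)))
        ((continuous_fst.mul continuous_const).prodMk (T.continuous.comp h1))
      exact h2.const_smul ((t : ℂ) * Complex.I)
    · intro r f g
      rw [← smul_sub, ← map_sub, norm_smul]
      simp only [conjFree, ContinuousLinearMap.comp_apply, hU.norm_apply]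
      have h1 := hT.norm_apply_le hMc (U₀ (-(r * t)) (f - g))
      rw [hU.norm_apply] at h1
      rw [norm_mul, Complex.norm_I, mul_one, Complex.norm_real, Real.norm_eq_abs, mul_assoc]
      gcongr
    · intro n k f g
      rw [← map_sub, hU.norm_trotter_apply (hiso _)]
    · intro n f
      simp [hU.trotter_zero]
    · intro n k f
      simp only [hU.trotter_succ, mul_apply_eq_comp]
    · intro n k f hk
      have hn : (0 : ℝ) < n := by exact_mod_cast (Nat.zero_le k).trans_lt hk
      set τ : ℝ := t / n with hτ
      set s : ℝ := ((k + 1 : ℕ) : ℝ) * τ with hs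
      have hs2 : ((k + 1 : ℕ) : ℝ) / n * t = s := by rw [hs, hτ]; ring
      have hE := ((hMul τ).sub IsMulBy.one).sub (hT.smul (-(τ : ℂ) * Complex.I))
      have hτn : |τ| ≤ |t| := by
        rw [hτ, abs_div, Nat.abs_cast]
        exact div_le_self (abs_nonneg _) (by exact_mod_cast (Nat.zero_le k).trans_lt hk)
      have hbd : ∀ x, ‖Complex.exp (-(τ : ℂ) * Complex.I * (V x : ℂ)) - 1 -
          -(τ : ℂ) * Complex.I * (V x : ℂ)‖ ≤ (|t| * M) ^ 2 * Real.exp (|t| * M) *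
            ((n : ℝ)⁻¹) ^ 2 := by
        intro x
        have h1 := Complex.norm_exp_sub_sum_le_norm_mul_exp (-(τ : ℂ) * Complex.I * (V x : ℂ)) 2
        have h2 : ‖-(τ : ℂ) * Complex.I * (V x : ℂ)‖ = |τ| * |V x| := by simp
        rw [h2] at h1
        simp only [Finset.sum_range_succ, Finset.range_zero, Finset.sum_empty, pow_zero,
          Nat.factorial, Nat.cast_one, div_one, zero_add, pow_one, Nat.succ_eq_add_one,
          mul_one] at h1
        rw [← sub_sub] at h1
        refine h1.trans ?_
        have h3 : |τ| * |V x| ≤ (|t| * M) * (n : ℝ)⁻¹ := by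
          rw [hτ, abs_div, Nat.abs_cast, div_eq_mul_inv, mul_right_comm]
          have := hM x
          gcongr
        have h4 : |τ| * |V x| ≤ |t| * M := by
          have := hM x
          gcongr
        calc (|τ| * |V x|) ^ 2 * Real.exp (|τ| * |V x|)
            ≤ ((|t| * M) * (n : ℝ)⁻¹) ^ 2 * Real.exp (|t| * M) := by gcongr
          _ = _ := by ring
      have h5 := hE.norm_apply_le hbd (U₀ (-s) f)
      rw [hU.norm_apply] at h5
      refine le_of_eq_of_le ?_ h5
      refine Eq.trans ?_ (hU.norm_apply s _)
      congr 1
      simp only [hs2, conjFree, ContinuousLinearMap.comp_apply, map_sub, sub_apply,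
        smul_apply, one_apply_eq_self, map_smul, hU.apply_apply,
        add_neg_cancel, hU.zero_apply]
      have h6 : ((n : ℝ)⁻¹ • ((t : ℂ) * Complex.I) • (U₀ s) (T ((U₀ (-s)) f))) =
          ((τ : ℂ) * Complex.I) • (U₀ s) (T ((U₀ (-s)) f)) := by
        rw [RCLike.real_smul_eq_coe_smul (K := ℂ), smul_smul, hτ]
        congr 1
        push_cast; ring
      rw [h6, neg_mul, neg_smul]
      abel
  choose W' hW' using fun f => cauchySeq_tendsto_of_complete (hcauchy f)
  let W := continuousLinearMapOfTendsto (fun n : ℕ => trotter U₀ (Mul (t / n)) (t / n) n)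
    (tendsto_pi_nhds.2 hW')
  have hW : ∀ f, Tendsto (fun n : ℕ => trotter U₀ (Mul (t / n)) (t / n) n f) atTop (𝓝 (W f)) := hW'
  obtain ⟨β₁, h₁⟩ := hU.exists_sj_one_le
  obtain ⟨β, hβ⟩ := hU.exists_sj_conjFree_le hT hVc hMc hfin |t|
  refine ⟨W, hW, (Real.exp (|t| * β)).toNNReal * β₁, fun l => ?_⟩
  filter_upwards [h₁ l, hβ l] with N hN1 hN
  have hbound : ∀ n : ℕ, 1 ≤ n → sj (farWeight l N) (trotter U₀ (Mul (t / n)) (t / n) n) ≤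
      ((Real.exp (|t| * β)).toNNReal * β₁ : ℝ≥0) := by
    intro n hn
    have hn0 : (0 : ℝ) < n := by exact_mod_cast hn
    have h2 := hU.sj_trotter_le (isWeight_farWeight l N) hT (t / n) (hMul (t / n)) hMc n
      (β := β) (fun j hj => hN _ (by
        rw [abs_mul, abs_div, Nat.abs_cast, Nat.abs_cast, mul_div_assoc']
        rw [div_le_iff₀ hn0, mul_comm]
        have : (j : ℝ) ≤ n := by exact_mod_cast hj
        gcongr))
    refine h2.trans ?_
    rw [ENNReal.coe_mul]
    refine mul_le_mul' (le_of_eq ?_) hN1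
    rw [ENNReal.ofReal]
    congr 3
    rw [abs_div, Nat.abs_cast]
    field_simp
  refine ⟨?_, hbound⟩
  exact sj_le_of_tendsto (isWeight_farWeight l N)
    (S := fun n : ℕ => trotter U₀ (Mul (t / (n + 1 : ℕ))) (t / (n + 1 : ℕ)) (n + 1))
    (fun f => (hW f).comp (tendsto_add_atTop_nat 1)) (fun n => hbound (n + 1) (by omega))

end TrotterKernel

namespace TrotterKernel

/-! ### Integral kernels -/

variable {d : ℕ} {F : L2Sp d ≃ₗᵢ[ℂ] L2Sp d} {U₀ : ℝ → L2Sp d →L[ℂ] L2Sp d}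

/-- The total mass of a Gaussian. -/
def gaussMass (d : ℕ) (b : ℝ) : ℝ≥0∞ := ∫⁻ x : Euc d, ENNReal.ofReal (Real.exp (-b * ‖x‖ ^ 2))

lemma gaussMass_lt_top {b : ℝ} (hb : 0 < b) : gaussMass d b < ⊤ := by
  have := integrable_rexp_sq hb (0 : Euc d)
  simp only [sub_zero] at this
  exact this.lintegral_lt_top

lemma lintegral_gauss_sub (b : ℝ) (c : Euc d) :
    ∫⁻ x : Euc d, ENNReal.ofReal (Real.exp (-b * ‖x - c‖ ^ 2)) = gaussMass d b :=
  lintegral_sub_right_eq_self (fun x : Euc d => ENNReal.ofReal (Real.exp (-b * ‖x‖ ^ 2))) c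

/-- A Gaussian bump in phase space. -/
def bump (ε t : ℝ) (x y : Euc d) (a : Euc d) (z : Euc d × Euc d) : ℝ≥0∞ :=
  ENNReal.ofReal (Real.exp (-ε * ‖x - a‖ ^ 2) * Real.exp (-ε * ‖y - ctr t z‖ ^ 2))

lemma continuous_bump (ε t : ℝ) (x y : Euc d) :
    Continuous fun p : Euc d × (Euc d × Euc d) => bump ε t x y p.1 p.2 := by
  unfold bump ctr
  exact ENNReal.continuous_ofReal.comp (by fun_prop)

lemma lintegral_bump (ε : ℝ) {t : ℝ} (ht : t ≠ 0) (x y h : Euc d) :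
    ∫⁻ z : Euc d × Euc d, bump ε t x y (z.1 + h) z =
      gaussMass d ε * gaussMass d (ε * (2 * π * t) ^ 2) := by
  have hm : Measurable fun z : Euc d × Euc d => bump ε t x y (z.1 + h) z :=
    ((continuous_bump ε t x y).comp (f := fun z : Euc d × Euc d => (z.1 + h, z))
      (by fun_prop)).measurable
  rw [Measure.volume_eq_prod, lintegral_prod _ (by exact hm.aemeasurable)]
  have h1 : ∀ z₁ : Euc d, ∫⁻ z₂ : Euc d, bump ε t x y (z₁ + h) (z₁, z₂) =
      ENNReal.ofReal (Real.exp (-ε * ‖z₁ - (x - h)‖ ^ 2)) * gaussMass d (ε * (2 * π * t) ^ 2) := by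
    intro z₁
    have h2 : ∀ z₂ : Euc d, bump ε t x y (z₁ + h) (z₁, z₂) =
        ENNReal.ofReal (Real.exp (-ε * ‖z₁ - (x - h)‖ ^ 2)) * ENNReal.ofReal
          (Real.exp (-(ε * (2 * π * t) ^ 2) * ‖z₂ - (2 * π * t)⁻¹ • (z₁ - y)‖ ^ 2)) := by
      intro z₂
      have hc : 2 * π * t ≠ 0 := by have := Real.pi_ne_zero; positivity
      have h3 : y - ctr t (z₁, z₂) = (2 * π * t) • (z₂ - (2 * π * t)⁻¹ • (z₁ - y)) := by
        rw [smul_sub, smul_smul, mul_inv_cancel₀ hc, one_smul]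
        simp only [ctr]
        abel
      have h4 : ‖x - (z₁ + h)‖ = ‖z₁ - (x - h)‖ := by
        rw [norm_sub_rev]; congr 1; abel
      unfold bump
      rw [h3, h4, ENNReal.ofReal_mul (Real.exp_pos _).le, norm_smul, mul_pow, Real.norm_eq_abs,
        sq_abs]
      congr 3
      ring
    simp_rw [h2]
    rw [lintegral_const_mul' _ _ ENNReal.ofReal_ne_top, lintegral_gauss_sub]
  simp_rw [h1]
  rw [lintegral_mul_const _ (by fun_prop), lintegral_gauss_sub]

lemma lintegral_pair_bump (ε : ℝ) {t : ℝ} (ht : t ≠ 0) (x y : Euc d)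
    {Φ : Euc d × Euc d → ℝ≥0∞} (hΦ : Measurable Φ) :
    ∫⁻ p : (Euc d × Euc d) × (Euc d × Euc d), Φ (p.1 - p.2) * bump ε t x y p.1.1 p.2 =
      (gaussMass d ε * gaussMass d (ε * (2 * π * t) ^ 2)) * ∫⁻ h, Φ h := by
  have hb : Continuous fun p : (Euc d × Euc d) × (Euc d × Euc d) => bump ε t x y p.1.1 p.2 :=
    (continuous_bump ε t x y).comp (f := fun p : (Euc d × Euc d) × (Euc d × Euc d) => (p.1.1, p.2))
      (by fun_prop)
  have hm : Measurable fun p : (Euc d × Euc d) × (Euc d × Euc d) =>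
      Φ (p.1 - p.2) * bump ε t x y p.1.1 p.2 :=
    (hΦ.comp (measurable_fst.sub measurable_snd)).mul hb.measurable
  rw [Measure.volume_eq_prod, lintegral_prod_symm _ hm.aemeasurable]
  have h1 : ∀ z : Euc d × Euc d, ∫⁻ w : Euc d × Euc d, Φ (w - z) * bump ε t x y w.1 z =
      ∫⁻ h : Euc d × Euc d, Φ h * bump ε t x y (z.1 + h.1) z := by
    intro z
    rw [← lintegral_add_right_eq_self (fun w => Φ (w - z) * bump ε t x y w.1 z) z]
    refine lintegral_congr fun h => ?_
    rw [add_sub_cancel_right, Prod.fst_add, add_comm h.1]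
  simp_rw [h1]
  have hm2 : Measurable fun p : (Euc d × Euc d) × (Euc d × Euc d) =>
      Φ p.2 * bump ε t x y (p.1.1 + p.2.1) p.1 :=
    (hΦ.comp measurable_snd).mul ((continuous_bump ε t x y).comp
      (f := fun p : (Euc d × Euc d) × (Euc d × Euc d) => (p.1.1 + p.2.1, p.1))
      (by fun_prop)).measurable
  rw [lintegral_lintegral_swap (by exact hm2.aemeasurable)]
  have h2 : ∀ h : Euc d × Euc d, ∫⁻ z : Euc d × Euc d, Φ h * bump ε t x y (z.1 + h.1) z =
      Φ h * (gaussMass d ε * gaussMass d (ε * (2 * π * t) ^ 2)) := by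
    intro h
    have h3 : Measurable fun z : Euc d × Euc d => bump ε t x y (z.1 + h.1) z :=
      ((continuous_bump ε t x y).comp
        (f := fun z : Euc d × Euc d => (z.1 + h.1, z)) (by fun_prop)).measurable
    rw [lintegral_const_mul _ h3, lintegral_bump ε ht]
  simp_rw [h2]
  rw [lintegral_mul_const _ hΦ, mul_comm]

/-- The integrand of the kernel. -/
def kernTerm (T : L2Sp d →L[ℂ] L2Sp d) (t : ℝ) (x y : Euc d)
    (p : (Euc d × Euc d) × (Euc d × Euc d)) : ℂ :=
  coeff T p.1 p.2 * packet 0 p.1 x * (starRingEnd ℂ) (packet t p.2 y)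

/-- The integral kernel of `T ∘ U₀ t`. -/
def kern (T : L2Sp d →L[ℂ] L2Sp d) (t : ℝ) (x y : Euc d) : ℂ := ∫ p, kernTerm T t x y p

lemma continuous_kernTerm (T : L2Sp d →L[ℂ] L2Sp d) (t : ℝ) :
    Continuous fun q : (Euc d × Euc d) × ((Euc d × Euc d) × (Euc d × Euc d)) =>
      kernTerm T t q.1.1 q.1.2 q.2 := by
  unfold kernTerm
  have h1 := (continuous_coeff T).comp (continuous_snd (X := Euc d × Euc d)
    (Y := (Euc d × Euc d) × (Euc d × Euc d)))
  have h2 := (continuous_packet (d := d) 0).comp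
    (f := fun q : (Euc d × Euc d) × ((Euc d × Euc d) × (Euc d × Euc d)) => (q.2.1, q.1.1))
    (by fun_prop)
  have h3 := (continuous_packet (d := d) t).comp
    (f := fun q : (Euc d × Euc d) × ((Euc d × Euc d) × (Euc d × Euc d)) => (q.2.2, q.1.2))
    (by fun_prop)
  exact (h1.mul h2).mul (Complex.continuous_conj.comp h3)

/-- The weight which dominates the integrand of the kernel, up to a constant. -/
def pairBump (t : ℝ) (p : (Euc d × Euc d) × (Euc d × Euc d)) : ℝ :=
  Real.exp (-(rate t / 2) * ‖p.1.1‖ ^ 2) * Real.exp (-(rate t / 2) * ‖ctr t p.2‖ ^ 2)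

lemma pairBump_pos (t : ℝ) (p : (Euc d × Euc d) × (Euc d × Euc d)) : 0 < pairBump t p := by
  unfold pairBump; positivity

lemma continuous_pairBump (t : ℝ) : Continuous (pairBump (d := d) t) := by
  unfold pairBump ctr; fun_prop

lemma ofReal_pairBump (t : ℝ) (p : (Euc d × Euc d) × (Euc d × Euc d)) :
    ENNReal.ofReal (pairBump t p) = bump (rate t / 2) t 0 0 p.1.1 p.2 := by
  simp [pairBump, bump]

/-- The constant in the local bound for kernels. -/
def kernConst (d : ℕ) (t R : ℝ) : ℝ := winConst d * ‖amp d t‖ * Real.exp (2 * (rate t * R ^ 2))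

lemma norm_packet_mul_le (t : ℝ) {R : ℝ} {x y : Euc d} (hx : ‖x‖ ≤ R) (hy : ‖y‖ ≤ R)
    (p : (Euc d × Euc d) × (Euc d × Euc d)) :
    ‖packet 0 p.1 x‖ * ‖packet t p.2 y‖ ≤ kernConst d t R * pairBump t p := by
  rw [norm_packet_zero, norm_packet]
  have h1 : Real.exp (-(π / 4) * ‖x - p.1.1‖ ^ 2) ≤ Real.exp (-rate t * ‖p.1.1 - x‖ ^ 2) := by
    rw [norm_sub_rev]
    have := rate_le t
    gcongr
  have h2 := exp_neg_sq_le (rate_pos t).le p.1.1 x hx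
  have h3 := exp_neg_sq_le (rate_pos t).le (ctr t p.2) y hy
  rw [norm_sub_rev] at h3
  have hw := winConst_nonneg d
  have h4 : Real.exp (2 * (rate t * R ^ 2)) =
      Real.exp (rate t * R ^ 2) * Real.exp (rate t * R ^ 2) := by
    rw [← Real.exp_add]; congr 1; ring
  calc _ ≤ (winConst d * (Real.exp (rate t * R ^ 2) * Real.exp (-(rate t / 2) * ‖p.1.1‖ ^ 2))) *
        (‖amp d t‖ * (Real.exp (rate t * R ^ 2) * Real.exp (-(rate t / 2) * ‖ctr t p.2‖ ^ 2))) := by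
        gcongr
        exact h1.trans h2
    _ = _ := by rw [kernConst, pairBump, h4]; ring

lemma kernConst_nonneg (t R : ℝ) : 0 ≤ kernConst d t R := by
  have := winConst_nonneg d
  unfold kernConst; positivity

lemma norm_kernTerm_le (T : L2Sp d →L[ℂ] L2Sp d) (t : ℝ) {R : ℝ} {x y : Euc d} (hx : ‖x‖ ≤ R)
    (hy : ‖y‖ ≤ R) (p : (Euc d × Euc d) × (Euc d × Euc d)) :
    ‖kernTerm T t x y p‖ ≤ kernConst d t R * (‖coeff T p.1 p.2‖ * pairBump t p) := by
  unfold kernTerm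
  rw [norm_mul, norm_mul, RCLike.norm_conj, mul_assoc]
  calc _ ≤ ‖coeff T p.1 p.2‖ * (kernConst d t R * pairBump t p) :=
        mul_le_mul_of_nonneg_left (norm_packet_mul_le t hx hy p) (norm_nonneg _)
    _ = _ := by ring

lemma integrable_coeff_mul_pairBump {T : L2Sp d →L[ℂ] L2Sp d} (hT : ∫⁻ h, env T h < ⊤) {t : ℝ}
    (ht : t ≠ 0) : Integrable fun p : (Euc d × Euc d) × (Euc d × Euc d) =>
      ‖coeff T p.1 p.2‖ * pairBump t p := by
  refine ⟨((continuous_coeff T).norm.mul (continuous_pairBump t)).aestronglyMeasurable, ?_⟩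
  have hc : 0 < (2 * π * t) ^ 2 := by have := Real.pi_ne_zero; positivity
  have hr := rate_pos t
  calc ∫⁻ p : (Euc d × Euc d) × (Euc d × Euc d), ‖‖coeff T p.1 p.2‖ * pairBump t p‖ₑ
      ≤ ∫⁻ p : (Euc d × Euc d) × (Euc d × Euc d),
          env T (p.1 - p.2) * bump (rate t / 2) t 0 0 p.1.1 p.2 := by
        refine lintegral_mono fun p => ?_
        rw [enorm_mul, enorm_norm, Real.enorm_of_nonneg (pairBump_pos t p).le, ofReal_pairBump]
        exact mul_le_mul_left (enorm_coeff_le T _ _) _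
    _ = _ := lintegral_pair_bump _ ht 0 0 (measurable_env T)
    _ < ⊤ := ENNReal.mul_lt_top (ENNReal.mul_lt_top (gaussMass_lt_top (by positivity))
        (gaussMass_lt_top (by positivity))) hT

lemma integrable_kernTerm {T : L2Sp d →L[ℂ] L2Sp d} (hT : ∫⁻ h, env T h < ⊤) {t : ℝ}
    (ht : t ≠ 0) (x y : Euc d) : Integrable (kernTerm T t x y) := by
  have hc : Continuous (kernTerm T t x y) := (continuous_kernTerm T t).comp
    (f := fun p : (Euc d × Euc d) × (Euc d × Euc d) => ((x, y), p)) (by fun_prop)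
  exact ((integrable_coeff_mul_pairBump hT ht).const_mul
    (kernConst d t (max ‖x‖ ‖y‖))).mono' hc.aestronglyMeasurable (Eventually.of_forall fun p =>
      norm_kernTerm_le T t (le_max_left _ _) (le_max_right _ _) p)

lemma continuous_kern {T : L2Sp d →L[ℂ] L2Sp d} (hT : ∫⁻ h, env T h < ⊤) {t : ℝ}
    (ht : t ≠ 0) : Continuous fun q : Euc d × Euc d => kern T t q.1 q.2 := by
  rw [continuous_iff_continuousAt]
  intro q₀
  have hb : ∀ᶠ q : Euc d × Euc d in 𝓝 q₀,
      ∀ᵐ p : (Euc d × Euc d) × (Euc d × Euc d), ‖kernTerm T t q.1 q.2 p‖ ≤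
        kernConst d t (‖q₀‖ + 1) * (‖coeff T p.1 p.2‖ * pairBump t p) := by
    filter_upwards [Metric.ball_mem_nhds q₀ one_pos] with q hq
    refine Eventually.of_forall fun p => ?_
    have h1 : ‖q‖ ≤ ‖q₀‖ + 1 := by
      have := norm_le_norm_add_norm_sub' q q₀
      rw [mem_ball_iff_norm] at hq
      linarith
    exact norm_kernTerm_le T t ((norm_fst_le q).trans h1) ((norm_snd_le q).trans h1) p
  have hc : ∀ᵐ p : (Euc d × Euc d) × (Euc d × Euc d),
      ContinuousAt (fun q : Euc d × Euc d => kernTerm T t q.1 q.2 p) q₀ :=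
    Eventually.of_forall fun p => ((continuous_kernTerm T t).comp
      (f := fun q : Euc d × Euc d => (q, p)) (by fun_prop)).continuousAt
  exact continuousAt_of_dominated
    (Eventually.of_forall fun q => (integrable_kernTerm hT ht q.1 q.2).aestronglyMeasurable) hb
    ((integrable_coeff_mul_pairBump hT ht).const_mul _) hc

lemma enorm_kern_sub_le {S T : L2Sp d →L[ℂ] L2Sp d} (hS : ∫⁻ h, env S h < ⊤)
    (hT : ∫⁻ h, env T h < ⊤) {t : ℝ} (ht : t ≠ 0) {R : ℝ} {x y : Euc d} (hx : ‖x‖ ≤ R)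
    (hy : ‖y‖ ≤ R) : ‖kern S t x y - kern T t x y‖ₑ ≤ ENNReal.ofReal (kernConst d t R) *
      ∫⁻ p : (Euc d × Euc d) × (Euc d × Euc d),
        ‖coeff S p.1 p.2 - coeff T p.1 p.2‖ₑ * bump (rate t / 2) t 0 0 p.1.1 p.2 := by
  unfold kern
  rw [← integral_sub (integrable_kernTerm hS ht x y) (integrable_kernTerm hT ht x y)]
  refine (enorm_integral_le_lintegral_enorm _).trans ?_
  rw [← lintegral_const_mul' _ _ ENNReal.ofReal_ne_top]
  refine lintegral_mono fun p => ?_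
  have h1 : kernTerm S t x y p - kernTerm T t x y p = (coeff S p.1 p.2 - coeff T p.1 p.2) *
      (packet 0 p.1 x * (starRingEnd ℂ) (packet t p.2 y)) := by
    unfold kernTerm; ring
  rw [h1, enorm_mul, mul_left_comm, ← ofReal_pairBump,
    ← ENNReal.ofReal_mul (kernConst_nonneg t R)]
  refine mul_le_mul_right ?_ _
  rw [← ofReal_norm, norm_mul, RCLike.norm_conj]
  exact ENNReal.ofReal_le_ofReal (norm_packet_mul_le t hx hy p)

end TrotterKernel

namespace TrotterKernel

variable {d : ℕ} {F : L2Sp d ≃ₗᵢ[ℂ] L2Sp d} {U₀ : ℝ → L2Sp d →L[ℂ] L2Sp d}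

lemma enorm_packet_mul_le (t : ℝ) (x y : Euc d) (p : (Euc d × Euc d) × (Euc d × Euc d)) :
    ‖packet 0 p.1 x * (starRingEnd ℂ) (packet t p.2 y)‖ₑ ≤
      ENNReal.ofReal (winConst d * ‖amp d t‖) * bump (rate t) t x y p.1.1 p.2 := by
  have hw := winConst_nonneg d
  unfold bump
  rw [← ENNReal.ofReal_mul (by positivity), ← ofReal_norm, norm_mul, RCLike.norm_conj,
    norm_packet_zero, norm_packet]
  apply ENNReal.ofReal_le_ofReal
  have := rate_le t
  calc _ ≤ winConst d * Real.exp (-rate t * ‖x - p.1.1‖ ^ 2) *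
        (‖amp d t‖ * Real.exp (-rate t * ‖y - ctr t p.2‖ ^ 2)) := by gcongr
    _ = _ := by ring

lemma lintegral_enorm_kernTerm_le (T : L2Sp d →L[ℂ] L2Sp d) {t : ℝ} (ht : t ≠ 0) (x y : Euc d) :
    ∫⁻ p, ‖kernTerm T t x y p‖ₑ ≤ ENNReal.ofReal (winConst d * ‖amp d t‖) *
      ((gaussMass d (rate t) * gaussMass d (rate t * (2 * π * t) ^ 2)) * ∫⁻ h, env T h) := by
  rw [← lintegral_pair_bump _ ht x y (measurable_env T),
    ← lintegral_const_mul' _ _ ENNReal.ofReal_ne_top]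
  refine lintegral_mono fun p => ?_
  unfold kernTerm
  rw [mul_assoc, enorm_mul, mul_left_comm]
  exact mul_le_mul' (enorm_coeff_le T _ _) (enorm_packet_mul_le t x y p)

lemma integrable_kernTerm_mul {T : L2Sp d →L[ℂ] L2Sp d} (hT : ∫⁻ h, env T h < ⊤) {t : ℝ}
    (ht : t ≠ 0) {φ : Euc d → ℂ} (hφ : Integrable φ) {s : Set (Euc d)} (hs : volume s < ⊤) :
    Integrable (fun q : (Euc d × Euc d) × ((Euc d × Euc d) × (Euc d × Euc d)) =>
      kernTerm T t q.1.1 q.1.2 q.2 * φ q.1.2)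
      (((volume.restrict s).prod volume).prod volume) := by
  have hm : AEStronglyMeasurable
      (fun q : (Euc d × Euc d) × ((Euc d × Euc d) × (Euc d × Euc d)) =>
        kernTerm T t q.1.1 q.1.2 q.2 * φ q.1.2)
      (((volume.restrict s).prod volume).prod volume) :=
    (continuous_kernTerm T t).aestronglyMeasurable.mul hφ.aestronglyMeasurable.comp_snd.comp_fst
  refine ⟨hm, ?_⟩
  set K := ENNReal.ofReal (winConst d * ‖amp d t‖) *
    ((gaussMass d (rate t) * gaussMass d (rate t * (2 * π * t) ^ 2)) * ∫⁻ h, env T h) with hK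
  have hKtop : K < ⊤ := by
    have hc : 0 < (2 * π * t) ^ 2 := by have := Real.pi_ne_zero; positivity
    have hr := rate_pos t
    exact ENNReal.mul_lt_top ENNReal.ofReal_lt_top (ENNReal.mul_lt_top
      (ENNReal.mul_lt_top (gaussMass_lt_top hr) (gaussMass_lt_top (by positivity))) hT)
  have hm' := hm.enorm
  rw [hasFiniteIntegral_iff_enorm, lintegral_prod _ hm']
  have h1 : ∀ q : Euc d × Euc d, ∫⁻ p, ‖kernTerm T t q.1 q.2 p * φ q.2‖ₑ ≤ K * ‖φ q.2‖ₑ := by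
    intro q
    simp_rw [enorm_mul]
    rw [lintegral_mul_const' _ _ enorm_ne_top]
    exact mul_le_mul_left (lintegral_enorm_kernTerm_le T ht q.1 q.2) _
  refine (lintegral_mono h1).trans_lt ?_
  have h2 : AEMeasurable (fun q : Euc d × Euc d => K * ‖φ q.2‖ₑ)
      ((volume.restrict s).prod volume) :=
    (hφ.aestronglyMeasurable.comp_snd (μ := volume.restrict s)).enorm.const_mul K
  rw [lintegral_prod _ h2]
  simp_rw [lintegral_const_mul' _ _ hKtop.ne]
  refine ENNReal.mul_lt_top hKtop ?_
  rw [lintegral_const]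
  refine ENNReal.mul_lt_top hφ.hasFiniteIntegral ?_
  simpa using hs

/-- `kern T t` is the integral kernel of `T ∘ U₀ t`. -/
lemma IsFree.apply_eq_integral_kern (hU : IsFree F U₀) {T : L2Sp d →L[ℂ] L2Sp d}
    (hT : ∫⁻ h, env T h < ⊤) {t : ℝ} (ht : t ≠ 0) {φ : Euc d → ℂ} (hφ : Integrable φ)
    {f : L2Sp d} (hf : f =ᵐ[volume] φ) :
    (T (U₀ t f) : Euc d → ℂ) =ᵐ[volume] fun x => ∫ y, kern T t x y * φ y := by
  have hmain : ∀ s : Set (Euc d), MeasurableSet s → volume s < ⊤ →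
      IntegrableOn (fun x => ∫ y, kern T t x y * φ y) s ∧
      ∫ x in s, T (U₀ t f) x = ∫ x in s, ∫ y, kern T t x y * φ y := by
    intro s hs hμ
    have hI := integrable_kernTerm_mul hT ht hφ hμ
    have hkern : ∀ q : Euc d × Euc d, ∫ p, kernTerm T t q.1 q.2 p * φ q.2 =
        kern T t q.1 q.2 * φ q.2 := fun q => integral_mul_const _ _
    have hI1 := hI.integral_prod_left
    simp only [hkern] at hI1
    refine ⟨hI1.integral_prod_left, ?_⟩
    rw [← L2.inner_indicatorConstLp_one hs hμ.ne, ← hU.integral_inner_mul_inner]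
    set χ := indicatorConstLp 2 hs hμ.ne (1 : ℂ) with hχ
    have hcoef : ∀ w : Euc d × Euc d, inner ℂ (wp 0 w) (T (U₀ t f)) =
        ∫ z : Euc d × Euc d, coeff T w z * inner ℂ (wp t z) f := by
      intro w
      rw [← ContinuousLinearMap.adjoint_inner_left, ← hU.integral_inner_mul_inner]
      refine integral_congr_ae (Eventually.of_forall fun z => ?_)
      simp only
      rw [ContinuousLinearMap.adjoint_inner_left]
      have h1 : inner ℂ (wp 0 z) (U₀ t f) = inner ℂ (wp t z) f := by
        have h2 := hU.inner_apply (-t) (wp 0 z) f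
        rw [hU.apply_wp, neg_neg, zero_sub, neg_neg] at h2
        exact h2.symm
      rw [h1]; rfl
    have hχw : ∀ w : Euc d × Euc d, inner ℂ χ (wp 0 w) = ∫ x in s, packet 0 w x := by
      intro w
      rw [hχ, L2.inner_indicatorConstLp_one hs hμ.ne]
      exact integral_congr_ae (ae_restrict_of_ae (coeFn_wp 0 w))
    have hfz : ∀ z : Euc d × Euc d, inner ℂ (wp t z) f =
        ∫ y, (starRingEnd ℂ) (packet t z y) * φ y := by
      intro z
      rw [inner_wp]
      refine integral_congr_ae ?_
      filter_upwards [hf] with y hy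
      rw [hy]
    have hprod : ∀ p : (Euc d × Euc d) × (Euc d × Euc d),
        ∫ q : Euc d × Euc d, kernTerm T t q.1 q.2 p * φ q.2 ∂((volume.restrict s).prod volume) =
          inner ℂ χ (wp 0 p.1) * (coeff T p.1 p.2 * inner ℂ (wp t p.2) f) := by
      intro p
      rw [hχw, hfz, mul_left_comm, ← integral_prod_mul, ← integral_const_mul]
      refine integral_congr_ae (Eventually.of_forall fun q => ?_)
      simp only [kernTerm]
      ring
    have hI2 := hI.integral_prod_right
    simp only [hprod] at hI2
    calc ∫ w : Euc d × Euc d, inner ℂ χ (wp 0 w) * inner ℂ (wp 0 w) (T (U₀ t f))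
        = ∫ w : Euc d × Euc d, ∫ z : Euc d × Euc d,
            inner ℂ χ (wp 0 w) * (coeff T w z * inner ℂ (wp t z) f) := by
          refine integral_congr_ae (Eventually.of_forall fun w => ?_)
          simp only [hcoef, integral_const_mul]
      _ = ∫ p : (Euc d × Euc d) × (Euc d × Euc d),
            inner ℂ χ (wp 0 p.1) * (coeff T p.1 p.2 * inner ℂ (wp t p.2) f) :=
          (integral_prod _ hI2).symm
      _ = ∫ p : (Euc d × Euc d) × (Euc d × Euc d), ∫ q : Euc d × Euc d,
            kernTerm T t q.1 q.2 p * φ q.2 ∂((volume.restrict s).prod volume) := by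
          simp only [hprod]
      _ = ∫ q : Euc d × Euc d, (∫ p : (Euc d × Euc d) × (Euc d × Euc d),
            kernTerm T t q.1 q.2 p * φ q.2) ∂((volume.restrict s).prod volume) :=
          (integral_integral_swap hI).symm
      _ = ∫ q : Euc d × Euc d, kern T t q.1 q.2 * φ q.2 ∂((volume.restrict s).prod volume) := by
          simp only [hkern]
      _ = _ := integral_prod _ hI1
  refine ae_eq_of_forall_setIntegral_eq_of_sigmaFinite (fun s _ hμ => ?_)
    (fun s hs hμ => (hmain s hs hμ).1) (fun s hs hμ => (hmain s hs hμ).2)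
  exact integrableOn_Lp_of_measure_ne_top _ (by norm_num) hμ.ne

end TrotterKernel

namespace TrotterKernel

variable {d : ℕ} {F : L2Sp d ≃ₗᵢ[ℂ] L2Sp d} {U₀ : ℝ → L2Sp d →L[ℂ] L2Sp d}

lemma far_le_one (n : ℕ) (h : Euc d × Euc d) : far n h ≤ 1 := by
  unfold far
  rw [← ENNReal.ofReal_one]
  exact ENNReal.ofReal_le_ofReal (min_le_left _ _)

lemma lintegral_one_sub_far_lt_top (n : ℕ) : ∫⁻ h : Euc d × Euc d, (1 - far n h) < ⊤ := by
  have h1 : ∀ h : Euc d × Euc d, 1 - far n h ≤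
      (Metric.closedBall (0 : Euc d × Euc d) (n + 1)).indicator (fun _ => 1) h := by
    intro h
    by_cases hh : h ∈ Metric.closedBall (0 : Euc d × Euc d) (n + 1)
    · rw [Set.indicator_of_mem hh]
      exact tsub_le_self
    · rw [Set.indicator_of_notMem hh]
      rw [mem_closedBall_zero_iff, not_le] at hh
      have : far n h = 1 := by
        unfold far
        rw [min_eq_left, ENNReal.ofReal_one]
        rw [le_div_iff₀ (by positivity)]
        linarith
      rw [this, tsub_self]
  refine (lintegral_mono h1).trans_lt ?_
  rw [lintegral_indicator_const measurableSet_closedBall, one_mul]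
  exact (isCompact_closedBall _ _).measure_lt_top

lemma lintegral_env_le_sj (T : L2Sp d →L[ℂ] L2Sp d) (l : ℝ≥0) (n : ℕ) :
    ∫⁻ h, env T h ≤ sj (farWeight l n) T := by
  unfold sj farWeight
  refine lintegral_mono fun h => ?_
  rw [mul_add, mul_one]
  exact le_self_add

lemma lintegral_env_mul_far_le_sj (T : L2Sp d →L[ℂ] L2Sp d) (l : ℝ≥0) (n : ℕ) :
    l * ∫⁻ h, env T h * far n h ≤ sj (farWeight l n) T := by
  unfold sj farWeight
  rw [← lintegral_const_mul' _ _ ENNReal.coe_ne_top]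
  refine lintegral_mono fun h => ?_
  rw [mul_add, mul_left_comm]
  exact le_add_self

lemma tendsto_coeff {T : ℕ → L2Sp d →L[ℂ] L2Sp d} {W : L2Sp d →L[ℂ] L2Sp d}
    (hlim : ∀ f, Tendsto (fun n => T n f) atTop (𝓝 (W f))) (w z : Euc d × Euc d) :
    Tendsto (fun n => coeff (T n) w z) atTop (𝓝 (coeff W w z)) :=
  tendsto_const_nhds.inner (hlim _)

lemma tendsto_lintegral_coeff_sub {T : ℕ → L2Sp d →L[ℂ] L2Sp d} {W : L2Sp d →L[ℂ] L2Sp d}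
    (hT : ∀ n, ‖T n‖ ≤ 1) (hW : ‖W‖ ≤ 1)
    (hlim : ∀ f, Tendsto (fun n => T n f) atTop (𝓝 (W f))) {β : ℝ≥0}
    (hβ : ∀ l : ℝ≥0, ∀ᶠ N : ℕ in atTop, sj (farWeight l N) W ≤ β ∧
      ∀ n, 1 ≤ n → sj (farWeight l N) (T n) ≤ β)
    {ε t : ℝ} (hε : 0 < ε) (ht : t ≠ 0) :
    Tendsto (fun n => ∫⁻ p : (Euc d × Euc d) × (Euc d × Euc d),
      ‖coeff (T n) p.1 p.2 - coeff W p.1 p.2‖ₑ * bump ε t 0 0 p.1.1 p.2) atTop (𝓝 0) := by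
  set C := gaussMass d ε * gaussMass d (ε * (2 * π * t) ^ 2) with hC
  have hc : 0 < (2 * π * t) ^ 2 := by have := Real.pi_ne_zero; positivity
  have hCtop : C < ⊤ :=
    ENNReal.mul_lt_top (gaussMass_lt_top hε) (gaussMass_lt_top (by positivity))
  rw [ENNReal.tendsto_nhds_zero]
  intro δ hδ
  rcases eq_or_ne δ ⊤ with rfl | hδt
  · exact Eventually.of_forall fun _ => le_top
  have hδ2 : δ / 2 ≠ 0 := (ENNReal.half_pos hδ.ne').ne'
  have hδ2t : δ / 2 ≠ ⊤ := (ENNReal.div_lt_top hδt (by norm_num)).ne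
  have hLt : C * (β + β) / (δ / 2) ≠ ⊤ :=
    (ENNReal.div_lt_top (ENNReal.mul_lt_top hCtop (by simp)).ne hδ2).ne
  set l : ℝ≥0 := (C * (β + β) / (δ / 2)).toNNReal + 1 with hl
  have hlC : C * (β + β) ≤ l * (δ / 2) := by
    rw [hl, ENNReal.coe_add, ENNReal.coe_toNNReal hLt, add_mul, ENNReal.div_mul_cancel hδ2 hδ2t]
    exact le_self_add
  have hl0 : (l : ℝ≥0∞) ≠ 0 := by
    rw [hl]; simp
  obtain ⟨N, hNW, hNT⟩ := (hβ l).exists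
  have hmb : Measurable fun p : (Euc d × Euc d) × (Euc d × Euc d) =>
      bump ε t (0 : Euc d) 0 p.1.1 p.2 :=
    ((continuous_bump ε t (0 : Euc d) 0).comp
      ((continuous_fst.comp continuous_fst).prodMk continuous_snd)).measurable
  have hmc : ∀ S : L2Sp d →L[ℂ] L2Sp d,
      Measurable fun p : (Euc d × Euc d) × (Euc d × Euc d) => coeff S p.1 p.2 :=
    fun S => (continuous_coeff S).measurable
  have hmfar : Measurable fun p : (Euc d × Euc d) × (Euc d × Euc d) => far N (p.1 - p.2) :=
    (measurable_far N).comp (measurable_fst.sub measurable_snd)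
  have hnear : Tendsto (fun n => ∫⁻ p : (Euc d × Euc d) × (Euc d × Euc d),
      ‖coeff (T n) p.1 p.2 - coeff W p.1 p.2‖ₑ *
        ((1 - far N (p.1 - p.2)) * bump ε t 0 0 p.1.1 p.2)) atTop (𝓝 0) := by
    rw [← lintegral_zero (α := (Euc d × Euc d) × (Euc d × Euc d)) (μ := volume)]
    refine tendsto_lintegral_of_dominated_convergence
      (fun p => 2 * ((1 - far N (p.1 - p.2)) * bump ε t 0 0 p.1.1 p.2)) (fun n => ?_)
      (fun n => Eventually.of_forall fun p => ?_) ?_ (Eventually.of_forall fun p => ?_)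
    · exact (((hmc _).sub (hmc _)).enorm).mul ((measurable_const.sub hmfar).mul hmb)
    · refine mul_le_mul_left ?_ _
      have h1 : ‖coeff (T n) p.1 p.2 - coeff W p.1 p.2‖ ≤ 2 := by
        refine (norm_sub_le _ _).trans ?_
        have := (norm_coeff_le (T n) p.1 p.2).trans (hT n)
        have := (norm_coeff_le W p.1 p.2).trans hW
        linarith
      rw [← ofReal_norm]
      exact (ENNReal.ofReal_le_ofReal h1).trans (by norm_num)
    · rw [lintegral_const_mul' _ _ (by norm_num)]
      rw [lintegral_pair_bump ε ht 0 0 (Φ := fun h => 1 - far N h)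
        (measurable_const.sub (measurable_far N))]
      exact (ENNReal.mul_lt_top (by norm_num) (ENNReal.mul_lt_top hCtop
        (lintegral_one_sub_far_lt_top N))).ne
    · have h1 : Tendsto (fun n => ‖coeff (T n) p.1 p.2 - coeff W p.1 p.2‖ₑ) atTop (𝓝 0) := by
        have := ((tendsto_coeff hlim p.1 p.2).sub_const (coeff W p.1 p.2)).enorm
        simpa using this
      have h2 := ENNReal.Tendsto.mul_const (b := (1 - far N (p.1 - p.2)) * bump ε t 0 0 p.1.1 p.2)
        h1 (Or.inr (ENNReal.mul_lt_top (tsub_le_self.trans_lt ENNReal.one_lt_top)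
          ENNReal.ofReal_lt_top).ne)
      simpa using h2
  have hfar : ∀ n, 1 ≤ n → ∫⁻ p : (Euc d × Euc d) × (Euc d × Euc d),
      ‖coeff (T n) p.1 p.2 - coeff W p.1 p.2‖ₑ *
        (far N (p.1 - p.2) * bump ε t 0 0 p.1.1 p.2) ≤ δ / 2 := by
    intro n hn
    have hmΦ : Measurable fun h : Euc d × Euc d => (env (T n) h + env W h) * far N h :=
      ((measurable_env _).add (measurable_env _)).mul (measurable_far N)
    have h1 : ∫⁻ p : (Euc d × Euc d) × (Euc d × Euc d),
        ‖coeff (T n) p.1 p.2 - coeff W p.1 p.2‖ₑ *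
          (far N (p.1 - p.2) * bump ε t 0 0 p.1.1 p.2) ≤
        C * ∫⁻ h, (env (T n) h + env W h) * far N h := by
      rw [← lintegral_pair_bump ε ht 0 0 hmΦ]
      refine lintegral_mono fun p => ?_
      rw [← mul_assoc]
      refine mul_le_mul_left (mul_le_mul_left ?_ _) _
      exact (enorm_sub_le).trans (add_le_add (enorm_coeff_le _ _ _) (enorm_coeff_le _ _ _))
    have h2 : l * ∫⁻ h, (env (T n) h + env W h) * far N h ≤ β + β := by
      have hm : Measurable fun h : Euc d × Euc d => env (T n) h * far N h :=
        (measurable_env _).mul (measurable_far N)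
      simp_rw [add_mul]
      rw [lintegral_add_left hm, mul_add]
      exact add_le_add ((lintegral_env_mul_far_le_sj _ _ _).trans (hNT n hn))
        ((lintegral_env_mul_far_le_sj _ _ _).trans hNW)
    refine h1.trans ?_
    rw [← ENNReal.mul_le_mul_iff_right hl0 ENNReal.coe_ne_top, mul_left_comm]
    exact (mul_le_mul_right h2 C).trans hlC
  filter_upwards [(ENNReal.tendsto_nhds_zero.1 hnear) (δ / 2) (ENNReal.half_pos hδ.ne'),
    eventually_ge_atTop 1] with n hn1 hn2
  have hm1 : Measurable fun p : (Euc d × Euc d) × (Euc d × Euc d) =>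
      ‖coeff (T n) p.1 p.2 - coeff W p.1 p.2‖ₑ *
        ((1 - far N (p.1 - p.2)) * bump ε t 0 0 p.1.1 p.2) :=
    (((hmc _).sub (hmc _)).enorm).mul ((measurable_const.sub hmfar).mul hmb)
  calc _ = ∫⁻ p : (Euc d × Euc d) × (Euc d × Euc d),
        (‖coeff (T n) p.1 p.2 - coeff W p.1 p.2‖ₑ *
          ((1 - far N (p.1 - p.2)) * bump ε t 0 0 p.1.1 p.2) +
        ‖coeff (T n) p.1 p.2 - coeff W p.1 p.2‖ₑ *
          (far N (p.1 - p.2) * bump ε t 0 0 p.1.1 p.2)) := by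
        refine lintegral_congr fun p => ?_
        rw [← mul_add, ← add_mul, tsub_add_cancel_of_le (far_le_one _ _), one_mul]
    _ ≤ δ / 2 + δ / 2 := by
        rw [lintegral_add_left hm1]
        exact add_le_add hn1 (hfar n hn2)
    _ = δ := ENNReal.add_halves δ

lemma tendstoUniformlyOn_kern {T : ℕ → L2Sp d →L[ℂ] L2Sp d} {W : L2Sp d →L[ℂ] L2Sp d}
    (hT : ∀ n, ‖T n‖ ≤ 1) (hW : ‖W‖ ≤ 1)
    (hlim : ∀ f, Tendsto (fun n => T n f) atTop (𝓝 (W f))) {β : ℝ≥0}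
    (hβ : ∀ l : ℝ≥0, ∀ᶠ N : ℕ in atTop, sj (farWeight l N) W ≤ β ∧
      ∀ n, 1 ≤ n → sj (farWeight l N) (T n) ≤ β)
    {t : ℝ} (ht : t ≠ 0) {K : Set (Euc d × Euc d)} (hK : IsCompact K) :
    TendstoUniformlyOn (fun (n : ℕ) (p : Euc d × Euc d) => kern (T n) t p.1 p.2)
      (fun p => kern W t p.1 p.2) atTop K := by
  obtain ⟨R, hR⟩ := hK.isBounded.exists_norm_le
  obtain ⟨N, hNW, hNT⟩ := (hβ 0).exists
  have hWe : ∫⁻ h, env W h < ⊤ :=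
    ((lintegral_env_le_sj W 0 N).trans hNW).trans_lt ENNReal.coe_lt_top
  have hTe : ∀ n, 1 ≤ n → ∫⁻ h, env (T n) h < ⊤ := fun n hn =>
    ((lintegral_env_le_sj (T n) 0 N).trans (hNT n hn)).trans_lt ENNReal.coe_lt_top
  have hr := rate_pos t
  have h0 := ENNReal.Tendsto.const_mul (a := ENNReal.ofReal (kernConst d t R))
    (tendsto_lintegral_coeff_sub hT hW hlim hβ (ε := rate t / 2) (by positivity) ht)
    (Or.inr ENNReal.ofReal_ne_top)
  rw [mul_zero] at h0
  rw [EMetric.tendstoUniformlyOn_iff]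
  intro δ hδ
  filter_upwards [h0.eventually (gt_mem_nhds hδ), eventually_ge_atTop 1] with n hn1 hn2 p hp
  rw [edist_comm, edist_eq_enorm_sub]
  refine (enorm_kern_sub_le (hTe n hn2) hWe ht ?_ ?_).trans_lt hn1
  · exact (norm_fst_le p).trans (hR p hp)
  · exact (norm_snd_le p).trans (hR p hp)

end TrotterKernel

namespace TrotterKernel

variable {d : ℕ}

lemma norm_sq_le_two_mul_add {E : Type*} [SeminormedAddCommGroup E] (a b : E) :
    ‖a‖ ^ 2 ≤ 2 * ‖a - b‖ ^ 2 + 2 * ‖b‖ ^ 2 := by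
  have h : ‖a‖ ≤ ‖a - b‖ + ‖b‖ := by simpa using norm_add_le (a - b) b
  nlinarith [norm_nonneg a, norm_nonneg (a - b), norm_nonneg b, sq_nonneg (‖a - b‖ - ‖b‖)]

/-- A chirped Gaussian times a Gaussian window, as a Gaussian centred at the weighted mean of the
two centres. -/
lemma chirp_mul_gauss_mul_window {b : ℂ} (hb : 0 < b.re) (θ : ℝ) (ξ y c u x : Euc d) :
    Complex.exp (-(((2 * π * ⟪ξ, x⟫ : ℝ) : ℂ) * Complex.I)) *
        Complex.exp (-(((θ * ‖x - y‖ ^ 2 : ℝ) : ℂ) * Complex.I)) *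
        Complex.exp (-b * ((‖x - c‖ ^ 2 : ℝ) : ℂ)) *
        ((Real.exp (-π * ‖x - u‖ ^ 2) : ℝ) : ℂ) =
      ((Real.exp (-(π * (b.re / (b.re + π))) * ‖u - c‖ ^ 2) : ℝ) : ℂ) *
        Complex.exp (-(((2 * π * ⟪ξ, c⟫ + θ * ‖c - y‖ ^ 2 -
          2 * π * ⟪ξ + (θ / π) • (c - y) + ((b.im + θ) / (b.re + π)) • (u - c), c⟫ -
          (b.im + θ) * (π / (b.re + π)) ^ 2 * ‖u - c‖ ^ 2 : ℝ) : ℂ) * Complex.I)) *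
        (Complex.exp (-(((2 * π *
          ⟪ξ + (θ / π) • (c - y) + ((b.im + θ) / (b.re + π)) • (u - c), x⟫ : ℝ) : ℂ) *
            Complex.I)) *
          Complex.exp (-(b + π + θ * Complex.I) *
            ((‖x - (c + (π / (b.re + π)) • (u - c))‖ ^ 2 : ℝ) : ℂ))) := by
  have hπ := Real.pi_pos
  have hR : b.re + π ≠ 0 := by positivity
  obtain ⟨X, rfl⟩ : ∃ X, x = X + c := ⟨x - c, by simp⟩
  obtain ⟨v, rfl⟩ : ∃ v, u = v + c := ⟨u - c, by simp⟩
  obtain ⟨q, rfl⟩ : ∃ q, y = c - q := ⟨c - y, by simp⟩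
  have e1 : X + c - (c - q) = X + q := by abel
  have e2 : X + c - (v + c) = X - v := by abel
  have e3 : X + c - (c + (π / (b.re + π)) • v) = X - (π / (b.re + π)) • v := by abel
  rw [show v + c - c = v by abel, show X + c - c = X by abel, show c - (c - q) = q by abel,
    e1, e2, e3, norm_add_sq_real, norm_sub_sq_real, norm_sub_sq_real, norm_smul]
  simp only [inner_add_left, inner_add_right, inner_smul_left, inner_smul_right, mul_pow,
    conj_trivial, Real.norm_eq_abs, sq_abs]
  rw [real_inner_comm X v, real_inner_comm X q]
  rw [Complex.ofReal_exp, Complex.ofReal_exp]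
  simp only [← Complex.exp_add]
  congr 1
  have hbb : b = (b.re : ℂ) + b.im * Complex.I := (Complex.re_add_im b).symm
  generalize b.re = r at *
  generalize b.im = m at *
  subst hbb
  have hR' : (r : ℂ) + π ≠ 0 := by exact_mod_cast hR
  have hπ' : (π : ℂ) ≠ 0 := by exact_mod_cast hπ.ne'
  push_cast
  field_simp
  ring

lemma norm_integral_chirp_le {b : ℂ} (hb : 0 < b.re) (θ : ℝ) :
    ∃ C : ℝ, 0 ≤ C ∧ ∃ ε : ℝ, 0 < ε ∧ ∀ ξ y c u : Euc d,
      ‖∫ x, Complex.exp (-(((2 * π * ⟪ξ, x⟫ : ℝ) : ℂ) * Complex.I)) *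
        Complex.exp (-(((θ * ‖x - y‖ ^ 2 : ℝ) : ℂ) * Complex.I)) *
        Complex.exp (-b * ((‖x - c‖ ^ 2 : ℝ) : ℂ)) *
        ((Real.exp (-π * ‖x - u‖ ^ 2) : ℝ) : ℂ)‖ ≤
      C * (Real.exp (-ε * ‖u - c‖ ^ 2) *
        Real.exp (-ε * ‖ξ + (θ / π) • (c - y)‖ ^ 2)) := by
  have hπ := Real.pi_pos
  set β : ℂ := b + π + θ * Complex.I with hβ
  have hβre : β.re = b.re + π := by simp [hβ]
  have hβpos : 0 < β.re := by rw [hβre]; positivity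
  have hβ0 : β ≠ 0 := fun h => by rw [h] at hβpos; simp at hβpos
  set κ : ℝ := π * (b.re / (b.re + π)) with hκ
  set σ : ℝ := (b.im + θ) / (b.re + π) with hσ
  set ρ : ℝ := ((π ^ 2 / β : ℂ)).re with hρ
  have hκpos : 0 < κ := by positivity
  have hρpos : 0 < ρ := by
    rw [hρ, show ((π : ℂ) ^ 2 / β) = ((π ^ 2 : ℝ) : ℂ) * β⁻¹ by push_cast; rfl,
      Complex.re_ofReal_mul, Complex.inv_re]
    have := Complex.normSq_pos.2 hβ0
    positivity
  refine ⟨‖((π : ℂ) / β) ^ ((d : ℂ) / 2)‖, norm_nonneg _,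
    min (κ / (1 + 2 * σ ^ 2)) (ρ / 2), by positivity, fun ξ y c u => ?_⟩
  set ε := min (κ / (1 + 2 * σ ^ 2)) (ρ / 2) with hε
  have hεpos : 0 < ε := by positivity
  have hε1 : ε * (1 + 2 * σ ^ 2) ≤ κ := by
    rw [← le_div_iff₀ (by positivity)]
    exact min_le_left _ _
  have hε2 : 2 * ε ≤ ρ := by
    have : ε ≤ ρ / 2 := min_le_right _ _
    linarith
  simp_rw [chirp_mul_gauss_mul_window hb θ ξ y c u]
  rw [integral_const_mul, ← hβ, integral_fourier_cexp_sq hβpos, norm_mul, norm_mul, norm_mul,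
    norm_mul, norm_cexp_neg_ofReal_mul_I, norm_cexp_neg_ofReal_mul_I, norm_cexp_neg_mul_sq,
    Complex.norm_real, Real.norm_of_nonneg (Real.exp_nonneg _), mul_one, one_mul, mul_left_comm]
  refine mul_le_mul_of_nonneg_left ?_ (norm_nonneg _)
  rw [← Real.exp_add, ← Real.exp_add, Real.exp_le_exp, ← hρ]
  set η := ξ + (θ / π) • (c - y) with hη
  have h1 := norm_sq_le_two_mul_add η (-(σ • (u - c)))
  rw [sub_neg_eq_add, norm_neg, norm_smul, mul_pow, Real.norm_eq_abs, sq_abs] at h1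
  have h2 := mul_le_mul_of_nonneg_right hε1 (sq_nonneg ‖u - c‖)
  have h3 := mul_le_mul_of_nonneg_right hε2 (sq_nonneg ‖η + σ • (u - c)‖)
  have h4 := mul_le_mul_of_nonneg_left h1 hεpos.le
  linarith

lemma exp_window_mul_le {ε r δ κ : ℝ} (hδ : 0 < δ) (h1 : 2 * δ ≤ ε)
    (h2 : 8 * κ ^ 2 * δ ≤ r) (h3 : 8 * δ ≤ r) (h4 : 2 * δ ≤ π) (A Y v : Euc d) :
    Real.exp (-ε * ‖A + κ • Y‖ ^ 2) * (Real.exp (-r * ‖Y‖ ^ 2) * Real.exp (-π * ‖Y - v‖ ^ 2)) ≤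
      Real.exp (-δ * ‖A‖ ^ 2) * Real.exp (-δ * ‖v‖ ^ 2) * Real.exp (-(r / 2) * ‖Y‖ ^ 2) := by
  simp only [← Real.exp_add]
  rw [Real.exp_le_exp]
  have e1 := norm_sq_le_two_mul_add A (-(κ • Y))
  rw [sub_neg_eq_add, norm_neg, norm_smul, mul_pow, Real.norm_eq_abs, sq_abs] at e1
  have e2 := norm_sq_le_two_mul_add v Y
  rw [norm_sub_rev] at e2
  have f1 := mul_le_mul_of_nonneg_left e1 hδ.le
  have f2 := mul_le_mul_of_nonneg_left e2 hδ.le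
  have g1 := mul_le_mul_of_nonneg_right h1 (sq_nonneg ‖A + κ • Y‖)
  have g2 := mul_le_mul_of_nonneg_right h2 (sq_nonneg ‖Y‖)
  have g3 := mul_le_mul_of_nonneg_right h3 (sq_nonneg ‖Y‖)
  have g4 := mul_le_mul_of_nonneg_right h4 (sq_nonneg ‖Y - v‖)
  linarith

/-- The Gaussian wave packet `e^{-2πi⟪ξ,x⟫} e^{-b|x-c|²}` seen through the window at `u`. -/
def winPacket (b : ℂ) (ξ c u x : Euc d) : ℂ :=
  Complex.exp (-(((2 * π * ⟪ξ, x⟫ : ℝ) : ℂ) * Complex.I)) *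
    Complex.exp (-b * ((‖x - c‖ ^ 2 : ℝ) : ℂ)) * ((Real.exp (-π * ‖x - u‖ ^ 2) : ℝ) : ℂ)

lemma norm_winPacket (b : ℂ) (ξ c u x : Euc d) : ‖winPacket b ξ c u x‖ =
    Real.exp (-b.re * ‖x - c‖ ^ 2) * Real.exp (-π * ‖x - u‖ ^ 2) := by
  unfold winPacket
  rw [norm_mul, norm_mul, norm_cexp_neg_ofReal_mul_I, norm_cexp_neg_mul_sq, one_mul,
    Complex.norm_real, Real.norm_of_nonneg (Real.exp_nonneg _)]

/-- The phase `e^{-iθ|x-y|²}`. -/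
def chirp (θ : ℝ) (x y : Euc d) : ℂ :=
  Complex.exp (-(((θ * ‖x - y‖ ^ 2 : ℝ) : ℂ) * Complex.I))

lemma chirp_comm (θ : ℝ) (x y : Euc d) : chirp θ x y = chirp θ y x := by
  unfold chirp
  rw [norm_sub_rev]

lemma norm_integral_chirp_pair_le_aux {b₁ b₂ : ℂ} (hb₁ : 0 < b₁.re) (hb₂ : 0 < b₂.re) (θ : ℝ) :
    ∃ C : ℝ, 0 ≤ C ∧ ∃ δ : ℝ, 0 < δ ∧ ∀ ξ₁ c₁ u₁ ξ₂ c₂ u₂ : Euc d,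
      ‖∫ v : Euc d × Euc d, winPacket b₁ ξ₁ c₁ u₁ v.1 * winPacket b₂ ξ₂ c₂ u₂ v.2 *
        chirp θ v.1 v.2‖ ≤
      C * (Real.exp (-δ * ‖u₁ - c₁‖ ^ 2) * Real.exp (-δ * ‖u₂ - c₂‖ ^ 2) *
        Real.exp (-δ * ‖ξ₁ + (θ / π) • (c₁ - c₂)‖ ^ 2)) := by
  have hπ := Real.pi_pos
  obtain ⟨C, hC, ε, hε, hA⟩ := norm_integral_chirp_le (d := d) hb₁ θ
  set r := b₂.re with hr
  set κ : ℝ := -(θ / π) with hκ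
  set δ : ℝ := min (ε / 2) (min (r / (8 * (κ ^ 2 + 1))) (π / 2)) with hδ
  have hδpos : 0 < δ := by positivity
  have h1 : 2 * δ ≤ ε := by have : δ ≤ ε / 2 := min_le_left _ _; linarith
  have h4 : 2 * δ ≤ π := by
    have : δ ≤ π / 2 := (min_le_right _ _).trans (min_le_right _ _); linarith
  have h23 : 8 * (κ ^ 2 + 1) * δ ≤ r := by
    have : δ ≤ r / (8 * (κ ^ 2 + 1)) := (min_le_right _ _).trans (min_le_left _ _)
    rw [le_div_iff₀ (by positivity)] at this
    linarith
  have h2 : 8 * κ ^ 2 * δ ≤ r := by nlinarith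
  have h3 : 8 * δ ≤ r := by nlinarith [mul_nonneg (sq_nonneg κ) hδpos.le]
  have hr2 : 0 < r / 2 := by positivity
  have hδε : δ ≤ ε := by linarith
  refine ⟨C * ∫ y : Euc d, Real.exp (-(r / 2) * ‖y - 0‖ ^ 2), by positivity, δ, hδpos,
    fun ξ₁ c₁ u₁ ξ₂ c₂ u₂ => ?_⟩
  by_cases hI : Integrable fun v : Euc d × Euc d =>
      winPacket b₁ ξ₁ c₁ u₁ v.1 * winPacket b₂ ξ₂ c₂ u₂ v.2 * chirp θ v.1 v.2
  swap
  · rw [integral_undef hI, norm_zero]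
    positivity
  rw [Measure.volume_eq_prod, integral_prod_symm _ hI]
  have hinner : ∀ y, ∫ x, winPacket b₁ ξ₁ c₁ u₁ x * winPacket b₂ ξ₂ c₂ u₂ y * chirp θ x y =
      winPacket b₂ ξ₂ c₂ u₂ y * ∫ x, Complex.exp (-(((2 * π * ⟪ξ₁, x⟫ : ℝ) : ℂ) * Complex.I)) *
        Complex.exp (-(((θ * ‖x - y‖ ^ 2 : ℝ) : ℂ) * Complex.I)) *
        Complex.exp (-b₁ * ((‖x - c₁‖ ^ 2 : ℝ) : ℂ)) *
        ((Real.exp (-π * ‖x - u₁‖ ^ 2) : ℝ) : ℂ) := by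
    intro y
    rw [← integral_const_mul]
    refine integral_congr_ae (Eventually.of_forall fun x => ?_)
    simp only [winPacket, chirp]
    ring
  simp only [hinner]
  have hg : Integrable fun y : Euc d => Real.exp (-(r / 2) * ‖y - c₂‖ ^ 2) :=
    integrable_rexp_sq hr2 c₂
  have hgi : ∫ y : Euc d, Real.exp (-(r / 2) * ‖y - 0‖ ^ 2) =
      ∫ y : Euc d, Real.exp (-(r / 2) * ‖y - c₂‖ ^ 2) := by
    rw [← integral_sub_right_eq_self (fun y : Euc d => Real.exp (-(r / 2) * ‖y - 0‖ ^ 2)) c₂]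
    simp
  rw [hgi, mul_right_comm, ← integral_const_mul]
  refine norm_integral_le_of_norm_le (hg.const_mul _) (Eventually.of_forall fun y => ?_)
  rw [norm_mul, norm_winPacket]
  have hk := exp_window_mul_le (d := d) (κ := κ) hδpos h1 h2 h3 h4
    (ξ₁ + (θ / π) • (c₁ - c₂)) (y - c₂) (u₂ - c₂)
  rw [show ξ₁ + (θ / π) • (c₁ - c₂) + κ • (y - c₂) = ξ₁ + (θ / π) • (c₁ - y) by
    rw [hκ]; module, sub_sub_sub_cancel_right] at hk
  have hu : Real.exp (-ε * ‖u₁ - c₁‖ ^ 2) ≤ Real.exp (-δ * ‖u₁ - c₁‖ ^ 2) := by gcongr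
  calc _ ≤ (Real.exp (-r * ‖y - c₂‖ ^ 2) * Real.exp (-π * ‖y - u₂‖ ^ 2)) *
        (C * (Real.exp (-δ * ‖u₁ - c₁‖ ^ 2) *
          Real.exp (-ε * ‖ξ₁ + (θ / π) • (c₁ - y)‖ ^ 2))) := by
        refine mul_le_mul_of_nonneg_left ((hA ξ₁ y c₁ u₁).trans ?_) (by positivity)
        gcongr
    _ = C * Real.exp (-δ * ‖u₁ - c₁‖ ^ 2) * (Real.exp (-ε * ‖ξ₁ + (θ / π) • (c₁ - y)‖ ^ 2) *
        (Real.exp (-r * ‖y - c₂‖ ^ 2) * Real.exp (-π * ‖y - u₂‖ ^ 2))) := by ring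
    _ ≤ C * Real.exp (-δ * ‖u₁ - c₁‖ ^ 2) * _ :=
        mul_le_mul_of_nonneg_left hk (by positivity)
    _ = _ := by ring

lemma norm_integral_chirp_pair_le {b₁ b₂ : ℂ} (hb₁ : 0 < b₁.re) (hb₂ : 0 < b₂.re) (θ : ℝ) :
    ∃ C : ℝ, 0 ≤ C ∧ ∃ δ : ℝ, 0 < δ ∧ ∀ ξ₁ c₁ u₁ ξ₂ c₂ u₂ : Euc d,
      ‖∫ v : Euc d × Euc d, winPacket b₁ ξ₁ c₁ u₁ v.1 * winPacket b₂ ξ₂ c₂ u₂ v.2 *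
        chirp θ v.1 v.2‖ ≤
      C * (Real.exp (-δ * ‖u₁ - c₁‖ ^ 2) * Real.exp (-δ * ‖u₂ - c₂‖ ^ 2) *
        (Real.exp (-δ * ‖ξ₁ + (θ / π) • (c₁ - c₂)‖ ^ 2) *
          Real.exp (-δ * ‖ξ₂ + (θ / π) • (c₂ - c₁)‖ ^ 2))) := by
  obtain ⟨C₁, hC₁, δ₁, hδ₁, h₁⟩ := norm_integral_chirp_pair_le_aux (d := d) hb₁ hb₂ θ
  obtain ⟨C₂, hC₂, δ₂, hδ₂, h₂⟩ := norm_integral_chirp_pair_le_aux (d := d) hb₂ hb₁ θ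
  set δ := min δ₁ δ₂ / 2 with hδ
  have hδpos : 0 < δ := by positivity
  have hd₁ : 2 * δ ≤ δ₁ := by have := min_le_left δ₁ δ₂; linarith
  have hd₂ : 2 * δ ≤ δ₂ := by have := min_le_right δ₁ δ₂; linarith
  have key : ∀ {D A₁ A₂ B₁ B₂ : ℝ}, 2 * δ ≤ D → 0 ≤ A₁ → 0 ≤ A₂ → 0 ≤ B₂ → B₂ ≤ B₁ →
      Real.exp (-D * A₁) * Real.exp (-D * A₂) * Real.exp (-D * B₁) ≤
        Real.exp (-δ * A₁) * Real.exp (-δ * A₂) *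
          (Real.exp (-δ * B₁) * Real.exp (-δ * B₂)) := by
    intro D A₁ A₂ B₁ B₂ hD hA₁ hA₂ hB₂ hB
    simp only [← Real.exp_add]
    rw [Real.exp_le_exp]
    have e1 := mul_le_mul_of_nonneg_right hD hA₁
    have e2 := mul_le_mul_of_nonneg_right hD hA₂
    have e3 := mul_le_mul_of_nonneg_right hD (hB₂.trans hB)
    have e4 := mul_le_mul_of_nonneg_left hB hδpos.le
    have e5 := mul_nonneg hδpos.le hA₁
    have e6 := mul_nonneg hδpos.le hA₂
    linarith
  refine ⟨max C₁ C₂, le_max_of_le_left hC₁, δ, hδpos, fun ξ₁ c₁ u₁ ξ₂ c₂ u₂ => ?_⟩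
  rcases le_total (‖ξ₂ + (θ / π) • (c₂ - c₁)‖ ^ 2) (‖ξ₁ + (θ / π) • (c₁ - c₂)‖ ^ 2) with h | h
  · refine (h₁ ξ₁ c₁ u₁ ξ₂ c₂ u₂).trans
      (mul_le_mul (le_max_left _ _) ?_ (by positivity) (le_max_of_le_left hC₁))
    exact key hd₁ (sq_nonneg _) (sq_nonneg _) (sq_nonneg _) h
  · have hsw : ∫ v : Euc d × Euc d, winPacket b₁ ξ₁ c₁ u₁ v.1 * winPacket b₂ ξ₂ c₂ u₂ v.2 *
        chirp θ v.1 v.2 = ∫ v : Euc d × Euc d, winPacket b₂ ξ₂ c₂ u₂ v.1 *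
          winPacket b₁ ξ₁ c₁ u₁ v.2 * chirp θ v.1 v.2 := by
      rw [Measure.volume_eq_prod, ← integral_prod_swap]
      refine integral_congr_ae (Eventually.of_forall fun v => ?_)
      simp only [Prod.fst_swap, Prod.snd_swap]
      rw [chirp_comm, mul_comm (winPacket b₂ ξ₂ c₂ u₂ v.1)]
    rw [hsw]
    refine (h₂ ξ₂ c₂ u₂ ξ₁ c₁ u₁).trans
      (mul_le_mul (le_max_right _ _) ?_ (by positivity) (le_max_of_le_left hC₁))
    refine (key hd₂ (sq_nonneg _) (sq_nonneg _) (sq_nonneg _) h).trans (le_of_eq ?_)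
    ring

end TrotterKernel

namespace TrotterKernel

variable {d : ℕ}

lemma packet_mul_window (s : ℝ) (z : Euc d × Euc d) (ξ u x : Euc d) :
    Complex.exp (-(((2 * π * ⟪ξ, x⟫ : ℝ) : ℂ) * Complex.I)) * packet s z x *
        ((Real.exp (-π * ‖x - u‖ ^ 2) : ℝ) : ℂ) =
      amp d s * Complex.exp (((2 * π ^ 2 * s * ‖z.2‖ ^ 2 : ℝ) : ℂ) * Complex.I) *
        winPacket (π / width s) (ξ - z.2) (ctr s z) u x := by
  unfold packet winPacket
  rw [inner_sub_left, show -(((2 * π * (⟪ξ, x⟫ - ⟪z.2, x⟫) : ℝ) : ℂ) * Complex.I) =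
    -(((2 * π * ⟪ξ, x⟫ : ℝ) : ℂ) * Complex.I) + ((2 * π * ⟪z.2, x⟫ : ℝ) : ℂ) * Complex.I by
      push_cast; ring, Complex.exp_add]
  ring

lemma conj_packet_mul_window (s : ℝ) (z : Euc d × Euc d) (ξ u x : Euc d) :
    Complex.exp (-(((2 * π * ⟪ξ, x⟫ : ℝ) : ℂ) * Complex.I)) * (starRingEnd ℂ) (packet s z x) *
        ((Real.exp (-π * ‖x - u‖ ^ 2) : ℝ) : ℂ) =
      (starRingEnd ℂ) (amp d s *
        Complex.exp (((2 * π ^ 2 * s * ‖z.2‖ ^ 2 : ℝ) : ℂ) * Complex.I)) *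
        winPacket ((starRingEnd ℂ) (π / width s)) (ξ + z.2) (ctr s z) u x := by
  unfold packet winPacket
  rw [inner_add_left, show -(((2 * π * (⟪ξ, x⟫ + ⟪z.2, x⟫) : ℝ) : ℂ) * Complex.I) =
    -(((2 * π * ⟪ξ, x⟫ : ℝ) : ℂ) * Complex.I) + -(((2 * π * ⟪z.2, x⟫ : ℝ) : ℂ) * Complex.I) by
      push_cast; ring, Complex.exp_add]
  have h1 : (starRingEnd ℂ) (Complex.exp (((2 * π * ⟪z.2, x⟫ : ℝ) : ℂ) * Complex.I)) =
      Complex.exp (-(((2 * π * ⟪z.2, x⟫ : ℝ) : ℂ) * Complex.I)) := by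
    rw [← Complex.exp_conj, map_mul, Complex.conj_ofReal, Complex.conj_I, mul_neg]
  have h2 : (starRingEnd ℂ) (Complex.exp (-(π / width s) * ((‖x - ctr s z‖ ^ 2 : ℝ) : ℂ))) =
      Complex.exp (-((starRingEnd ℂ) (π / width s)) * ((‖x - ctr s z‖ ^ 2 : ℝ) : ℂ)) := by
    rw [← Complex.exp_conj, map_mul, Complex.conj_ofReal, map_neg]
  rw [map_mul, map_mul, h1, h2]
  ring

/-- The integrand of the short-time Fourier transform of one term of a chirped kernel. -/
def stftTerm (T : L2Sp d →L[ℂ] L2Sp d) (t : ℝ) (u ζ : Euc d × Euc d)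
    (v : Euc d × Euc d) (p : (Euc d × Euc d) × (Euc d × Euc d)) : ℂ :=
  Complex.exp (-(((2 * π * (⟪ζ.1, v.1⟫ + ⟪ζ.2, v.2⟫) : ℝ) : ℂ) * Complex.I)) *
    (chirp (2 * t)⁻¹ v.1 v.2 * kernTerm T t v.1 v.2 p) * gaussWindow2 (v - u)

lemma stftTerm_eq (T : L2Sp d →L[ℂ] L2Sp d) (t : ℝ) (u ζ : Euc d × Euc d)
    (v : Euc d × Euc d) (p : (Euc d × Euc d) × (Euc d × Euc d)) :
    stftTerm T t u ζ v p = (coeff T p.1 p.2 *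
      (amp d 0 * Complex.exp (((2 * π ^ 2 * 0 * ‖p.1.2‖ ^ 2 : ℝ) : ℂ) * Complex.I) *
      (starRingEnd ℂ) (amp d t *
        Complex.exp (((2 * π ^ 2 * t * ‖p.2.2‖ ^ 2 : ℝ) : ℂ) * Complex.I)))) *
      (winPacket (π / width 0) (ζ.1 - p.1.2) (ctr 0 p.1) u.1 v.1 *
        winPacket ((starRingEnd ℂ) (π / width t)) (ζ.2 + p.2.2) (ctr t p.2) u.2 v.2 *
        chirp (2 * t)⁻¹ v.1 v.2) := by
  have h1 := packet_mul_window 0 p.1 ζ.1 u.1 v.1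
  have h2 := conj_packet_mul_window t p.2 ζ.2 u.2 v.2
  have hg : gaussWindow2 (v - u) = ((Real.exp (-π * ‖v.1 - u.1‖ ^ 2) : ℝ) : ℂ) *
      ((Real.exp (-π * ‖v.2 - u.2‖ ^ 2) : ℝ) : ℂ) := by
    unfold gaussWindow2
    rw [← Complex.ofReal_mul, ← Real.exp_add, ← mul_add]
    rfl
  unfold stftTerm kernTerm
  rw [hg, show -(((2 * π * (⟪ζ.1, v.1⟫ + ⟪ζ.2, v.2⟫) : ℝ) : ℂ) * Complex.I) =
    -(((2 * π * ⟪ζ.1, v.1⟫ : ℝ) : ℂ) * Complex.I) + -(((2 * π * ⟪ζ.2, v.2⟫ : ℝ) : ℂ) * Complex.I)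
      by push_cast; ring, Complex.exp_add]
  linear_combination coeff T p.1 p.2 * chirp (2 * t)⁻¹ v.1 v.2 *
    (Complex.exp (-(((2 * π * ⟪ζ.2, v.2⟫ : ℝ) : ℂ) * Complex.I)) *
      (starRingEnd ℂ) (packet t p.2 v.2) * ((Real.exp (-π * ‖v.2 - u.2‖ ^ 2) : ℝ) : ℂ)) * h1 +
    coeff T p.1 p.2 * chirp (2 * t)⁻¹ v.1 v.2 *
    (amp d 0 * Complex.exp (((2 * π ^ 2 * 0 * ‖p.1.2‖ ^ 2 : ℝ) : ℂ) * Complex.I) *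
        winPacket (π / width 0) (ζ.1 - p.1.2) (ctr 0 p.1) u.1 v.1) * h2

lemma norm_gaussWindow2 (v : Euc d × Euc d) : ‖gaussWindow2 v‖ =
    Real.exp (-π * ‖v.1‖ ^ 2) * Real.exp (-π * ‖v.2‖ ^ 2) := by
  unfold gaussWindow2
  rw [Complex.norm_real, Real.norm_of_nonneg (Real.exp_nonneg _), ← Real.exp_add, ← mul_add]

lemma continuous_gaussWindow2 : Continuous (gaussWindow2 (d := d)) := by
  unfold gaussWindow2
  fun_prop

lemma lintegral_enorm_gaussWindow2_sub (u : Euc d × Euc d) :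
    ∫⁻ v, ‖gaussWindow2 (v - u)‖ₑ = gaussMass d π * gaussMass d π := by
  have h := lintegral_sub_right_eq_self (μ := (volume : Measure (Euc d × Euc d)))
    (fun v : Euc d × Euc d => ‖gaussWindow2 v‖ₑ) u
  rw [h, Measure.volume_eq_prod]
  have h2 : ∀ v : Euc d × Euc d, ‖gaussWindow2 v‖ₑ =
      ENNReal.ofReal (Real.exp (-π * ‖v.1‖ ^ 2)) * ENNReal.ofReal (Real.exp (-π * ‖v.2‖ ^ 2)) := by
    intro v
    rw [← ofReal_norm, norm_gaussWindow2, ENNReal.ofReal_mul (Real.exp_nonneg _)]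
  simp_rw [h2]
  have hm : Measurable fun x : Euc d => ENNReal.ofReal (Real.exp (-π * ‖x‖ ^ 2)) := by fun_prop
  exact lintegral_prod_mul hm.aemeasurable hm.aemeasurable

lemma norm_chirp (θ : ℝ) (x y : Euc d) : ‖chirp θ x y‖ = 1 := norm_cexp_neg_ofReal_mul_I _

lemma integrable_stftTerm {T : L2Sp d →L[ℂ] L2Sp d} (hT : ∫⁻ h, env T h < ⊤) {t : ℝ}
    (ht : t ≠ 0) (u ζ : Euc d × Euc d) :
    Integrable (fun q : (Euc d × Euc d) × ((Euc d × Euc d) × (Euc d × Euc d)) =>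
      stftTerm T t u ζ q.1 q.2) (volume.prod volume) := by
  have hc : Continuous (fun q : (Euc d × Euc d) × ((Euc d × Euc d) × (Euc d × Euc d)) =>
      stftTerm T t u ζ q.1 q.2) := by
    have h1 := continuous_kernTerm T t
    have h2 : Continuous fun q : (Euc d × Euc d) × ((Euc d × Euc d) × (Euc d × Euc d)) =>
        gaussWindow2 (q.1 - u) := continuous_gaussWindow2.comp (by fun_prop)
    unfold stftTerm chirp
    fun_prop
  refine ⟨hc.aestronglyMeasurable, ?_⟩
  have hm := hc.enorm.measurable
  rw [hasFiniteIntegral_iff_enorm, lintegral_prod _ hm.aemeasurable]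
  set K := ENNReal.ofReal (winConst d * ‖amp d t‖) *
    ((gaussMass d (rate t) * gaussMass d (rate t * (2 * π * t) ^ 2)) * ∫⁻ h, env T h) with hK
  have hKtop : K < ⊤ := by
    have hc : 0 < (2 * π * t) ^ 2 := by have := Real.pi_ne_zero; positivity
    have hr := rate_pos t
    exact ENNReal.mul_lt_top ENNReal.ofReal_lt_top (ENNReal.mul_lt_top
      (ENNReal.mul_lt_top (gaussMass_lt_top hr) (gaussMass_lt_top (by positivity))) hT)
  have h1 : ∀ v : Euc d × Euc d, ∫⁻ p, ‖stftTerm T t u ζ v p‖ₑ ≤ K * ‖gaussWindow2 (v - u)‖ₑ := by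
    intro v
    have h2 : ∀ p, ‖stftTerm T t u ζ v p‖ₑ =
        ‖kernTerm T t v.1 v.2 p‖ₑ * ‖gaussWindow2 (v - u)‖ₑ := by
      intro p
      unfold stftTerm
      rw [enorm_mul, enorm_mul, enorm_mul, ← ofReal_norm (Complex.exp _),
        norm_cexp_neg_ofReal_mul_I, ← ofReal_norm (chirp _ _ _), norm_chirp, ENNReal.ofReal_one,
        one_mul, one_mul]
    simp_rw [h2]
    rw [lintegral_mul_const' _ _ enorm_ne_top]
    exact mul_le_mul_left (lintegral_enorm_kernTerm_le T ht v.1 v.2) _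
  refine (lintegral_mono h1).trans_lt ?_
  rw [lintegral_const_mul' _ _ hKtop.ne, lintegral_enorm_gaussWindow2_sub]
  have := gaussMass_lt_top (d := d) Real.pi_pos
  exact ENNReal.mul_lt_top hKtop (ENNReal.mul_lt_top this this)

/-- A Gaussian in the frequency variable `ζ`, centred at a linear function of `h`. -/
def freqBump (δ t : ℝ) (ζ h : Euc d × Euc d) : ℝ≥0∞ :=
  ENNReal.ofReal (Real.exp (-δ * ‖ζ.1 - (h.2 - (2 * π * t)⁻¹ • h.1)‖ ^ 2)) *
    ENNReal.ofReal (Real.exp (-δ * ‖ζ.2 - (2 * π * t)⁻¹ • h.1‖ ^ 2))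

lemma measurable_freqBump (δ t : ℝ) :
    Measurable fun q : (Euc d × Euc d) × (Euc d × Euc d) => freqBump δ t q.1 q.2 := by
  have h1 : Continuous fun q : (Euc d × Euc d) × (Euc d × Euc d) =>
      Real.exp (-δ * ‖q.1.1 - (q.2.2 - (2 * π * t)⁻¹ • q.2.1)‖ ^ 2) := by fun_prop
  have h2 : Continuous fun q : (Euc d × Euc d) × (Euc d × Euc d) =>
      Real.exp (-δ * ‖q.1.2 - (2 * π * t)⁻¹ • q.2.1‖ ^ 2) := by fun_prop
  exact h1.measurable.ennreal_ofReal.mul h2.measurable.ennreal_ofReal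

lemma measurable_freqBump_left (δ t : ℝ) (h : Euc d × Euc d) :
    Measurable fun ζ => freqBump δ t ζ h := by
  unfold freqBump
  fun_prop

lemma measurable_freqBump_right (δ t : ℝ) (ζ : Euc d × Euc d) :
    Measurable fun h => freqBump δ t ζ h := by
  unfold freqBump
  fun_prop

lemma lintegral_freqBump (δ t : ℝ) (h : Euc d × Euc d) :
    ∫⁻ ζ, freqBump δ t ζ h = gaussMass d δ * gaussMass d δ := by
  have hm : ∀ c : Euc d, AEMeasurable
      (fun x : Euc d => ENNReal.ofReal (Real.exp (-δ * ‖x - c‖ ^ 2))) := fun c => by fun_prop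
  unfold freqBump
  refine (lintegral_prod_mul (hm (h.2 - (2 * π * t)⁻¹ • h.1)) (hm ((2 * π * t)⁻¹ • h.1))).trans ?_
  rw [lintegral_gauss_sub, lintegral_gauss_sub]

/-- The amplitude of `kern T t` with respect to the phase of the free propagator. -/
def kernAmp (T : L2Sp d →L[ℂ] L2Sp d) (t : ℝ) (v : Euc d × Euc d) : ℂ :=
  Complex.exp (-(Complex.I * ((‖v.1 - v.2‖ ^ 2 / (2 * t) : ℝ) : ℂ))) * kern T t v.1 v.2

lemma kernAmp_eq (T : L2Sp d →L[ℂ] L2Sp d) (t : ℝ) (v : Euc d × Euc d) :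
    kernAmp T t v = ∫ p, chirp (2 * t)⁻¹ v.1 v.2 * kernTerm T t v.1 v.2 p := by
  rw [integral_const_mul]
  unfold kernAmp chirp kern
  rw [mul_comm Complex.I, div_eq_inv_mul]

lemma STFT2_kernAmp {T : L2Sp d →L[ℂ] L2Sp d} (hT : ∫⁻ h, env T h < ⊤) {t : ℝ}
    (ht : t ≠ 0) (u ζ : Euc d × Euc d) :
    STFT2 (kernAmp T t) u ζ = ∫ p, ∫ v, stftTerm T t u ζ v p := by
  have hI := integrable_stftTerm hT ht u ζ
  rw [← integral_integral_swap hI]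
  unfold STFT2 stftTerm
  refine integral_congr_ae (Eventually.of_forall fun v => ?_)
  simp only
  rw [integral_mul_const, integral_const_mul, kernAmp_eq]

lemma exists_enorm_integral_stftTerm_le (d : ℕ) {t : ℝ} (ht : t ≠ 0) :
    ∃ C : ℝ, ∃ δ : ℝ, 0 < δ ∧ ∀ (T : L2Sp d →L[ℂ] L2Sp d) (u ζ : Euc d × Euc d)
      (p : (Euc d × Euc d) × (Euc d × Euc d)),
      ‖∫ v, stftTerm T t u ζ v p‖ₑ ≤ ENNReal.ofReal C *
        ((env T (p.1 - p.2) * freqBump δ t ζ (p.1 - p.2)) * bump δ t u.1 u.2 p.1.1 p.2) := by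
  have hπ := Real.pi_pos
  have hb₁ : 0 < ((π : ℂ) / width 0).re := by rw [pi_div_width_re]; exact rate_pos 0
  have hb₂ : 0 < ((starRingEnd ℂ) ((π : ℂ) / width t)).re := by
    rw [Complex.conj_re, pi_div_width_re]; exact rate_pos t
  obtain ⟨C, hC, δ, hδ, hJ⟩ := norm_integral_chirp_pair_le (d := d) hb₁ hb₂ (2 * t)⁻¹
  refine ⟨‖amp d 0‖ * ‖amp d t‖ * C, δ, hδ, fun T u ζ p => ?_⟩
  simp_rw [stftTerm_eq]
  rw [integral_const_mul, enorm_mul, enorm_mul, mul_assoc]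
  have hctr : ctr 0 p.1 = p.1.1 := by simp [ctr]
  have hJ' := hJ (ζ.1 - p.1.2) (ctr 0 p.1) u.1 (ζ.2 + p.2.2) (ctr t p.2) u.2
  rw [hctr] at hJ' ⊢
  have hθ : (2 * t)⁻¹ / π = (2 * π * t)⁻¹ := by field_simp
  have hc : (2 * π * t)⁻¹ * (2 * π * t) = 1 := inv_mul_cancel₀ (by positivity)
  have e1 : ζ.1 - p.1.2 + ((2 * t)⁻¹ / π) • (p.1.1 - ctr t p.2) =
      ζ.1 - ((p.1 - p.2).2 - (2 * π * t)⁻¹ • (p.1 - p.2).1) := by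
    rw [hθ]
    simp only [ctr, Prod.fst_sub, Prod.snd_sub, smul_sub, smul_smul, hc, one_smul]
    abel
  have e2 : ζ.2 + p.2.2 + ((2 * t)⁻¹ / π) • (ctr t p.2 - p.1.1) =
      ζ.2 - (2 * π * t)⁻¹ • (p.1 - p.2).1 := by
    rw [hθ]
    simp only [ctr, Prod.fst_sub, smul_sub, smul_smul, hc, one_smul]
    abel
  rw [e1, e2] at hJ'
  have hA : ‖amp d 0 * Complex.exp (((2 * π ^ 2 * 0 * ‖p.1.2‖ ^ 2 : ℝ) : ℂ) * Complex.I) *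
      (starRingEnd ℂ) (amp d t *
        Complex.exp (((2 * π ^ 2 * t * ‖p.2.2‖ ^ 2 : ℝ) : ℂ) * Complex.I))‖ₑ =
      ENNReal.ofReal (‖amp d 0‖ * ‖amp d t‖) := by
    rw [← ofReal_norm, norm_mul, RCLike.norm_conj, norm_mul, norm_mul,
      Complex.norm_exp_ofReal_mul_I, Complex.norm_exp_ofReal_mul_I, mul_one, mul_one]
  rw [hA]
  have hJe := ENNReal.ofReal_le_ofReal hJ'
  rw [ofReal_norm, ENNReal.ofReal_mul hC, ENNReal.ofReal_mul (by positivity),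
    ENNReal.ofReal_mul (p := Real.exp (-δ * ‖ζ.1 - _‖ ^ 2)) (by positivity)] at hJe
  refine (mul_le_mul' (enorm_coeff_le T p.1 p.2) (mul_le_mul_right hJe _)).trans (le_of_eq ?_)
  rw [ENNReal.ofReal_mul (p := ‖amp d 0‖ * ‖amp d t‖) (by positivity)]
  unfold freqBump bump
  ring

lemma exists_lintegral_STFT2_le (d : ℕ) {t : ℝ} (ht : t ≠ 0) :
    ∃ K : ℝ≥0∞, K < ⊤ ∧ ∀ T : L2Sp d →L[ℂ] L2Sp d, ∫⁻ h, env T h < ⊤ →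
      ∫⁻ ζ, ⨆ u, ‖STFT2 (kernAmp T t) u ζ‖ₑ ≤ K * ∫⁻ h, env T h := by
  obtain ⟨C, δ, hδ, hJ⟩ := exists_enorm_integral_stftTerm_le d ht
  have hc : 0 < (2 * π * t) ^ 2 := by have := Real.pi_ne_zero; positivity
  set G := gaussMass d δ * gaussMass d (δ * (2 * π * t) ^ 2) with hG
  have hGtop : G < ⊤ :=
    ENNReal.mul_lt_top (gaussMass_lt_top hδ) (gaussMass_lt_top (by positivity))
  have hg := gaussMass_lt_top (d := d) hδ
  refine ⟨ENNReal.ofReal C * G * (gaussMass d δ * gaussMass d δ), ENNReal.mul_lt_top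
    (ENNReal.mul_lt_top ENNReal.ofReal_lt_top hGtop) (ENNReal.mul_lt_top hg hg), fun T hT => ?_⟩
  have hsup : ∀ ζ : Euc d × Euc d, ⨆ u, ‖STFT2 (kernAmp T t) u ζ‖ₑ ≤
      ENNReal.ofReal C * G * ∫⁻ h, env T h * freqBump δ t ζ h := by
    intro ζ
    refine iSup_le fun u => ?_
    have hmΦ : Measurable fun h : Euc d × Euc d => env T h * freqBump δ t ζ h :=
      (measurable_env T).mul (measurable_freqBump_right δ t ζ)
    have hpair := lintegral_pair_bump δ ht u.1 u.2 hmΦ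
    rw [STFT2_kernAmp hT ht]
    refine (enorm_integral_le_lintegral_enorm _).trans
      ((lintegral_mono fun p => hJ T u ζ p).trans (le_of_eq ?_))
    rw [lintegral_const_mul' _ _ ENNReal.ofReal_ne_top, mul_assoc]
    exact congrArg _ hpair
  refine (lintegral_mono hsup).trans (le_of_eq ?_)
  rw [lintegral_const_mul' _ _ (ENNReal.mul_lt_top ENNReal.ofReal_lt_top hGtop).ne]
  refine Eq.trans (congrArg (ENNReal.ofReal C * G * ·) ?_) (mul_assoc _ _ _).symm
  have hm : Measurable fun q : (Euc d × Euc d) × (Euc d × Euc d) =>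
      env T q.2 * freqBump δ t q.1 q.2 :=
    ((measurable_env T).comp measurable_snd).mul (measurable_freqBump δ t)
  rw [lintegral_lintegral_swap hm.aemeasurable, ← lintegral_const_mul _ (measurable_env T)]
  refine lintegral_congr fun h => ?_
  rw [lintegral_const_mul _ (measurable_freqBump_left δ t h), lintegral_freqBump, mul_comm]

end TrotterKernel

namespace TrotterKernel

variable {d : ℕ} {F : L2Sp d ≃ₗᵢ[ℂ] L2Sp d} {U₀ : ℝ → L2Sp d →L[ℂ] L2Sp d}

lemma IsFree.trotter_apply_free (hU : IsFree F U₀) (E : L2Sp d →L[ℂ] L2Sp d) (t : ℝ) {n : ℕ}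
    (hn : 1 ≤ n) (f : L2Sp d) :
    trotter U₀ E (t / n) n (U₀ t f) = (((U₀ (t / n)).comp E) ^ n) f := by
  have hn0 : (n : ℝ) ≠ 0 := by positivity
  unfold trotter
  rw [ContinuousLinearMap.comp_apply, hU.apply_apply, mul_div_cancel₀ _ hn0, neg_add_cancel,
    hU.zero_apply]

end TrotterKernel

open TrotterKernel

/-- **Pointwise convergence of integral kernels of Trotter approximations of Feynman
path integrals, for potentials in the Sjöstrand class `M^{∞,1}(ℝ^d)`**
(Nicola–Trapasso): for `t ≠ 0` the Trotter approximations `E_n(t) = (U₀(t/n) M_{t/n})^n`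
have continuous integral kernels `e_n`; the amplitudes
`a_n(x,y) = e^{-i|x-y|²/(2t)} e_n(x,y)` form a bounded subset of `M^{∞,1}(ℝ^{2d})`; and
`e_n` converges uniformly on compact subsets to a continuous function `u_t`, the
integral kernel of the propagator `U(t) = lim_n E_n(t)`. Here `F` is the
Fourier–Plancherel transform, `U₀` the free propagator, `Mul` multiplication by
`e^{-iτV}`, and `ι` the embedding `𝓢 ↪ L²`. -/
theorem trotter_kernels_pointwise_convergence_sjostrand
    {d : ℕ} (hd : 1 ≤ d)
    (V : Euc d → ℝ) (hVcont : Continuous V) (hVbdd : ∃ M : ℝ, ∀ x, |V x| ≤ M)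
    (hVmod : (∫⁻ ξ : Euc d, ⨆ x : Euc d,
      (‖STFT (fun x => (V x : ℂ)) x ξ‖₊ : ℝ≥0∞)) < ⊤)
    (F : L2Sp d ≃ₗᵢ[ℂ] L2Sp d)
    (hF : ∀ f : L2Sp d, Integrable (f : Euc d → ℂ) →
      (F f : Euc d → ℂ) =ᵐ[volume] fun ξ =>
        ∫ x, Complex.exp (-(((2 * π * ⟪ξ, x⟫ : ℝ) : ℂ) * Complex.I)) * f x)
    (U₀ : ℝ → L2Sp d →L[ℂ] L2Sp d)
    (hU₀ : ∀ (τ : ℝ) (f : L2Sp d),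
      (F (U₀ τ f) : Euc d → ℂ) =ᵐ[volume] fun ξ =>
        Complex.exp (-(((2 * π ^ 2 * τ * ‖ξ‖ ^ 2 : ℝ) : ℂ) * Complex.I)) *
          (F f : Euc d → ℂ) ξ)
    (Mul : ℝ → L2Sp d →L[ℂ] L2Sp d)
    (hMul : ∀ (τ : ℝ) (f : L2Sp d),
      (Mul τ f : Euc d → ℂ) =ᵐ[volume] fun x =>
        Complex.exp (-(((τ * V x : ℝ) : ℂ) * Complex.I)) * f x)
    (ι : SchwartzMap (Euc d) ℂ → L2Sp d)
    (hι : ∀ φ : SchwartzMap (Euc d) ℂ, (ι φ : Euc d → ℂ) =ᵐ[volume] fun x => φ x)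
    (t : ℝ) (ht : t ≠ 0) :
    ∃ (e : ℕ → Euc d → Euc d → ℂ) (u : Euc d → Euc d → ℂ),
      (∀ n : ℕ, 1 ≤ n → Continuous fun p : Euc d × Euc d => e n p.1 p.2) ∧
      (∀ n : ℕ, 1 ≤ n → ∀ φ : SchwartzMap (Euc d) ℂ,
        ((((U₀ (t / n)).comp (Mul (t / n))) ^ n) (ι φ) : Euc d → ℂ) =ᵐ[volume]
          fun x => ∫ y, e n x y * φ y) ∧
      (∃ B : ℝ≥0∞, B < ⊤ ∧ ∀ n : ℕ, 1 ≤ n →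
        (∫⁻ ζ : Euc d × Euc d, ⨆ u' : Euc d × Euc d,
          (‖STFT2 (fun p : Euc d × Euc d =>
            Complex.exp (-(Complex.I * ((‖p.1 - p.2‖ ^ 2 / (2 * t) : ℝ) : ℂ))) *
              e n p.1 p.2) u' ζ‖₊ : ℝ≥0∞)) ≤ B) ∧
      Continuous (fun p : Euc d × Euc d => u p.1 p.2) ∧
      (∀ K : Set (Euc d × Euc d), IsCompact K →
        TendstoUniformlyOn (fun (n : ℕ) (p : Euc d × Euc d) => e n p.1 p.2)
          (fun p => u p.1 p.2) atTop K) ∧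
      (∀ φ : SchwartzMap (Euc d) ℂ,
        ∃ ψ : L2Sp d,
          Tendsto (fun n : ℕ => (((U₀ (t / n)).comp (Mul (t / n))) ^ n) (ι φ))
            atTop (𝓝 ψ) ∧
          (ψ : Euc d → ℂ) =ᵐ[volume] fun x => ∫ y, u x y * φ y) := by
  obtain ⟨M, hM⟩ := hVbdd
  have hU : IsFree F U₀ := ⟨hF, hU₀⟩
  have hMul' : ∀ τ : ℝ,
      IsMulBy (fun x => Complex.exp (-(τ : ℂ) * Complex.I * (V x : ℂ))) (Mul τ) := by
    intro τ f
    filter_upwards [hMul τ f] with x hx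
    rw [hx]
    congr 2
    push_cast
    ring
  obtain ⟨W, hlim, β, hβ⟩ := hU.exists_trotter_limit hVcont hM hVmod hMul' t
  set T : ℕ → L2Sp d →L[ℂ] L2Sp d := fun n => trotter U₀ (Mul (t / n)) (t / n) n with hTdef
  have hiso : ∀ n f, ‖T n f‖ = ‖f‖ := fun n f =>
    hU.norm_trotter_apply (fun g => (hMul' _).norm_apply_eq
      (fun x => by rw [Complex.norm_exp]; simp) g) _ n f
  have hT1 : ∀ n, ‖T n‖ ≤ 1 := fun n =>
    ContinuousLinearMap.opNorm_le_bound _ zero_le_one fun f => by rw [hiso, one_mul]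
  have hW1 : ‖W‖ ≤ 1 := ContinuousLinearMap.opNorm_le_bound _ zero_le_one fun f => by
    rw [one_mul]
    exact le_of_tendsto' (hlim f).norm fun n => (hiso n f).le
  obtain ⟨N, hNW, hNT⟩ := (hβ 0).exists
  have hWβ : ∫⁻ h, env W h ≤ β := (lintegral_env_le_sj W 0 N).trans hNW
  have hTβ : ∀ n, 1 ≤ n → ∫⁻ h, env (T n) h ≤ β := fun n hn =>
    (lintegral_env_le_sj (T n) 0 N).trans (hNT n hn)
  have hW : ∫⁻ h, env W h < ⊤ := hWβ.trans_lt ENNReal.coe_lt_top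
  have hT : ∀ n, 1 ≤ n → ∫⁻ h, env (T n) h < ⊤ := fun n hn =>
    (hTβ n hn).trans_lt ENNReal.coe_lt_top
  obtain ⟨K, hK, hSTFT⟩ := exists_lintegral_STFT2_le d ht
  refine ⟨fun n => kern (T n) t, kern W t, fun n hn => continuous_kern (hT n hn) ht,
    fun n hn φ => ?_, ⟨K * β, ENNReal.mul_lt_top hK ENNReal.coe_lt_top, fun n hn => ?_⟩,
    continuous_kern hW ht, fun C hC => tendstoUniformlyOn_kern hT1 hW1 hlim hβ ht hC,
    fun φ => ⟨W (U₀ t (ι φ)), ?_, hU.apply_eq_integral_kern hW ht φ.integrable (hι φ)⟩⟩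
  · rw [← hU.trotter_apply_free _ t hn]
    exact hU.apply_eq_integral_kern (hT n hn) ht φ.integrable (hι φ)
  · exact (hSTFT (T n) (hT n hn)).trans (mul_le_mul_right (hTβ n hn) K)
  · refine (hlim (U₀ t (ι φ))).congr' ?_
    filter_upwards [eventually_ge_atTop 1] with n hn
    exact hU.trotter_apply_free _ t hn _
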